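/- Fix θ > 0 and an integer m ≥ 1. Let {a(N) ∈ 𝒫_N}_{N≥1} be a regular sequence of ordered tuples with limiting measure μ, and assume Var[μ] > 0. For each N > m, let (a_j^{(k,N)})_{1≤j≤k≤N−1} be distributed according to the orbital beta process 𝕄^{a(N),θ} with top level a(N). Then, as N → ∞, the random m(m+1)/2-dimensional vectors ( (a_i^{(k,N)} − N·𝔼[μ_N])/√(N·Var[μ]) )_{1≤i≤k≤m}, where μ_N := (1/N)∑_{i=1}^N δ_{a(N)_i/N}, converge weakly (in distribution) to the Gaussian beta corners process 𝕄^{(θ)}_{m,corners}. -/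

import Mathlib

open MeasureTheory Filter Topology
open scoped ENNReal

noncomputable section

/-- A triangular array with `M` levels: for `k : Fin M`, level `k+1` has `k+1` real entries. -/
abbrev Tri (M : ℕ) := ∀ k : Fin M, Fin (k.1 + 1) → ℝ

/-- `Interlaces u v` means `u ≺ v`, i.e. `v 1 > u 1 > v 2 > u 2 > ⋯ > v n > u n > v (n+1)`. -/
def Interlaces {n : ℕ} (u : Fin n → ℝ) (v : Fin (n + 1) → ℝ) : Prop :=
  ∀ i : Fin n, u i < v i.castSucc ∧ v i.succ < u i

/-- Level `k+1` (for `k < N`) of the configuration consisting of the triangular array `x`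
(levels `1, …, N-1`) together with the top level `a` (level `N`). -/
def lvl {N : ℕ} (a : Fin N → ℝ) (x : Tri (N - 1)) (k : ℕ) (hk : k < N) :
    Fin (k + 1) → ℝ :=
  if h : k < N - 1 then fun i => x ⟨k, h⟩ i
  else fun i => a ⟨i.1, by have := i.isLt; omega⟩

/-- The (unnormalized) density of the orbital beta process with top level `a`. -/
def obpWt (θ : ℝ) {N : ℕ} (a : Fin N → ℝ) (x : Tri (N - 1)) : ℝ :=
  ∏ k : Fin (N - 1),
    ((∏ i : Fin (k.1 + 1), ∏ j : Fin (k.1 + 1),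
        if i < j then |x k i - x k j| ^ (2 - 2 * θ) else 1) *
      ∏ s : Fin (k.1 + 2), ∏ r : Fin (k.1 + 1),
        |lvl a x (k.1 + 1) (by have := k.isLt; omega) s - x k r| ^ (θ - 1))

/-- The interlacing scheme `𝒫(a)`: arrays `(a⁽¹⁾ ≺ a⁽²⁾ ≺ ⋯ ≺ a⁽ᴺ⁻¹⁾ ≺ a)`. -/
def obpDomain {N : ℕ} (a : Fin N → ℝ) : Set (Tri (N - 1)) :=
  {x | ∀ k : Fin (N - 1),
      Interlaces (x k) (lvl a x (k.1 + 1) (by have := k.isLt; omega))}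

/-- The orbital beta process `𝕄^{a,θ}` with top level `a`. -/
def obp (θ : ℝ) {N : ℕ} (a : Fin N → ℝ) : Measure (Tri (N - 1)) :=
  (ENNReal.ofReal (∫ x in obpDomain a, obpWt θ a x))⁻¹ •
    volume.withDensity fun x =>
      ENNReal.ofReal ((obpDomain a).indicator (obpWt θ a) x)

/-- The Weyl chamber `𝒲_m = {x : x 0 ≥ x 1 ≥ ⋯}`. -/
def weylChamber (m : ℕ) : Set (Fin m → ℝ) :=
  {x | ∀ i j : Fin m, i ≤ j → x j ≤ x i}

/-- The (unnormalized) density of the Gaussian beta ensemble. -/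
def gbeWt (θ : ℝ) (m : ℕ) (x : Fin m → ℝ) : ℝ :=
  (∏ i : Fin m, ∏ j : Fin m, if i < j then |x i - x j| ^ (2 * θ) else 1) *
    Real.exp (-(θ / 2) * ∑ i, x i ^ 2)

/-- The Gaussian beta ensemble `𝕄^{(θ)}_m` of rank `m`. -/
def gbe (θ : ℝ) (m : ℕ) : Measure (Fin m → ℝ) :=
  (ENNReal.ofReal (∫ x in weylChamber m, gbeWt θ m x))⁻¹ •
    volume.withDensity fun x =>
      ENNReal.ofReal ((weylChamber m).indicator (gbeWt θ m) x)

/-- The empirical measure `μ_N = (1/N) ∑ δ_{a_i/N}`. -/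
def empMeasure {N : ℕ} (a : Fin N → ℝ) : Measure ℝ :=
  ((N : ℝ≥0∞))⁻¹ • ∑ i : Fin N, Measure.dirac (a i / N)

/-- The mean `𝔼[ν]` of a measure on `ℝ`. -/
def meanM (ν : Measure ℝ) : ℝ := ∫ t, t ∂ν

/-- The variance `Var[ν]` of a measure on `ℝ`. -/
def varM (ν : Measure ℝ) : ℝ := (∫ t, t ^ 2 ∂ν) - meanM ν ^ 2

/-- A regular sequence of ordered tuples with limiting measure `μ`. -/
def RegularSeq (a : (N : ℕ) → Fin N → ℝ) (μ : Measure ℝ) : Prop :=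
  (∀ N : ℕ, 1 ≤ N → StrictAnti (a N)) ∧
  (∃ C : ℝ, ∀ N : ℕ, ∀ hN : 1 ≤ N,
      |a N ⟨0, by omega⟩| ≤ C * N ∧ |a N ⟨N - 1, by omega⟩| ≤ C * N) ∧
  IsProbabilityMeasure μ ∧
  (∃ R : ℝ, μ {t : ℝ | |t| ≤ R}ᶜ = 0) ∧
  ∀ f : BoundedContinuousFunction ℝ ℝ,
    Tendsto (fun N : ℕ => ∫ t, f t ∂empMeasure (a N)) atTop (𝓝 (∫ t, f t ∂μ))

/-- Projection of a triangular array (with top level of size `N`) to its `m`-th level. -/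
def levelProj {N : ℕ} (m : ℕ) (h1 : 1 ≤ m) (h2 : m < N) (x : Tri (N - 1)) :
    Fin m → ℝ :=
  fun i => x ⟨m - 1, by omega⟩ ⟨i.1, (by have := i.isLt; omega : i.1 < m - 1 + 1)⟩

/-- Projection of a triangular array to its bottom `m` levels. -/
def triProj {N : ℕ} (m : ℕ) (h : m < N) (x : Tri (N - 1)) : Tri m :=
  fun k i => x ⟨k.1, by have := k.isLt; omega⟩ ⟨i.1, i.isLt⟩

/-- The top level of a triangular array with `m` levels. -/
def topLvl {m : ℕ} (hm : 1 ≤ m) (x : Tri m) : Fin m → ℝ :=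
  fun i => x ⟨m - 1, by omega⟩ ⟨i.1, (by have := i.isLt; omega : i.1 < m - 1 + 1)⟩

/-- The Gelfand–Tsetlin polytope `𝒲_{m,corners}` (weak interlacing). -/
def gtPoly (m : ℕ) : Set (Tri m) :=
  {x | ∀ k : Fin m, ∀ hk : k.1 + 1 < m, ∀ i : Fin (k.1 + 1),
      x k i ≤ x ⟨k.1 + 1, hk⟩ i.castSucc ∧ x ⟨k.1 + 1, hk⟩ i.succ ≤ x k i}

/-- Unnormalized density of the Gaussian beta corners process with `m` levels. -/
def gbcWt (θ : ℝ) {m : ℕ} (hm : 1 ≤ m) (x : Tri m) : ℝ :=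
  (∏ i : Fin m, ∏ j : Fin m,
      if i < j then topLvl hm x i - topLvl hm x j else 1) *
    Real.exp (-(θ / 2) * ∑ i, topLvl hm x i ^ 2) *
    ∏ k : Fin (m - 1),
      ((∏ i : Fin (k.1 + 1), ∏ j : Fin (k.1 + 1),
          if i < j then
            |x ⟨k.1, by have := k.isLt; omega⟩ i -
              x ⟨k.1, by have := k.isLt; omega⟩ j| ^ (2 - 2 * θ)
          else 1) *
        ∏ i : Fin (k.1 + 1), ∏ j : Fin (k.1 + 2),
          |x ⟨k.1, by have := k.isLt; omega⟩ i -
            x ⟨k.1 + 1, by have := k.isLt; omega⟩ j| ^ (θ - 1))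

/-- The Gaussian beta corners process `𝕄^{(θ)}_{m,corners}`. -/
def gbc (θ : ℝ) {m : ℕ} (hm : 1 ≤ m) : Measure (Tri m) :=
  (ENNReal.ofReal (∫ x in gtPoly m, gbcWt θ hm x))⁻¹ •
    volume.withDensity fun x =>
      ENNReal.ofReal ((gtPoly m).indicator (gbcWt θ hm) x)

/-- Strict interlacing domain `x⁽¹⁾ ≺ x⁽²⁾ ≺ ⋯ ≺ x⁽ᵐ⁾` inside `Tri m`. -/
def triDomain (m : ℕ) : Set (Tri m) :=
  {x | ∀ k : Fin m, ∀ hk : k.1 + 1 < m, Interlaces (x k) (x ⟨k.1 + 1, hk⟩)}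

/-- The θ-Gibbs conditional density of the bottom `n` levels given level `n+1`. -/
def gibbsWt (θ : ℝ) (n : ℕ) (x : Tri (n + 1)) : ℝ :=
  ((∏ k : Fin (n + 1), Real.Gamma ((k.1 + 1) * θ)) /
      Real.Gamma θ ^ ((n + 1) * (n + 2) / 2)) *
    (∏ i : Fin (n + 1), ∏ j : Fin (n + 1),
      if i < j then
        (x ⟨n, Nat.lt_succ_self n⟩ i - x ⟨n, Nat.lt_succ_self n⟩ j) ^ (1 - 2 * θ)
      else 1) *
    ∏ k : Fin n,
      ((∏ i : Fin (k.1 + 1), ∏ j : Fin (k.1 + 1),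
          if i < j then
            (x ⟨k.1, by have := k.isLt; omega⟩ i -
              x ⟨k.1, by have := k.isLt; omega⟩ j) ^ (2 - 2 * θ)
          else 1) *
        ∏ i : Fin (k.1 + 1), ∏ j : Fin (k.1 + 2),
          |x ⟨k.1, by have := k.isLt; omega⟩ i -
            x ⟨k.1 + 1, by have := k.isLt; omega⟩ j| ^ (θ - 1))

/-- `|a⁽ᵏ⁾|`, the sum of the entries of level `k` (with `a⁽⁰⁾ := 0` and `a⁽ᴺ⁾ := a`). -/
def sumLvl {N : ℕ} (a : Fin N → ℝ) (x : Tri (N - 1)) (k : ℕ) : ℝ :=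
  if k = 0 then 0
  else if h : k - 1 < N - 1 then ∑ i, x ⟨k - 1, h⟩ i
  else ∑ i, a i

/-- The multivariate Bessel function `𝓑_a(y; θ)`, defined through its combinatorial
integral representation over the interlacing scheme with top level `a`. -/
def MBF (θ : ℝ) {N : ℕ} (a : Fin N → ℝ) (y : Fin N → ℂ) : ℂ :=
  ((((∏ k : Fin N, Real.Gamma ((k.1 + 1) * θ)) /
        Real.Gamma θ ^ (N * (N + 1) / 2)) : ℝ) : ℂ) *
    (((∏ i : Fin N, ∏ j : Fin N,
        if i < j then |a i - a j| ^ (1 - 2 * θ) else 1) : ℝ) : ℂ) *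
    ∫ x in obpDomain a,
      Complex.exp (∑ k : Fin N,
        y k * ((sumLvl a x (k.1 + 1) - sumLvl a x k.1 : ℝ) : ℂ)) *
      ((obpWt θ a x : ℝ) : ℂ)

/-- Padding of an `m`-tuple with `N - m` zeros: `(y_1, …, y_m, 0^{N-m})`. -/
def padC {m N : ℕ} (_h : m ≤ N) (y : Fin m → ℂ) : Fin N → ℂ :=
  fun k => if h' : k.1 < m then y ⟨k.1, h'⟩ else 0

/-- Integrand `exp(yz) ∏ (z - a_i)^{-θ}` of the left-directed contour integral,
with `w^{-θ} := exp(-θ Log w)` for the principal branch `Log`. -/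
def contourFnL (θ : ℝ) {N : ℕ} (a : Fin N → ℝ) (y z : ℂ) : ℂ :=
  Complex.exp (y * z) *
    ∏ i : Fin N, Complex.exp (-(θ : ℂ) * Complex.log (z - (a i : ℂ)))

/-- Integrand `exp(-yz) ∏ (a_i - z)^{-θ}` of the right-directed contour integral. -/
def contourFnR (θ : ℝ) {N : ℕ} (a : Fin N → ℝ) (y z : ℂ) : ℂ :=
  Complex.exp (-y * z) *
    ∏ i : Fin N, Complex.exp (-(θ : ℂ) * Complex.log ((a i : ℂ) - z))

/-- `(y_1, …, y_m, y_{m+1})` with `y_{m+1} := y - (z_1 + ⋯ + z_m)`. -/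
def Yext {m : ℕ} (ys : Fin m → ℝ) (y : ℝ) (z : Fin m → ℝ) : Fin (m + 1) → ℝ :=
  fun j => if h : j.1 < m then ys ⟨j.1, h⟩ else y - ∑ i, z i

/-- `(z_1, …, z_m, z_{m+1})` with `z_{m+1} := 0`. -/
def Zext {m : ℕ} (z : Fin m → ℝ) : Fin (m + 1) → ℝ :=
  fun j => if h : j.1 < m then z ⟨j.1, h⟩ else 0

/-- The function `G_{θ, y_1, …, y_m, y}(z_1, …, z_m)`. -/
def Gfn (θ : ℝ) {m : ℕ} (ys : Fin m → ℝ) (y : ℝ) (z : Fin m → ℝ) : ℝ :=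
  (∏ i : Fin m, ∏ j : Fin m,
      if i < j then (ys i - ys j + z i) ^ (θ - 1) else 1) *
    ∏ i : Fin (m + 1), ∏ j : Fin (m + 1),
      if i < j then
        (Yext ys y z i - Yext ys y z j + Zext z i - Zext z j) *
          (Yext ys y z i - Yext ys y z j - Zext z j) ^ (θ - 1)
      else 1

/-- The function `F_{y_1, …, y_m, y}(z_1, …, z_m)`. -/
def Ffn {m : ℕ} (ys : Fin m → ℝ) (y : ℝ) (z : Fin m → ℝ) : ℝ :=
  (1 - (∑ i, z i) / y) * ∏ i, (1 + z i / ys i)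

/-! ### Interlacing and Lagrange weights -/

/-- The absolute value of the Vandermonde product. -/
def vdm {n : ℕ} (x : Fin n → ℝ) : ℝ :=
  ∏ i : Fin n, ∏ j : Fin n, if i < j then |x i - x j| else 1

/-- The weights in the partial fraction expansion of `∏ (z - a r) / ∏ (z - b i)`. -/
def lagW {n : ℕ} (b : Fin (n + 1) → ℝ) (a : Fin n → ℝ) (i : Fin (n + 1)) : ℝ :=
  ∏ r, (b i - a r) / (b i - b (i.succAbove r))

lemma vdm_pos {n : ℕ} {x : Fin n → ℝ} (hx : Function.Injective x) : 0 < vdm x := by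
  refine Finset.prod_pos fun i _ => Finset.prod_pos fun j _ => ?_
  split_ifs with h
  · exact abs_pos.mpr (sub_ne_zero.mpr (hx.ne h.ne))
  · exact one_pos

lemma vdm_nonneg {n : ℕ} (x : Fin n → ℝ) : 0 ≤ vdm x := by
  refine Finset.prod_nonneg fun i _ => Finset.prod_nonneg fun j _ => ?_
  split_ifs <;> positivity

lemma Interlaces.strictAnti_left {n : ℕ} {a : Fin n → ℝ} {b : Fin (n + 1) → ℝ}
    (h : Interlaces a b) : StrictAnti a := by
  cases n with
  | zero => exact fun i => i.elim0
  | succ n =>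
    refine Fin.strictAnti_iff_succ_lt.mpr fun i => ?_
    have h1 := (h i.castSucc).2
    have h2 := (h i.succ).1
    rw [Fin.castSucc_succ] at *
    exact h2.trans h1

lemma Interlaces.strictAnti_right {n : ℕ} {a : Fin n → ℝ} {b : Fin (n + 1) → ℝ}
    (h : Interlaces a b) : StrictAnti b :=
  Fin.strictAnti_iff_succ_lt.mpr fun i => (h i).2.trans (h i).1

lemma Interlaces.ratio_pos {n : ℕ} {a : Fin n → ℝ} {b : Fin (n + 1) → ℝ}
    (h : Interlaces a b) (i : Fin (n + 1)) (r : Fin n) :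
    0 < (b i - a r) / (b i - b (i.succAbove r)) := by
  have hb := h.strictAnti_right
  rcases lt_or_ge r.castSucc i with hri | hri
  · rw [Fin.succAbove_of_castSucc_lt _ _ hri]
    have h1 := hb.antitone (Fin.castSucc_lt_iff_succ_le.mp hri)
    obtain ⟨h2, h3⟩ := h r
    exact div_pos_of_neg_of_neg (by linarith) (by linarith)
  · rw [Fin.succAbove_of_le_castSucc _ _ hri]
    have h1 := hb.antitone hri
    obtain ⟨h2, h3⟩ := h r
    exact div_pos (by linarith) (by linarith)

lemma lagW_pos {n : ℕ} {a : Fin n → ℝ} {b : Fin (n + 1) → ℝ}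
    (h : Interlaces a b) (i : Fin (n + 1)) : 0 < lagW b a i :=
  Finset.prod_pos fun r _ => h.ratio_pos i r

open Polynomial in
lemma natDegree_prod_X_sub_C_fin {n : ℕ} (a : Fin n → ℝ) :
    (∏ r, (X - C (a r))).natDegree = n := by
  simp [natDegree_prod_of_monic _ _ fun r _ => monic_X_sub_C (a r)]

open Polynomial in
lemma lagrange_eval {n : ℕ} {b : Fin (n + 1) → ℝ} (y : Fin (n + 1) → ℝ)
    (k : Fin (n + 1)) :
    (∑ i, C (y i) * ∏ r, (X - C (b (i.succAbove r)))).eval (b k) =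
      y k * ∏ r, (b k - b (k.succAbove r)) := by
  rw [eval_finsetSum, Finset.sum_eq_single k]
  · simp [eval_prod]
  · intro i _ hik
    obtain ⟨r, hr⟩ := Fin.exists_succAbove_eq hik.symm
    rw [eval_mul, eval_prod, Finset.prod_eq_zero (Finset.mem_univ r), mul_zero]
    simp [hr]
  · simp

open Polynomial in
lemma lagrange_natDegree_le {n : ℕ} (b y : Fin (n + 1) → ℝ) :
    (∑ i, C (y i) * ∏ r, (X - C (b (i.succAbove r)))).natDegree ≤ n := by
  refine natDegree_sum_le_of_forall_le _ _ fun i _ => ?_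
  exact (natDegree_C_mul_le _ _).trans
    (natDegree_prod_X_sub_C_fin fun r => b (i.succAbove r)).le

open Polynomial in
/-- A combination of Lagrange nodal polynomials is determined by its values at the nodes. -/
lemma lagrange_eq {n : ℕ} {b : Fin (n + 1) → ℝ} (hb : Function.Injective b)
    (y : Fin (n + 1) → ℝ) {f : ℝ[X]} (hf : f.natDegree ≤ n)
    (h : ∀ k, y k * ∏ r, (b k - b (k.succAbove r)) = f.eval (b k)) :
    ∑ i, C (y i) * ∏ r, (X - C (b (i.succAbove r))) = f := by
  refine eq_of_degrees_lt_of_eval_index_eq (v := b) Finset.univ hb.injOn ?_ ?_ ?_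
  · refine degree_le_natDegree.trans_lt ?_
    simpa using mod_cast Nat.lt_succ_of_le (lagrange_natDegree_le b y)
  · refine degree_le_natDegree.trans_lt ?_
    simpa using mod_cast Nat.lt_succ_of_le hf
  · intro k _
    rw [lagrange_eval, h]

lemma prod_sub_succAbove_ne_zero {n : ℕ} {b : Fin (n + 1) → ℝ} (hb : Function.Injective b)
    (k : Fin (n + 1)) : ∏ r, (b k - b (k.succAbove r)) ≠ 0 :=
  Finset.prod_ne_zero_iff.mpr fun r _ =>
    sub_ne_zero.mpr (hb.ne (Fin.succAbove_ne k r).symm)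

lemma lagW_mul {n : ℕ} {b : Fin (n + 1) → ℝ} (hb : Function.Injective b) (a : Fin n → ℝ)
    (k : Fin (n + 1)) :
    lagW b a k * ∏ r, (b k - b (k.succAbove r)) = ∏ r, (b k - a r) := by
  rw [lagW, Finset.prod_div_distrib, div_mul_cancel₀ _ (prod_sub_succAbove_ne_zero hb k)]

open Polynomial in
lemma lagrange_lagW {n : ℕ} {b : Fin (n + 1) → ℝ} (hb : Function.Injective b)
    (a : Fin n → ℝ) (t : ℝ) :
    ∑ i, C (t * lagW b a i) * ∏ r, (X - C (b (i.succAbove r))) =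
      C t * ∏ r, (X - C (a r)) := by
  refine lagrange_eq hb _ ((natDegree_C_mul_le _ _).trans
    (natDegree_prod_X_sub_C_fin a).le) fun k => ?_
  rw [mul_assoc, lagW_mul hb]
  simp [eval_prod]

open Polynomial in
lemma coeff_prod_X_sub_C_fin {n : ℕ} (a : Fin n → ℝ) :
    (∏ r, (X - C (a r))).coeff n = 1 := by
  have h := (monic_prod_of_monic Finset.univ _ fun r _ => monic_X_sub_C (a r)).coeff_natDegree
  rwa [natDegree_prod_X_sub_C_fin] at h

open Polynomial in
lemma sum_lagW {n : ℕ} {b : Fin (n + 1) → ℝ} (hb : Function.Injective b)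
    (a : Fin n → ℝ) : ∑ i, lagW b a i = 1 := by
  have h := congrArg (fun p : ℝ[X] => p.coeff n) (lagrange_lagW hb a 1)
  simpa [finsetSum_coeff, coeff_C_mul, coeff_prod_X_sub_C_fin] using h

/-! ### The Jacobian determinant -/

lemma prod_offDiag_abs {n : ℕ} (x : Fin n → ℝ) :
    ∏ i, ∏ j, (if i = j then 1 else |x i - x j|) = vdm x ^ 2 := by
  have h : ∀ i j, (if i = j then 1 else |x i - x j|) =
      (if i < j then |x i - x j| else 1) * (if j < i then |x j - x i| else 1) := by
    intro i j
    rcases lt_trichotomy i j with h | h | h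
    · simp [h, h.ne, h.not_gt]
    · simp [h]
    · simp [h, h.ne', h.not_gt, abs_sub_comm]
  simp_rw [h, Finset.prod_mul_distrib]
  rw [sq, vdm]
  congr 1
  exact Finset.prod_comm

lemma prod_erase_abs {n : ℕ} (x : Fin n → ℝ) :
    ∏ i, ∏ j ∈ Finset.univ.erase i, |x i - x j| = vdm x ^ 2 := by
  rw [← prod_offDiag_abs]
  refine Finset.prod_congr rfl fun i _ => ?_
  rw [← Finset.mul_prod_erase Finset.univ _ (Finset.mem_univ i)]
  rw [if_pos rfl, one_mul]
  refine Finset.prod_congr rfl fun j hj => ?_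
  rw [if_neg (Finset.ne_of_mem_erase hj).symm]

lemma prod_succAbove_abs {n : ℕ} (x : Fin (n + 1) → ℝ) :
    ∏ i, ∏ r, |x i - x (i.succAbove r)| = vdm x ^ 2 := by
  rw [← prod_offDiag_abs]
  refine Finset.prod_congr rfl fun i _ => ?_
  rw [Fin.prod_univ_succAbove _ i, if_pos rfl, one_mul]
  refine Finset.prod_congr rfl fun j _ => ?_
  rw [if_neg (Fin.succAbove_ne i j).symm]

lemma abs_det_vandermonde {n : ℕ} (x : Fin n → ℝ) :
    |(Matrix.vandermonde x).det| = vdm x := by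
  rw [Matrix.det_vandermonde, Finset.abs_prod, vdm]
  refine Finset.prod_congr rfl fun i _ => ?_
  rw [Finset.abs_prod, ← Finset.prod_filter]
  refine Finset.prod_congr (by ext; simp) fun j _ => abs_sub_comm _ _

lemma vdm_cons {n : ℕ} (x : ℝ) (a : Fin n → ℝ) :
    vdm (Fin.cons x a : Fin (n + 1) → ℝ) = (∏ r, |x - a r|) * vdm a := by
  simp [vdm, Fin.prod_univ_succ]

open Polynomial in
lemma det_eval_eq {n : ℕ} (x : Fin n → ℝ) (f : Fin n → ℝ[X]) (hf : ∀ j, (f j).natDegree < n) :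
    (Matrix.of fun i j => (f j).eval (x i)).det =
      (Matrix.vandermonde x).det * (Matrix.of fun k j : Fin n => (f j).coeff k).det := by
  rw [← Matrix.det_mul]
  congr 1
  ext i j
  rw [Matrix.mul_apply, Matrix.of_apply, eval_eq_sum_range' (hf j), Finset.sum_range]
  exact Finset.sum_congr rfl fun k _ => mul_comm _ _

/-- The polynomials `∏ (X - a r)` and `∏_{s ≠ r} (X - a s)`. -/
def nodalPolys {n : ℕ} (a : Fin n → ℝ) : Fin (n + 1) → Polynomial ℝ :=
  Fin.cons (∏ r, (Polynomial.X - Polynomial.C (a r)))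
    fun r => ∏ s ∈ Finset.univ.erase r, (Polynomial.X - Polynomial.C (a s))

open Polynomial in
lemma nodalPolys_natDegree {n : ℕ} (a : Fin n → ℝ) (j : Fin (n + 1)) :
    (nodalPolys a j).natDegree < n + 1 := by
  refine Fin.cases ?_ (fun r => ?_) j
  · rw [nodalPolys, Fin.cons_zero, natDegree_prod_X_sub_C_fin]
    exact Nat.lt_succ_self n
  · rw [nodalPolys, Fin.cons_succ, natDegree_prod_of_monic _ _ fun r _ => monic_X_sub_C (a r)]
    simp

open Polynomial in
lemma abs_det_nodalPolys_coeff {n : ℕ} {a : Fin n → ℝ} (ha : Function.Injective a) :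
    |(Matrix.of fun k j : Fin (n + 1) => (nodalPolys a j).coeff k).det| = vdm a := by
  obtain ⟨x, hx⟩ : ∃ x : ℝ, ∀ r, x ≠ a r := by
    obtain ⟨x, hx⟩ := (Set.finite_range a).exists_notMem
    exact ⟨x, fun r h => hx ⟨r, h.symm⟩⟩
  have hP : 0 < ∏ r, |x - a r| :=
    Finset.prod_pos fun r _ => abs_pos.mpr (sub_ne_zero.mpr (hx r))
  have hdet := det_eval_eq (Fin.cons x a : Fin (n + 1) → ℝ) (nodalPolys a)
    (nodalPolys_natDegree a)
  have htri : (Matrix.of fun i j =>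
      (nodalPolys a j).eval ((Fin.cons x a : Fin (n + 1) → ℝ) i)).BlockTriangular id := by
    intro i j hij
    obtain ⟨s, rfl⟩ := Fin.exists_succ_eq.mpr (Fin.ne_zero_of_lt hij)
    rw [Matrix.of_apply, Fin.cons_succ]
    induction j using Fin.cases with
    | zero =>
      rw [nodalPolys, Fin.cons_zero, eval_prod, Finset.prod_eq_zero (Finset.mem_univ s)]
      simp
    | succ r =>
      have hrs : s ≠ r := by
        rintro rfl
        exact lt_irrefl _ hij
      rw [nodalPolys, Fin.cons_succ, eval_prod, Finset.prod_eq_zero (i := s)]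
      · simp [hrs]
      · simp
  rw [Matrix.det_of_isUpperTriangular htri] at hdet
  have habs := congrArg abs hdet
  rw [abs_mul, abs_det_vandermonde, vdm_cons, Fin.prod_univ_succ, abs_mul] at habs
  simp only [Matrix.of_apply, Fin.cons_zero, Fin.cons_succ, nodalPolys, eval_prod, eval_sub,
    eval_X, eval_C, Finset.abs_prod] at habs
  rw [prod_erase_abs, mul_assoc] at habs
  have h2 := mul_left_cancel₀ hP.ne' habs
  rw [sq] at h2
  exact (mul_left_cancel₀ (vdm_pos ha).ne' h2).symm

lemma abs_det_nodalPolys {n : ℕ} {a : Fin n → ℝ} (ha : Function.Injective a)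
    (b : Fin (n + 1) → ℝ) :
    |(Matrix.of fun i j => (nodalPolys a j).eval (b i)).det| = vdm b * vdm a := by
  rw [det_eval_eq b _ (nodalPolys_natDegree a), abs_mul, abs_det_vandermonde,
    abs_det_nodalPolys_coeff ha]

/-- The change of variables `(t, a) ↦ (t * lagW b a i)_i`. -/
def lagMap {n : ℕ} (b : Fin (n + 1) → ℝ) (x : Fin (n + 1) → ℝ) (i : Fin (n + 1)) : ℝ :=
  x 0 * lagW b (Fin.tail x) i

/-- The Jacobian matrix of `lagMap`. -/
def lagJac {n : ℕ} (b : Fin (n + 1) → ℝ) (x : Fin (n + 1) → ℝ) :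
    Matrix (Fin (n + 1)) (Fin (n + 1)) ℝ :=
  Matrix.of fun i j => (∏ r, (b i - b (i.succAbove r)))⁻¹ *
    ((nodalPolys (Fin.tail x) j).eval (b i) * (Fin.cons 1 fun _ => -x 0 : Fin (n + 1) → ℝ) j)

lemma abs_det_lagJac {n : ℕ} {b : Fin (n + 1) → ℝ} (hb : Function.Injective b)
    {x : Fin (n + 1) → ℝ} (h0 : 0 < x 0) (ha : Function.Injective (Fin.tail x)) :
    |(lagJac b x).det| = x 0 ^ n * vdm (Fin.tail x) / vdm b := by
  have h1 : lagJac b x = Matrix.of fun i j => (∏ r, (b i - b (i.succAbove r)))⁻¹ *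
      (Matrix.of fun i j => (Fin.cons 1 fun _ => -x 0 : Fin (n + 1) → ℝ) j *
        (Matrix.of fun i j => (nodalPolys (Fin.tail x) j).eval (b i)) i j) i j := by
    ext i j
    simp [lagJac, mul_comm]
  rw [h1, Matrix.det_mul_column, Matrix.det_mul_row, abs_mul, abs_mul, abs_det_nodalPolys ha,
    Finset.prod_inv_distrib, abs_inv, Finset.abs_prod]
  simp only [Finset.abs_prod]
  rw [prod_succAbove_abs, Fin.prod_univ_succ]
  have := (vdm_pos hb).ne'
  simp only [Fin.cons_zero, Fin.cons_succ, abs_one, abs_neg, Finset.prod_const, Finset.card_univ,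
    Fintype.card_fin, one_mul, abs_of_pos h0]
  field_simp

lemma hasFDerivAt_lagMap {n : ℕ} (b : Fin (n + 1) → ℝ) (x : Fin (n + 1) → ℝ) :
    HasFDerivAt (lagMap b) (lagJac b x).toLin'.toContinuousLinearMap x := by
  rw [hasFDerivAt_pi']
  intro i
  have hproj : ∀ j : Fin (n + 1), HasFDerivAt (fun x : Fin (n + 1) → ℝ => x j)
      (ContinuousLinearMap.proj j : (Fin (n + 1) → ℝ) →L[ℝ] ℝ) x := fun j =>
    hasFDerivAt_apply j x
  have hprod := HasFDerivAt.finsetProd (u := Finset.univ)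
    (g := fun (r : Fin n) (x : Fin (n + 1) → ℝ) => b i - x r.succ)
    (fun r _ => (hproj r.succ).const_sub (b i))
  have h := ((hproj 0).mul hprod).const_mul (∏ r, (b i - b (i.succAbove r)))⁻¹
  refine HasFDerivAt.congr_fderiv (h.congr_of_eventuallyEq (.of_forall fun y => ?_)) ?_
  · simp only [lagMap, lagW, Finset.prod_div_distrib, Fin.tail, Pi.mul_apply]
    field_simp
  · ext v
    simp [lagJac, Matrix.mulVec, dotProduct, Fin.sum_univ_succ, nodalPolys,
      Polynomial.eval_prod, Fin.tail, Finset.mul_sum]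
    ring_nf

/-! ### The change of variables is a bijection -/

lemma exists_interlaces {n : ℕ} {b : Fin (n + 1) → ℝ} (hb : StrictAnti b) :
    ∃ a : Fin n → ℝ, Interlaces a b := by
  refine ⟨fun r => (b r.castSucc + b r.succ) / 2, fun r => ?_⟩
  have := hb (Fin.castSucc_lt_succ (i := r))
  constructor <;> linarith

lemma prod_sub_succAbove_mul_neg {n : ℕ} {b : Fin (n + 1) → ℝ} (hb : StrictAnti b) (r : Fin n) :
    (∏ s, (b r.castSucc - b (r.castSucc.succAbove s))) *
      (∏ s, (b r.succ - b (r.succ.succAbove s))) < 0 := by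
  obtain ⟨a, ha⟩ := exists_interlaces hb
  have h1 := lagW_mul hb.injective a r.castSucc
  have h2 := lagW_mul hb.injective a r.succ
  have key : (∏ s, (b r.castSucc - a s)) * (∏ s, (b r.succ - a s)) < 0 := by
    rw [← Finset.prod_mul_distrib, ← Finset.mul_prod_erase Finset.univ _ (Finset.mem_univ r)]
    obtain ⟨h3, h4⟩ := ha r
    refine mul_neg_of_neg_of_pos (mul_neg_of_pos_of_neg (by linarith) (by linarith))
      (Finset.prod_pos fun s hs => ?_)
    obtain ⟨h5, h6⟩ := ha s
    rcases lt_or_gt_of_ne (Finset.ne_of_mem_erase hs) with hsr | hsr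
    · have h7 : b r.castSucc ≤ b s.succ :=
        hb.antitone (by rw [← Fin.castSucc_lt_iff_succ_le]; exact hsr)
      exact mul_pos_of_neg_of_neg (by linarith) (by linarith)
    · have h7 : b s.castSucc ≤ b r.succ :=
        hb.antitone (by rw [← Fin.castSucc_lt_iff_succ_le]; exact hsr)
      exact mul_pos (by linarith) (by linarith)
  rw [← h1, ← h2] at key
  have h3 := lagW_pos ha r.castSucc
  have h4 := lagW_pos ha r.succ
  by_contra! hcon
  exact key.not_ge (by
    have := mul_nonneg (mul_pos h3 h4).le hcon
    linarith)

lemma exists_root_Ioo {f : ℝ → ℝ} (hf : Continuous f) {u v : ℝ} (huv : u < v)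
    (h : f u * f v < 0) : ∃ x ∈ Set.Ioo u v, f x = 0 := by
  rcases mul_neg_iff.mp h with ⟨h1, h2⟩ | ⟨h1, h2⟩
  · exact intermediate_value_Ioo' huv.le hf.continuousOn ⟨h2, h1⟩
  · exact intermediate_value_Ioo huv.le hf.continuousOn ⟨h1, h2⟩

/-- The domain of the change of variables `lagMap`. -/
def lagDom {n : ℕ} (b : Fin (n + 1) → ℝ) : Set (Fin (n + 1) → ℝ) :=
  {x | 0 < x 0 ∧ Interlaces (Fin.tail x) b}

lemma sum_lagMap {n : ℕ} {b : Fin (n + 1) → ℝ} (hb : Function.Injective b)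
    (x : Fin (n + 1) → ℝ) : ∑ i, lagMap b x i = x 0 := by
  simp only [lagMap, ← Finset.mul_sum, sum_lagW hb, mul_one]

open Polynomial in
lemma injOn_lagMap {n : ℕ} {b : Fin (n + 1) → ℝ} (hb : StrictAnti b) :
    Set.InjOn (lagMap b) (lagDom b) := by
  intro x hx x' hx' hxx'
  have h0 : x 0 = x' 0 := by
    rw [← sum_lagMap hb.injective x, ← sum_lagMap hb.injective x', hxx']
  have hP : (∏ r, (X - C (Fin.tail x r))) = ∏ r, (X - C (Fin.tail x' r)) := by
    have h1 := lagrange_lagW hb.injective (Fin.tail x) (x 0)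
    have h2 := lagrange_lagW hb.injective (Fin.tail x') (x' 0)
    have h3 : ∀ i, x 0 * lagW b (Fin.tail x) i = x' 0 * lagW b (Fin.tail x') i := fun i =>
      congrFun hxx' i
    simp_rw [h3] at h1
    rw [h1, ← h0] at h2
    exact mul_left_cancel₀ (C_ne_zero.mpr hx.1.ne') h2
  have htail : Fin.tail x = Fin.tail x' := by
    funext r
    have hev := congrArg (eval (Fin.tail x r)) hP
    rw [eval_prod, eval_prod, Finset.prod_eq_zero (Finset.mem_univ r) (by simp)] at hev
    obtain ⟨s, -, hs⟩ := Finset.prod_eq_zero_iff.mp hev.symm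
    have hs' : Fin.tail x r = Fin.tail x' s := by simpa [sub_eq_zero] using hs
    obtain ⟨h1, h2⟩ := hx.2 r
    obtain ⟨h3, h4⟩ := hx'.2 s
    have hrs : r = s := by
      by_contra hne
      rcases lt_or_gt_of_ne hne with hlt | hlt
      · have : b s.castSucc ≤ b r.succ :=
          hb.antitone (by rw [← Fin.castSucc_lt_iff_succ_le]; exact hlt)
        linarith
      · have : b r.castSucc ≤ b s.succ :=
          hb.antitone (by rw [← Fin.castSucc_lt_iff_succ_le]; exact hlt)
        linarith
    rw [hs', hrs]
  rw [← Fin.cons_self_tail x, ← Fin.cons_self_tail x', h0, htail]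

open Polynomial in
lemma image_lagMap {n : ℕ} {b : Fin (n + 1) → ℝ} (hb : StrictAnti b) :
    lagMap b '' lagDom b = Set.univ.pi fun _ => Set.Ioi 0 := by
  ext y
  constructor
  · rintro ⟨x, hx, rfl⟩ i -
    exact mul_pos hx.1 (lagW_pos hx.2 i)
  · intro hy
    have hy' : ∀ i, 0 < y i := fun i => hy i (Set.mem_univ i)
    set Q : ℝ[X] := ∑ i, C (y i) * ∏ r, (X - C (b (i.succAbove r))) with hQ
    have hroot : ∀ r : Fin n, ∃ z ∈ Set.Ioo (b r.succ) (b r.castSucc), Q.eval z = 0 := by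
      intro r
      refine exists_root_Ioo Q.continuous (hb Fin.castSucc_lt_succ) ?_
      rw [hQ, lagrange_eval, lagrange_eval]
      have h1 := prod_sub_succAbove_mul_neg hb r
      have h2 := mul_pos (hy' r.castSucc) (hy' r.succ)
      have h3 := mul_neg_of_pos_of_neg h2 h1
      linarith
    choose a ha hQa using hroot
    have hab : Interlaces a b := fun r => ⟨(ha r).2, (ha r).1⟩
    set t := ∑ i, y i with ht
    have htpos : 0 < t := Finset.sum_pos (fun i _ => hy' i) Finset.univ_nonempty
    have hQt : Q = C t * ∏ r, (X - C (a r)) := by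
      rw [← sub_eq_zero]
      refine eq_zero_of_degree_lt_of_eval_finset_eq_zero (Finset.univ.image a) ?_ ?_
      · rw [Finset.card_image_of_injective _ hab.strictAnti_left.injective, Finset.card_univ,
          Fintype.card_fin, degree_lt_iff_coeff_zero]
        intro k hk
        rcases hk.lt_or_eq with hk | rfl
        · refine coeff_eq_zero_of_natDegree_lt ((natDegree_sub_le _ _).trans_lt
            (max_lt ((lagrange_natDegree_le b y).trans_lt hk) ?_))
          exact ((natDegree_C_mul_le _ _).trans (natDegree_prod_X_sub_C_fin a).le).trans_lt hk
        · have h5 : ∀ i : Fin (n + 1),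
              (∏ r, (X - C (b (i.succAbove r)))).coeff n = (1 : ℝ) := fun i =>
            coeff_prod_X_sub_C_fin fun r => b (i.succAbove r)
          rw [coeff_sub, coeff_C_mul, coeff_prod_X_sub_C_fin]
          simp [hQ, h5, ht]
      · intro z hz
        obtain ⟨r, -, rfl⟩ := Finset.mem_image.mp hz
        rw [eval_sub, hQa, eval_mul, eval_prod, Finset.prod_eq_zero (Finset.mem_univ r) (by simp)]
        simp
    refine ⟨Fin.cons t a, ⟨by simpa using htpos, by simpa using hab⟩, funext fun i => ?_⟩
    have h6 := congrArg (eval (b i)) hQt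
    rw [hQ, lagrange_eval] at h6
    simp only [eval_mul, eval_C, eval_prod, eval_sub, eval_X] at h6
    rw [← lagW_mul hb.injective a, ← mul_assoc] at h6
    simpa [lagMap] using (mul_right_cancel₀ (prod_sub_succAbove_ne_zero hb.injective i) h6).symm

/-! ### The Dixon–Anderson integral -/

lemma isOpen_setOf_interlaces {X : Type*} [TopologicalSpace X] {n : ℕ} {u : X → Fin n → ℝ}
    {v : X → Fin (n + 1) → ℝ} (hu : Continuous u) (hv : Continuous v) :
    IsOpen {x | Interlaces (u x) (v x)} := by
  simp only [Interlaces, Set.ofPred_forall]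
  refine isOpen_iInter_of_finite fun i => ?_
  exact (isOpen_lt ((continuous_apply i).comp hu) ((continuous_apply _).comp hv)).inter
    (isOpen_lt ((continuous_apply _).comp hv) ((continuous_apply i).comp hu))

lemma measurableSet_interlaces {n : ℕ} (b : Fin (n + 1) → ℝ) :
    MeasurableSet {a | Interlaces a b} :=
  (isOpen_setOf_interlaces continuous_id continuous_const).measurableSet

lemma measurable_vdm {n : ℕ} : Measurable (vdm : (Fin n → ℝ) → ℝ) := by
  unfold vdm
  refine Finset.measurable_prod _ fun i _ => Finset.measurable_prod _ fun j _ => ?_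
  split_ifs <;> fun_prop

lemma measurable_lagW {n : ℕ} (b : Fin (n + 1) → ℝ) (i : Fin (n + 1)) :
    Measurable fun a => lagW b a i := by
  unfold lagW
  fun_prop

/-- The density `vdm a * ∏ i, (lagW b a i) ^ (s i - 1)`. -/
def daWt {n : ℕ} (b s : Fin (n + 1) → ℝ) (a : Fin n → ℝ) : ℝ :=
  vdm a * ∏ i, lagW b a i ^ (s i - 1)

lemma measurable_daWt {n : ℕ} (b s : Fin (n + 1) → ℝ) : Measurable (daWt b s) := by
  refine measurable_vdm.mul (Finset.measurable_prod _ fun i _ => ?_)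
  exact (measurable_lagW b i).pow_const _

lemma daWt_pos {n : ℕ} {b : Fin (n + 1) → ℝ} (s : Fin (n + 1) → ℝ) {a : Fin n → ℝ}
    (h : Interlaces a b) : 0 < daWt b s a :=
  mul_pos (vdm_pos h.strictAnti_left.injective)
    (Finset.prod_pos fun i _ => Real.rpow_pos_of_pos (lagW_pos h i) _)

lemma lintegral_Ioi_gamma {s : ℝ} (hs : 0 < s) :
    ∫⁻ t in Set.Ioi (0 : ℝ), ENNReal.ofReal (Real.exp (-t) * t ^ (s - 1)) =
      ENNReal.ofReal (Real.Gamma s) := by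
  rw [Real.Gamma_eq_integral hs, ofReal_integral_eq_lintegral_ofReal]
  · exact Real.GammaIntegral_convergent hs
  · filter_upwards [ae_restrict_mem measurableSet_Ioi] with t ht
    have : (0 : ℝ) < t := ht
    positivity

lemma lintegral_pi_gamma {n : ℕ} {s : Fin n → ℝ} (hs : ∀ i, 0 < s i) :
    ∫⁻ y in Set.univ.pi fun _ => Set.Ioi (0 : ℝ),
      ENNReal.ofReal (∏ i, (Real.exp (-y i) * y i ^ (s i - 1))) =
      ENNReal.ofReal (∏ i, Real.Gamma (s i)) := by
  have hvol : (volume : Measure (Fin n → ℝ)).restrict (Set.univ.pi fun _ => Set.Ioi (0 : ℝ)) =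
      Measure.pi fun _ => (volume : Measure ℝ).restrict (Set.Ioi 0) := by
    rw [volume_pi, Measure.restrict_pi_pi]
  have hInt : Integrable (fun y : Fin n → ℝ => ∏ i, (Real.exp (-y i) * y i ^ (s i - 1)))
      (Measure.pi fun _ => (volume : Measure ℝ).restrict (Set.Ioi 0)) :=
    Integrable.fintype_prod (f := fun i t => Real.exp (-t) * t ^ (s i - 1)) fun i =>
      Real.GammaIntegral_convergent (hs i)
  rw [hvol, ← ofReal_integral_eq_lintegral_ofReal hInt]
  · rw [integral_fintype_prod_eq_prod (f := fun i t => Real.exp (-t) * t ^ (s i - 1))]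
    congr 1
    exact Finset.prod_congr rfl fun i _ => (Real.Gamma_eq_integral (hs i)).symm
  · rw [← hvol]
    filter_upwards [ae_restrict_mem (MeasurableSet.univ_pi fun _ => measurableSet_Ioi)] with y hy
    have : ∀ i, 0 < y i := fun i => hy i (Set.mem_univ i)
    exact Finset.prod_nonneg fun i _ =>
      mul_nonneg (Real.exp_pos _).le (Real.rpow_nonneg (this i).le _)

lemma measurableSet_lagDom {n : ℕ} (b : Fin (n + 1) → ℝ) : MeasurableSet (lagDom b) := by
  refine IsOpen.measurableSet ?_
  exact (isOpen_lt continuous_const (continuous_apply 0)).inter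
    (isOpen_setOf_interlaces (by unfold Fin.tail; fun_prop) continuous_const)

lemma lagMap_density {n : ℕ} {b : Fin (n + 1) → ℝ} (hb : StrictAnti b) (s : Fin (n + 1) → ℝ)
    {x : Fin (n + 1) → ℝ} (hx : x ∈ lagDom b) :
    |(lagJac b x).det| * ∏ i, (Real.exp (-lagMap b x i) * lagMap b x i ^ (s i - 1)) =
      (Real.exp (-x 0) * x 0 ^ ((∑ i, s i) - 1)) * (daWt b s (Fin.tail x) / vdm b) := by
  have h0 : 0 < x 0 := hx.1
  have hW := fun i => lagW_pos hx.2 i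
  rw [abs_det_lagJac hb.injective h0 hx.2.strictAnti_left.injective, Finset.prod_mul_distrib,
    ← Real.exp_sum, Finset.sum_neg_distrib, sum_lagMap hb.injective]
  have h1 : ∏ i, lagMap b x i ^ (s i - 1) =
      x 0 ^ ((∑ i, s i) - (n + 1)) * ∏ i, lagW b (Fin.tail x) i ^ (s i - 1) := by
    simp only [lagMap]
    simp_rw [fun i => Real.mul_rpow (z := s i - 1) h0.le (hW i).le]
    rw [Finset.prod_mul_distrib, ← Real.rpow_sum_of_pos h0]
    simp
  have h2 : x 0 ^ ((∑ i, s i) - 1) = x 0 ^ n * x 0 ^ ((∑ i, s i) - (n + 1)) := by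
    rw [← Real.rpow_natCast, ← Real.rpow_add h0]
    ring_nf
  rw [h1, h2, daWt]
  ring

/-- The Dixon–Anderson integral with arbitrary positive exponents. -/
theorem lintegral_daWt {n : ℕ} {b : Fin (n + 1) → ℝ} (hb : StrictAnti b) {s : Fin (n + 1) → ℝ}
    (hs : ∀ i, 0 < s i) :
    ∫⁻ a in {a | Interlaces a b}, ENNReal.ofReal (daWt b s a) =
      ENNReal.ofReal (vdm b * (∏ i, Real.Gamma (s i)) / Real.Gamma (∑ i, s i)) := by
  have hS : 0 < ∑ i, s i := Finset.sum_pos (fun i _ => hs i) Finset.univ_nonempty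
  have hG := Real.Gamma_pos_of_pos hS
  have hv := vdm_pos hb.injective
  have key := lintegral_image_eq_lintegral_abs_det_fderiv_mul volume (measurableSet_lagDom b)
    (fun x _ => (hasFDerivAt_lagMap b x).hasFDerivWithinAt) (injOn_lagMap hb)
    (fun y => ENNReal.ofReal (∏ i, (Real.exp (-y i) * y i ^ (s i - 1))))
  rw [image_lagMap hb, lintegral_pi_gamma hs] at key
  have h1 : ∀ x ∈ lagDom b, ENNReal.ofReal |(lagJac b x).toLin'.toContinuousLinearMap.det| *
      ENNReal.ofReal (∏ i, (Real.exp (-lagMap b x i) * lagMap b x i ^ (s i - 1))) =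
      ENNReal.ofReal (Real.exp (-x 0) * x 0 ^ ((∑ i, s i) - 1)) *
        (ENNReal.ofReal (daWt b s (Fin.tail x)) * ENNReal.ofReal (vdm b)⁻¹) := by
    intro x hx
    have hx0 : 0 < x 0 := hx.1
    rw [← ENNReal.ofReal_mul (abs_nonneg _), ← ENNReal.ofReal_mul (daWt_pos s hx.2).le,
      ← ENNReal.ofReal_mul (by positivity), ← div_eq_mul_inv, ← lagMap_density hb s hx]
    congr 3
    simp [ContinuousLinearMap.det]
  rw [setLIntegral_congr_fun (measurableSet_lagDom b) h1] at key
  have hmp := volume_preserving_piFinSuccAbove (fun _ : Fin (n + 1) => ℝ) 0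
  have hdom : lagDom b = (MeasurableEquiv.piFinSuccAbove (fun _ : Fin (n + 1) => ℝ) 0) ⁻¹'
      (Set.Ioi 0 ×ˢ {a | Interlaces a b}) := by
    ext x
    simp [lagDom, MeasurableEquiv.piFinSuccAbove, Fin.insertNthEquiv]
  rw [hdom] at key
  have h2 := hmp.setLIntegral_comp_preimage_emb (MeasurableEquiv.measurableEmbedding _)
    (fun z : ℝ × (Fin n → ℝ) => ENNReal.ofReal (Real.exp (-z.1) * z.1 ^ ((∑ i, s i) - 1)) *
        (ENNReal.ofReal (daWt b s z.2) * ENNReal.ofReal (vdm b)⁻¹))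
    (Set.Ioi 0 ×ˢ {a | Interlaces a b})
  have h3 := key.trans h2
  rw [Measure.volume_eq_prod, ← Measure.prod_restrict, lintegral_prod_mul
    (f := fun z => ENNReal.ofReal (Real.exp (-z) * z ^ ((∑ i, s i) - 1)))
    (g := fun z => (ENNReal.ofReal (daWt b s z) * ENNReal.ofReal (vdm b)⁻¹)) (by fun_prop)
    ((measurable_daWt b s).ennreal_ofReal.mul_const _).aemeasurable,
    lintegral_Ioi_gamma hS, lintegral_mul_const _ (measurable_daWt b s).ennreal_ofReal] at h3
  have hne : ENNReal.ofReal (vdm b)⁻¹ ≠ 0 := by simpa using hv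
  have hne' : ENNReal.ofReal (Real.Gamma (∑ i, s i)) ≠ 0 := by simpa using hG
  rw [mul_div_assoc, ENNReal.ofReal_mul hv.le, ENNReal.ofReal_div_of_pos hG, h3,
    ENNReal.ofReal_inv_of_pos hv, ENNReal.div_eq_inv_mul, ← mul_assoc (ENNReal.ofReal (Real.Gamma _))⁻¹,
    ENNReal.inv_mul_cancel hne' ENNReal.ofReal_ne_top, one_mul, mul_comm, mul_assoc,
    ENNReal.inv_mul_cancel (by simpa using hv) ENNReal.ofReal_ne_top, mul_one]

/-! ### Universal moment formulas for the Dixon–Anderson density -/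

/-- The total mass of `daWt b s`. -/
def daZ {n : ℕ} (b s : Fin (n + 1) → ℝ) : ℝ :=
  vdm b * (∏ i, Real.Gamma (s i)) / Real.Gamma (∑ i, s i)

lemma daZ_pos {n : ℕ} {b : Fin (n + 1) → ℝ} (hb : StrictAnti b) {s : Fin (n + 1) → ℝ}
    (hs : ∀ i, 0 < s i) : 0 < daZ b s :=
  div_pos (mul_pos (vdm_pos hb.injective)
    (Finset.prod_pos fun i _ => Real.Gamma_pos_of_pos (hs i)))
    (Real.Gamma_pos_of_pos (Finset.sum_pos (fun i _ => hs i) Finset.univ_nonempty))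

lemma integrableOn_daWt {n : ℕ} {b : Fin (n + 1) → ℝ} (hb : StrictAnti b) {s : Fin (n + 1) → ℝ}
    (hs : ∀ i, 0 < s i) : IntegrableOn (daWt b s) {a | Interlaces a b} := by
  refine ⟨(measurable_daWt b s).aestronglyMeasurable, ?_⟩
  rw [hasFiniteIntegral_iff_ofReal, lintegral_daWt hb hs]
  · exact ENNReal.ofReal_lt_top
  · filter_upwards [ae_restrict_mem (measurableSet_interlaces b)] with a ha
    exact (daWt_pos s ha).le

lemma integral_daWt {n : ℕ} {b : Fin (n + 1) → ℝ} (hb : StrictAnti b) {s : Fin (n + 1) → ℝ}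
    (hs : ∀ i, 0 < s i) : ∫ a in {a | Interlaces a b}, daWt b s a = daZ b s := by
  rw [integral_eq_lintegral_of_nonneg_ae, lintegral_daWt hb hs, ENNReal.toReal_ofReal]
  · rfl
  · exact (daZ_pos hb hs).le
  · filter_upwards [ae_restrict_mem (measurableSet_interlaces b)] with a ha
    exact (daWt_pos s ha).le
  · exact (measurable_daWt b s).aestronglyMeasurable

/-- The rising factorial. -/
def risingFact (z : ℝ) (j : ℕ) : ℝ := ∏ i ∈ Finset.range j, (z + i)

lemma risingFact_succ (z : ℝ) (j : ℕ) : risingFact z (j + 1) = z * risingFact (z + 1) j := by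
  rw [risingFact, Finset.prod_range_succ', risingFact, mul_comm]
  simp [add_comm, add_left_comm]

lemma risingFact_pos {z : ℝ} (hz : 0 < z) (j : ℕ) : 0 < risingFact z j :=
  Finset.prod_pos fun i _ => by positivity

/-- Products of power sums of total degree `d`, as functions of the sequence of power sums. -/
def powProd (ν : Multiset ℕ) (p : ℕ → ℝ) : ℝ := (ν.map p).prod

/-- Linear combinations of products of (positive index) power sums of total degree `d`. -/
def polySpace (d : ℕ) : Submodule ℝ ((ℕ → ℝ) → ℝ) :=
  Submodule.span ℝ (Set.range fun ν : Nat.Partition d => powProd ν.parts)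

lemma powProd_mem {ν : Multiset ℕ} (hν : ∀ i ∈ ν, 0 < i) {d : ℕ} (hd : ν.sum = d) :
    powProd ν ∈ polySpace d :=
  Submodule.subset_span ⟨⟨ν, fun {i} hi => hν i hi, hd⟩, rfl⟩

lemma polySpace_induction {d : ℕ} {motive : ∀ f : (ℕ → ℝ) → ℝ, f ∈ polySpace d → Prop}
    (gen : ∀ (ν : Multiset ℕ) (hν : ∀ i ∈ ν, 0 < i) (hd : ν.sum = d),
      motive (powProd ν) (powProd_mem hν hd))
    (zero : motive 0 (zero_mem _))
    (add : ∀ f g hf hg, motive f hf → motive g hg → motive (f + g) (add_mem hf hg))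
    (smul : ∀ (c : ℝ) f hf, motive f hf → motive (c • f) (Submodule.smul_mem _ c hf))
    {f : (ℕ → ℝ) → ℝ} (hf : f ∈ polySpace d) : motive f hf := by
  induction hf using Submodule.span_induction with
  | mem f hf =>
    obtain ⟨ν, rfl⟩ := hf
    exact gen _ (fun i hi => ν.parts_pos hi) ν.parts_sum
  | zero => exact zero
  | add f g hf hg h1 h2 => exact add f g hf hg h1 h2
  | smul c f hf h => exact smul c f hf h

lemma mul_mem_polySpace {d e : ℕ} {f g : (ℕ → ℝ) → ℝ} (hf : f ∈ polySpace d)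
    (hg : g ∈ polySpace e) : f * g ∈ polySpace (d + e) := by
  induction hf using polySpace_induction with
  | gen ν hν hd =>
    induction hg using polySpace_induction with
    | gen κ hκ he =>
      have : powProd ν * powProd κ = powProd (ν + κ) := by
        funext p
        simp [powProd]
      rw [this]
      refine powProd_mem (fun i hi => ?_) (by rw [Multiset.sum_add, hd, he])
      rcases Multiset.mem_add.mp hi with h | h
      exacts [hν i h, hκ i h]
    | zero => simp
    | add g h _ _ hg hh => rw [mul_add]; exact add_mem hg hh
    | smul c g _ hg => rw [mul_smul_comm]; exact Submodule.smul_mem _ c hg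
  | zero => simp
  | add f h _ _ hf hh => rw [add_mul]; exact add_mem hf hh
  | smul c f _ hf => rw [smul_mul_assoc]; exact Submodule.smul_mem _ c hf

lemma one_mem_polySpace : (1 : (ℕ → ℝ) → ℝ) ∈ polySpace 0 := by
  have h : (1 : (ℕ → ℝ) → ℝ) = powProd 0 := by
    funext p
    simp [powProd]
  rw [h]
  exact powProd_mem (by simp) rfl

lemma coord_mem_polySpace {l : ℕ} (hl : 0 < l) : (fun p : ℕ → ℝ => p l) ∈ polySpace l := by
  have h : (fun p : ℕ → ℝ => p l) = powProd {l} := by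
    funext p
    simp [powProd]
  rw [h]
  exact powProd_mem (by simpa using hl) (by simp)

lemma exists_shift_powProd (ν : Multiset ℕ) (hν : ∀ i ∈ ν, 0 < i) :
    ∀ l : ℕ, 0 < l → ∃ g ∈ polySpace (ν.sum + l), ∀ (n : ℕ) (s x : Fin n → ℝ),
      ∑ i, s i * x i ^ l * powProd ν (fun k => (∑ j, s j * x j ^ k) + x i ^ k) =
        g fun k => ∑ j, s j * x j ^ k := by
  induction ν using Multiset.induction with
  | empty =>
    intro l hl
    refine ⟨fun p => p l, by simpa using coord_mem_polySpace hl, fun n s x => ?_⟩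
    simp [powProd]
  | cons k ν ih =>
    intro l hl
    have hν' : ∀ i ∈ ν, 0 < i := fun i hi => hν i (Multiset.mem_cons_of_mem hi)
    have hk : 0 < k := hν k (Multiset.mem_cons_self k ν)
    obtain ⟨g, hg, hg'⟩ := ih hν' l hl
    obtain ⟨h, hh, hh'⟩ := ih hν' (l + k) (by omega)
    refine ⟨(fun p => p k) * g + h, add_mem ?_ ?_, fun n s x => ?_⟩
    · convert mul_mem_polySpace (coord_mem_polySpace hk) hg using 2
      rw [Multiset.sum_cons]; ring
    · convert hh using 2
      rw [Multiset.sum_cons]; ring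
    · rw [Pi.add_apply, Pi.mul_apply, ← hg', ← hh', Finset.mul_sum, ← Finset.sum_add_distrib]
      refine Finset.sum_congr rfl fun i _ => ?_
      simp only [powProd, Multiset.map_cons, Multiset.prod_cons]
      ring

lemma exists_shift {d : ℕ} {f : (ℕ → ℝ) → ℝ} (hf : f ∈ polySpace d) {l : ℕ} (hl : 0 < l) :
    ∃ g ∈ polySpace (d + l), ∀ (n : ℕ) (s x : Fin n → ℝ),
      ∑ i, s i * x i ^ l * f (fun k => (∑ j, s j * x j ^ k) + x i ^ k) =
        g fun k => ∑ j, s j * x j ^ k := by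
  induction hf using polySpace_induction with
  | gen ν hν hd => subst hd; exact exists_shift_powProd ν hν l hl
  | zero => exact ⟨0, zero_mem _, fun n s x => by simp⟩
  | add f f' _ _ h h' =>
    obtain ⟨g, hg, e⟩ := h
    obtain ⟨g', hg', e'⟩ := h'
    refine ⟨g + g', add_mem hg hg', fun n s x => ?_⟩
    simp only [Pi.add_apply, ← e, ← e', mul_add, Finset.sum_add_distrib]
  | smul c f _ h =>
    obtain ⟨g, hg, e⟩ := h
    refine ⟨c • g, Submodule.smul_mem _ c hg, fun n s x => ?_⟩
    simp only [Pi.smul_apply, smul_eq_mul, ← e, Finset.mul_sum]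
    exact Finset.sum_congr rfl fun i _ => by ring

lemma lagW_mul_daWt {n : ℕ} {b : Fin (n + 1) → ℝ} (s : Fin (n + 1) → ℝ) {a : Fin n → ℝ}
    (h : Interlaces a b) (i : Fin (n + 1)) :
    lagW b a i * daWt b s a = daWt b (s + Pi.single i 1) a := by
  rw [daWt, daWt, mul_left_comm]
  congr 1
  conv_rhs => rw [← Finset.mul_prod_erase _ _ (Finset.mem_univ i)]
  rw [← Finset.mul_prod_erase _ _ (Finset.mem_univ i), ← mul_assoc]
  congr 1
  · rw [mul_comm, ← Real.rpow_add_one (lagW_pos h i).ne']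
    simp
  · refine Finset.prod_congr rfl fun j hj => ?_
    simp [Finset.ne_of_mem_erase hj]

lemma daZ_add_single {n : ℕ} (b : Fin (n + 1) → ℝ) {s : Fin (n + 1) → ℝ} (hs : ∀ i, 0 < s i)
    (i : Fin (n + 1)) : daZ b (s + Pi.single i 1) = daZ b s * (s i / ∑ j, s j) := by
  have hS : 0 < ∑ i, s i := Finset.sum_pos (fun i _ => hs i) Finset.univ_nonempty
  have h1 : ∑ j, (s + Pi.single i 1 : Fin (n + 1) → ℝ) j = (∑ j, s j) + 1 := by
    simp [Finset.sum_add_distrib]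
  have h2 : ∏ j, Real.Gamma ((s + Pi.single i 1 : Fin (n + 1) → ℝ) j) =
      s i * ∏ j, Real.Gamma (s j) := by
    rw [← Finset.mul_prod_erase _ _ (Finset.mem_univ i),
      ← Finset.mul_prod_erase _ (fun j => Real.Gamma (s j)) (Finset.mem_univ i), ← mul_assoc]
    congr 1
    · simp [Real.Gamma_add_one (hs i).ne']
    · refine Finset.prod_congr rfl fun j hj => ?_
      simp [Finset.ne_of_mem_erase hj]
  have h3 := (Real.Gamma_pos_of_pos hS).ne'
  rw [daZ, daZ, h1, h2, Real.Gamma_add_one hS.ne']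
  field_simp

/-- The weighted power sums `∑ i, lagW b a i * x i ^ l`. -/
def lagMoment {n : ℕ} (b : Fin (n + 1) → ℝ) (x : Fin (n + 1) → ℝ) (a : Fin n → ℝ) (l : ℕ) : ℝ :=
  ∑ i, lagW b a i * x i ^ l

/-- Joint moments of the weighted power sums under the Dixon–Anderson density. -/
lemma exists_integral_lagMoment (κ : List ℕ) (hκ : ∀ l ∈ κ, 0 < l) :
    ∃ M ∈ polySpace κ.sum, ∀ (n : ℕ) (b s x : Fin (n + 1) → ℝ), StrictAnti b → (∀ i, 0 < s i) →
      IntegrableOn (fun a => (κ.map (lagMoment b x a)).prod * daWt b s a) {a | Interlaces a b} ∧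
      ∫ a in {a | Interlaces a b}, (κ.map (lagMoment b x a)).prod * daWt b s a =
        daZ b s * (M (fun k => ∑ j, s j * x j ^ k) / risingFact (∑ i, s i) κ.length) := by
  induction κ with
  | nil =>
    refine ⟨1, one_mem_polySpace, fun n b s x hb hs => ?_⟩
    simpa [risingFact] using ⟨integrableOn_daWt hb hs, integral_daWt hb hs⟩
  | cons l κ ih =>
    obtain ⟨M, hM, hM'⟩ := ih fun l hl => hκ l (List.mem_cons_of_mem _ hl)
    obtain ⟨g, hg, hg'⟩ := exists_shift hM (hκ l List.mem_cons_self)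
    refine ⟨g, by rwa [List.sum_cons, add_comm], fun n b s x hb hs => ?_⟩
    have hS : 0 < ∑ i, s i := Finset.sum_pos (fun i _ => hs i) Finset.univ_nonempty
    have hs' : ∀ i j, 0 < (s + Pi.single i 1 : Fin (n + 1) → ℝ) j := fun i j =>
      add_pos_of_pos_of_nonneg (hs j) (by rw [Pi.single_apply]; split_ifs <;> simp)
    have hfun : Set.EqOn (fun a => ((l :: κ).map (lagMoment b x a)).prod * daWt b s a)
        (fun a => ∑ i, x i ^ l *
          ((κ.map (lagMoment b x a)).prod * daWt b (s + Pi.single i 1) a))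
        {a | Interlaces a b} := by
      intro a ha
      simp only [List.map_cons, List.prod_cons]
      nth_rewrite 1 [lagMoment]
      rw [Finset.sum_mul, Finset.sum_mul]
      refine Finset.sum_congr rfl fun i _ => ?_
      rw [← lagW_mul_daWt s ha i]
      ring
    have hInt := fun i => (hM' n b (s + Pi.single i 1) x hb (hs' i)).1.const_mul (x i ^ l)
    constructor
    · rw [integrableOn_congr_fun hfun (measurableSet_interlaces b)]
      exact integrable_finsetSum _ fun i _ => hInt i
    · rw [setIntegral_congr_fun (measurableSet_interlaces b) hfun,
        integral_finsetSum _ fun i _ => hInt i]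
      simp_rw [integral_const_mul]
      rw [List.length_cons, risingFact_succ, ← hg', Finset.sum_div, Finset.mul_sum]
      refine Finset.sum_congr rfl fun i _ => ?_
      rw [(hM' n b (s + Pi.single i 1) x hb (hs' i)).2, daZ_add_single b hs]
      have h1 : ∑ j, (s + Pi.single i 1 : Fin (n + 1) → ℝ) j = (∑ j, s j) + 1 := by
        simp [Finset.sum_add_distrib]
      have h2 : (fun k => ∑ j, (s + Pi.single i 1 : Fin (n + 1) → ℝ) j * x j ^ k) =
          fun k => (∑ j, s j * x j ^ k) + x i ^ k := by
        funext k
        simp [add_mul, Finset.sum_add_distrib, Pi.single_apply]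
      rw [h1, h2]
      have := (risingFact_pos (z := (∑ j, s j) + 1) (by positivity) κ.length).ne'
      field_simp

/-! ### Power sums of interlacing sequences -/

open PowerSeries in
lemma derivative_prod_one_sub {ι : Type*} (s : Finset ι) (u : ι → ℝ) :
    d⁄dX ℝ (∏ r ∈ s, (1 - C (u r) * X : PowerSeries ℝ)) =
      -((∏ r ∈ s, (1 - C (u r) * X)) * ∑ r ∈ s, PowerSeries.mk fun l => u r ^ (l + 1)) := by
  have hgeo : ∀ r, (1 - C (u r) * X : PowerSeries ℝ) * PowerSeries.mk (fun l => u r ^ (l + 1)) =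
      C (u r) := by
    intro r
    ext n
    rw [sub_mul, one_mul, mul_assoc, map_sub, coeff_C_mul, coeff_mk]
    cases n with
    | zero => simp
    | succ n => rw [mul_comm X, coeff_succ_mul_X, coeff_mk, coeff_C, if_neg (by omega)]; ring
  induction s using Finset.cons_induction with
  | empty => simp
  | cons r s hr ih =>
    rw [Finset.prod_cons, Derivation.leibniz, ih, Finset.sum_cons]
    have h1 : d⁄dX ℝ (1 - C (u r) * X : PowerSeries ℝ) = -C (u r) := by
      rw [map_sub, Derivation.leibniz]
      simp [derivative_X]
    rw [h1]
    simp only [smul_eq_mul]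
    linear_combination (-(∏ r ∈ s, (1 - C (u r) * X : PowerSeries ℝ))) * (-hgeo r)

/-- The Lagrange interpolation identity for reversed polynomials. -/
lemma sum_lagW_mul_prod_one_sub {n : ℕ} {b : Fin (n + 1) → ℝ} (hb : Function.Injective b)
    (a : Fin n → ℝ) :
    ∑ i, Polynomial.C (lagW b a i) *
        ∏ j, (1 - Polynomial.C (b (i.succAbove j)) * Polynomial.X) =
      ∏ r, (1 - Polynomial.C (a r) * Polynomial.X) := by
  apply mul_left_cancel₀ (Polynomial.X_ne_zero (R := ℝ))
  refine Polynomial.funext fun z => ?_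
  rcases eq_or_ne z 0 with rfl | hz
  · simp
  have h := congrArg (Polynomial.eval z⁻¹) (lagrange_lagW hb a 1)
  simp only [Polynomial.eval_finsetSum, Polynomial.eval_mul, Polynomial.eval_prod,
    Polynomial.eval_C, Polynomial.eval_sub, Polynomial.eval_X, one_mul] at h
  simp only [Polynomial.eval_finsetSum, Polynomial.eval_mul, Polynomial.eval_prod,
    Polynomial.eval_C, Polynomial.eval_sub, Polynomial.eval_X, Polynomial.eval_one]
  have key : ∀ v : Fin n → ℝ, ∏ r, (1 - v r * z) = z ^ n * ∏ r, (z⁻¹ - v r) := by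
    intro v
    have hc : z ^ n = ∏ _r : Fin n, z := by simp
    rw [hc, ← Finset.prod_mul_distrib]
    exact Finset.prod_congr rfl fun r _ => by field_simp
  simp_rw [key]
  rw [← h, Finset.mul_sum, Finset.mul_sum, Finset.mul_sum]
  exact Finset.sum_congr rfl fun i _ => by ring

lemma lagW_affine {n : ℕ} (b : Fin (n + 1) → ℝ) (a : Fin n → ℝ) (c : ℝ) {σ : ℝ} (hσ : σ ≠ 0)
    (i : Fin (n + 1)) :
    lagW (fun i => (b i - c) / σ) (fun r => (a r - c) / σ) i = lagW b a i := by
  refine Finset.prod_congr rfl fun r _ => ?_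
  rw [← sub_div, ← sub_div, div_div_div_cancel_right₀ hσ]
  ring_nf

/-- Newton-type relation between the differences of power sums and the weighted power sums. -/
lemma lagMoment_newton {n : ℕ} {b : Fin (n + 1) → ℝ} (hb : Function.Injective b)
    (a : Fin n → ℝ) (l : ℕ) :
    (l + 1) * lagMoment b b a (l + 1) =
      ∑ q ∈ Finset.HasAntidiagonal.antidiagonal l, lagMoment b b a q.1 *
        ((∑ i, b i ^ (q.2 + 1)) - ∑ r, a r ^ (q.2 + 1)) := by
  open PowerSeries in
  set A : PowerSeries ℝ := PowerSeries.mk (lagMoment b b a) with hA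
  set Eb : PowerSeries ℝ := ∏ i, (1 - C (b i) * X) with hEb
  set Ea : PowerSeries ℝ := ∏ i, (1 - C (a i) * X) with hEa
  have hgeo : ∀ i, (1 - C (b i) * X : PowerSeries ℝ) * PowerSeries.mk (fun l => b i ^ l) = 1 := by
    intro i
    ext n
    rw [sub_mul, one_mul, mul_assoc, map_sub, coeff_C_mul, coeff_mk]
    cases n with
    | zero => simp
    | succ n => rw [mul_comm X, coeff_succ_mul_X, coeff_mk, coeff_one, if_neg (by omega)]; ring
  have h1 : Ea = Eb * A := by
    have hAs : A = ∑ i, C (lagW b a i) * PowerSeries.mk (fun l => b i ^ l) := by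
      ext l
      simp [hA, lagMoment]
    have h := congrArg (Polynomial.coeToPowerSeries.ringHom (R := ℝ))
      (sum_lagW_mul_prod_one_sub hb a)
    simp only [map_sum, map_mul, map_prod, map_sub, map_one,
      Polynomial.coeToPowerSeries.ringHom_apply, Polynomial.coe_C, Polynomial.coe_X] at h
    rw [hEa, ← h, hAs, Finset.mul_sum]
    refine Finset.sum_congr rfl fun i _ => ?_
    rw [hEb, Fin.prod_univ_succAbove _ i]
    linear_combination (-(C (lagW b a i)) *
      ∏ j, (1 - C (b (i.succAbove j)) * X : PowerSeries ℝ)) * hgeo i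
  have hEb0 : Eb ≠ 0 := by
    refine Finset.prod_ne_zero_iff.mpr fun i _ h => ?_
    have := hgeo i
    rw [h, zero_mul] at this
    exact zero_ne_one this
  have h2 : d⁄dX ℝ A = A * ((∑ i, PowerSeries.mk fun l => b i ^ (l + 1)) -
      ∑ r, PowerSeries.mk fun l => a r ^ (l + 1)) := by
    have h3 := congrArg (d⁄dX ℝ) h1
    rw [Derivation.leibniz, hEa, hEb, derivative_prod_one_sub, derivative_prod_one_sub, ← hEa,
      ← hEb, h1] at h3
    simp only [smul_eq_mul] at h3
    apply mul_left_cancel₀ hEb0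
    linear_combination -h3
  have h4 := congrArg (coeff l) h2
  rw [coeff_derivative, coeff_mul] at h4
  simp only [hA, coeff_mk, map_sub, map_sum] at h4
  linear_combination h4

/-! ### One step of the Dixon–Anderson chain on products of power sums -/

/-- Products of power sums in two families of variables, of total degree `d`, and with at least
`j` factors from the second family. -/
def mixSpace (d j : ℕ) : Submodule ℝ ((ℕ → ℝ) → (ℕ → ℝ) → ℝ) :=
  Submodule.span ℝ {F | ∃ ν κ : Multiset ℕ, (∀ i ∈ ν, 0 < i) ∧ (∀ i ∈ κ, 0 < i) ∧
    ν.sum + κ.sum = d ∧ j ≤ Multiset.card κ ∧ F = fun p A => powProd ν p * powProd κ A}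

lemma gen_mem_mixSpace {d j : ℕ} {ν κ : Multiset ℕ} (hν : ∀ i ∈ ν, 0 < i) (hκ : ∀ i ∈ κ, 0 < i)
    (hd : ν.sum + κ.sum = d) (hj : j ≤ Multiset.card κ) :
    (fun p A => powProd ν p * powProd κ A) ∈ mixSpace d j :=
  Submodule.subset_span ⟨ν, κ, hν, hκ, hd, hj, rfl⟩

lemma mixSpace_anti {d j k : ℕ} (h : k ≤ j) : mixSpace d j ≤ mixSpace d k :=
  Submodule.span_mono fun _ ⟨ν, κ, h1, h2, h3, h4, h5⟩ => ⟨ν, κ, h1, h2, h3, h.trans h4, h5⟩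

lemma powProd_add (ν κ : Multiset ℕ) (p : ℕ → ℝ) :
    powProd (ν + κ) p = powProd ν p * powProd κ p := by
  simp [powProd]

lemma powProd_cons (i : ℕ) (ν : Multiset ℕ) (p : ℕ → ℝ) :
    powProd (i ::ₘ ν) p = p i * powProd ν p := by
  simp [powProd]

lemma mul_mem_mixSpace {d j e k : ℕ} {F G : (ℕ → ℝ) → (ℕ → ℝ) → ℝ} (hF : F ∈ mixSpace d j)
    (hG : G ∈ mixSpace e k) : F * G ∈ mixSpace (d + e) (j + k) := by
  induction hF using Submodule.span_induction with
  | mem F hF =>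
    obtain ⟨ν, κ, h1, h2, h3, h4, rfl⟩ := hF
    induction hG using Submodule.span_induction with
    | mem G hG =>
      obtain ⟨ν', κ', h1', h2', h3', h4', rfl⟩ := hG
      have : (fun p A => powProd ν p * powProd κ A) * (fun p A => powProd ν' p * powProd κ' A) =
          fun p A => powProd (ν + ν') p * powProd (κ + κ') A := by
        funext p A
        simp only [Pi.mul_apply, powProd_add]
        ring
      rw [this]
      refine gen_mem_mixSpace (fun i hi => ?_) (fun i hi => ?_) ?_ ?_
      · exact (Multiset.mem_add.mp hi).elim (h1 i) (h1' i)
      · exact (Multiset.mem_add.mp hi).elim (h2 i) (h2' i)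
      · rw [Multiset.sum_add, Multiset.sum_add]; omega
      · rw [Multiset.card_add]; omega
    | zero => simp
    | add g h _ _ hg hh => rw [mul_add]; exact add_mem hg hh
    | smul c g _ hg => rw [mul_smul_comm]; exact Submodule.smul_mem _ c hg
  | zero => simp
  | add f h _ _ hf hh => rw [add_mul]; exact add_mem hf hh
  | smul c f _ hf => rw [smul_mul_assoc]; exact Submodule.smul_mem _ c hf

lemma powProd_left_mem {ν : Multiset ℕ} (hν : ∀ i ∈ ν, 0 < i) :
    (fun p _ => powProd ν p) ∈ mixSpace ν.sum 0 := by
  have := gen_mem_mixSpace (κ := 0) hν (by simp) (by simp; rfl) le_rfl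
  simpa [powProd] using this

lemma coord_right_mem {l : ℕ} (hl : 0 < l) : (fun _ A => A l) ∈ mixSpace l 1 := by
  have := gen_mem_mixSpace (ν := 0) (κ := {l}) (d := l) (j := 1) (by simp) (by simpa using hl)
    (by simp) (by simp)
  simpa [powProd] using this

/-- The differences of power sums of two interlacing sequences in terms of the weighted power
sums. -/
def powDiff : ℕ → (ℕ → ℝ) → ℝ
  | 0 => fun _ => 0
  | n + 1 => fun A => (n + 1) * A (n + 1) - ∑ k : Fin n, A (k + 1) * powDiff (n - k) A
  termination_by n => n
  decreasing_by omega

lemma powDiff_eq {A Q : ℕ → ℝ} (hA : A 0 = 1) (h : ∀ l : ℕ, (l + 1) * A (l + 1) =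
    ∑ q ∈ Finset.HasAntidiagonal.antidiagonal l, A q.1 * Q (q.2 + 1)) {l : ℕ} (hl : 0 < l) :
    powDiff l A = Q l := by
  induction l using Nat.strong_induction_on with
  | _ l ih =>
    obtain ⟨n, rfl⟩ : ∃ n, l = n + 1 := ⟨l - 1, by omega⟩
    have hn := h n
    rw [Finset.Nat.sum_antidiagonal_eq_sum_range_succ_mk, Finset.sum_range_succ', hA,
      Finset.sum_range] at hn
    rw [powDiff]
    have : ∑ k : Fin n, A (k + 1) * powDiff (n - k) A =
        ∑ k : Fin n, A (k + 1) * Q (n - (k + 1) + 1) := by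
      refine Finset.sum_congr rfl fun k _ => ?_
      rw [ih (n - k) (by omega) (by omega), show n - (k + 1) + 1 = n - k by omega]
    simp only [Nat.sub_zero] at hn
    beta_reduce
    rw [this]
    linear_combination hn

lemma powDiff_sub_mem {l : ℕ} (hl : 0 < l) :
    (fun _ A => powDiff l A) ∈ mixSpace l 1 ∧
      (fun _ A => powDiff l A - l * A l) ∈ mixSpace l 2 := by
  induction l using Nat.strong_induction_on with
  | _ l ih =>
    obtain ⟨n, rfl⟩ : ∃ n, l = n + 1 := ⟨l - 1, by omega⟩
    have h2 : (fun _ A => powDiff (n + 1) A - (n + 1 : ℕ) * A (n + 1)) ∈ mixSpace (n + 1) 2 := by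
      have : (fun (_ : ℕ → ℝ) A => powDiff (n + 1) A - (n + 1 : ℕ) * A (n + 1)) =
          -∑ k : Fin n, (fun (_ : ℕ → ℝ) (A : ℕ → ℝ) => A (k + 1)) *
            (fun _ A => powDiff (n - k) A) := by
        funext p A
        rw [powDiff]
        simp
      rw [this]
      refine neg_mem (sum_mem fun k _ => ?_)
      have := mul_mem_mixSpace (coord_right_mem (l := k + 1) (by omega))
        (ih (n - k) (by omega) (by omega)).1
      rwa [show (k : ℕ) + 1 + (n - k) = n + 1 by omega] at this
    refine ⟨?_, h2⟩
    have := add_mem (mixSpace_anti one_le_two h2)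
      (Submodule.smul_mem _ ((n + 1 : ℕ) : ℝ) (coord_right_mem hl))
    convert this using 1
    funext p A
    simp

/-- `G K p` is the mean of `F p A` under the Dixon–Anderson density with total parameter `θ K` and
weighted power sums `θ p`, where `A` are the random weighted power sums. -/
def HasDAMean (θ : ℝ) (F : (ℕ → ℝ) → (ℕ → ℝ) → ℝ) (G : ℝ → (ℕ → ℝ) → ℝ) : Prop :=
  ∀ (n : ℕ) (b s x : Fin (n + 1) → ℝ) (K : ℝ) (p : ℕ → ℝ), StrictAnti b → (∀ i, 0 < s i) →
    ∑ i, s i = θ * K → (∀ l, 0 < l → ∑ i, s i * x i ^ l = θ * p l) →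
    IntegrableOn (fun a => F p (lagMoment b x a) * daWt b s a) {a | Interlaces a b} ∧
    ∫ a in {a | Interlaces a b}, F p (lagMoment b x a) * daWt b s a = daZ b s * G K p

lemma HasDAMean.add {θ : ℝ} {F F' : (ℕ → ℝ) → (ℕ → ℝ) → ℝ} {G G' : ℝ → (ℕ → ℝ) → ℝ}
    (h : HasDAMean θ F G) (h' : HasDAMean θ F' G') : HasDAMean θ (F + F') (G + G') := by
  intro n b s x K p hb hs hK hp
  obtain ⟨h1, h2⟩ := h n b s x K p hb hs hK hp
  obtain ⟨h1', h2'⟩ := h' n b s x K p hb hs hK hp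
  simp only [Pi.add_apply, add_mul]
  exact ⟨h1.add h1', by rw [integral_add h1 h1', h2, h2', mul_add]⟩

lemma HasDAMean.mul_left {θ : ℝ} {F : (ℕ → ℝ) → (ℕ → ℝ) → ℝ} {G : ℝ → (ℕ → ℝ) → ℝ}
    (h : HasDAMean θ F G) (f : (ℕ → ℝ) → ℝ) :
    HasDAMean θ (fun p A => f p * F p A) (fun K p => f p * G K p) := by
  intro n b s x K p hb hs hK hp
  obtain ⟨h1, h2⟩ := h n b s x K p hb hs hK hp
  simp only [mul_assoc]
  exact ⟨h1.const_mul _, by rw [integral_const_mul, h2, mul_left_comm]⟩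

lemma hasDAMean_left (θ : ℝ) (f : (ℕ → ℝ) → ℝ) :
    HasDAMean θ (fun p _ => f p) (fun _ p => f p) := by
  intro n b s x K p hb hs hK hp
  exact ⟨(integrableOn_daWt hb hs).const_mul _, by
    rw [integral_const_mul, integral_daWt hb hs, mul_comm]⟩

lemma powProd_congr {ν : Multiset ℕ} (hν : ∀ i ∈ ν, 0 < i) {p q : ℕ → ℝ}
    (h : ∀ l, 0 < l → p l = q l) : powProd ν p = powProd ν q := by
  rw [powProd, powProd, Multiset.map_congr rfl fun i hi => h i (hν i hi)]

lemma powProd_mul_left (ν : Multiset ℕ) (θ : ℝ) (p : ℕ → ℝ) :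
    powProd ν (fun l => θ * p l) = θ ^ Multiset.card ν * powProd ν p := by
  simp [powProd, Multiset.prod_map_mul]

lemma polySpace_congr {d : ℕ} {f : (ℕ → ℝ) → ℝ} (hf : f ∈ polySpace d) {p q : ℕ → ℝ}
    (h : ∀ l, 0 < l → p l = q l) : f p = f q := by
  induction hf using polySpace_induction with
  | gen ν hν hd => exact powProd_congr hν h
  | zero => rfl
  | add f g _ _ h1 h2 => simp [h1, h2]
  | smul c f _ h => simp [h]

lemma polySpace_scale {d : ℕ} {f : (ℕ → ℝ) → ℝ} (hf : f ∈ polySpace d) (θ : ℝ) :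
    (fun p => f fun l => θ * p l) ∈ polySpace d := by
  induction hf using polySpace_induction with
  | gen ν hν hd =>
    simp only [powProd_mul_left]
    exact Submodule.smul_mem _ (θ ^ Multiset.card ν) (powProd_mem hν hd)
  | zero => exact zero_mem _
  | add f g _ _ h1 h2 => exact add_mem h1 h2
  | smul c f _ h => exact Submodule.smul_mem _ c h

lemma exists_hasDAMean_gen (θ : ℝ) {ν κ : Multiset ℕ} (hν : ∀ i ∈ ν, 0 < i)
    (hκ : ∀ i ∈ κ, 0 < i) :
    ∃ g ∈ polySpace (ν.sum + κ.sum), HasDAMean θ (fun p A => powProd ν p * powProd κ A)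
      (fun K p => g p / risingFact (θ * K) (Multiset.card κ)) := by
  obtain ⟨M, hM, h⟩ := exists_integral_lagMoment κ.toList (by simpa using hκ)
  have hs : κ.toList.sum = κ.sum := by rw [← Multiset.sum_coe, Multiset.coe_toList]
  rw [hs] at hM
  refine ⟨_, mul_mem_polySpace (powProd_mem hν rfl) (polySpace_scale hM θ), ?_⟩
  have : HasDAMean θ (fun _ A => powProd κ A)
      (fun K p => M (fun l => θ * p l) / risingFact (θ * K) (Multiset.card κ)) := by
    intro n b s x K p hb hs hK hp
    have e : ∀ A : ℕ → ℝ, powProd κ A = (κ.toList.map A).prod := fun A => by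
      rw [powProd, ← Multiset.prod_coe, ← Multiset.map_coe, Multiset.coe_toList]
    simp only [e]
    obtain ⟨h1, h2⟩ := h n b s x hb hs
    refine ⟨h1, ?_⟩
    rw [h2, hK, polySpace_congr hM hp, Multiset.length_toList]
  convert this.mul_left (powProd ν) using 3
  simp [mul_div_assoc]

lemma hasDAMean_coord {θ : ℝ} (hθ : 0 < θ) {l : ℕ} (hl : 0 < l) :
    HasDAMean θ (fun _ A => A l) (fun K p => p l / K) := by
  intro n b s x K p hb hs hK hp
  have hS : 0 < ∑ i, s i := Finset.sum_pos (fun i _ => hs i) Finset.univ_nonempty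
  have hs' : ∀ i j, 0 < (s + Pi.single i 1 : Fin (n + 1) → ℝ) j := fun i j =>
    add_pos_of_pos_of_nonneg (hs j) (by rw [Pi.single_apply]; split_ifs <;> simp)
  have hfun : Set.EqOn (fun a => lagMoment b x a l * daWt b s a)
      (fun a => ∑ i, x i ^ l * daWt b (s + Pi.single i 1) a) {a | Interlaces a b} := by
    intro a ha
    simp only [lagMoment, Finset.sum_mul]
    exact Finset.sum_congr rfl fun i _ => by rw [← lagW_mul_daWt s ha i]; ring
  have hInt := fun i => (integrableOn_daWt hb (hs' i)).const_mul (x i ^ l)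
  constructor
  · rw [integrableOn_congr_fun hfun (measurableSet_interlaces b)]
    exact integrable_finsetSum _ fun i _ => hInt i
  · rw [setIntegral_congr_fun (measurableSet_interlaces b) hfun,
      integral_finsetSum _ fun i _ => hInt i]
    simp_rw [integral_const_mul]
    have hK' : 0 < K := by rw [hK] at hS; exact pos_of_mul_pos_right hS hθ.le
    have : p l / K = (∑ i, s i * x i ^ l) / (θ * K) := by
      rw [hp l hl, mul_div_mul_left _ _ hθ.ne']
    rw [this, Finset.sum_div, Finset.mul_sum]
    refine Finset.sum_congr rfl fun i _ => ?_
    rw [integral_daWt hb (hs' i), daZ_add_single b hs, hK]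
    ring

lemma exists_hasDAMean_mixSpace (θ : ℝ) {d : ℕ} {R : (ℕ → ℝ) → (ℕ → ℝ) → ℝ}
    (hR : R ∈ mixSpace d 2) : ∃ g : ℕ → (ℕ → ℝ) → ℝ, (∀ j, g j ∈ polySpace d) ∧
      HasDAMean θ R (fun K p => ∑ j ∈ Finset.range d, g j p / risingFact (θ * K) (j + 2)) := by
  induction hR using Submodule.span_induction with
  | mem F hF =>
    obtain ⟨ν, κ, hν, hκ, rfl, hc, rfl⟩ := hF
    obtain ⟨g, hg, h⟩ := exists_hasDAMean_gen θ hν hκ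
    refine ⟨fun j => if j = Multiset.card κ - 2 then g else 0, fun j => ?_, ?_⟩
    · dsimp only
      split_ifs
      exacts [hg, zero_mem _]
    · have hcard : Multiset.card κ ≤ κ.sum := by
        simpa using Multiset.card_nsmul_le_sum (s := κ) (a := 1) fun i hi => hκ i hi
      convert h using 3 with K p
      rw [Finset.sum_eq_single (Multiset.card κ - 2)]
      · simp only [if_true, Nat.sub_add_cancel hc]
      · intro j _ hj
        simp [hj]
      · intro h
        rw [Finset.mem_range] at h
        omega
  | zero =>
    refine ⟨fun _ => 0, fun _ => zero_mem _, ?_⟩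
    convert hasDAMean_left θ 0 using 3
    · simp
    · exact Finset.sum_eq_zero fun j _ => by simp
  | add F F' _ _ h h' =>
    obtain ⟨g, hg, h⟩ := h
    obtain ⟨g', hg', h'⟩ := h'
    refine ⟨g + g', fun j => add_mem (hg j) (hg' j), ?_⟩
    convert h.add h' using 3
    simp [add_div, Finset.sum_add_distrib]
  | smul c F _ h =>
    obtain ⟨g, hg, h⟩ := h
    refine ⟨c • g, fun j => Submodule.smul_mem _ c (hg j), ?_⟩
    convert h.mul_left (fun _ => c) using 3
    · simp
    · rw [Finset.mul_sum]
      exact Finset.sum_congr rfl fun j _ => by simp [mul_div_assoc]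

lemma exists_expand_powProd {θ : ℝ} (hθ : 0 < θ) (ν : Multiset ℕ) (hν : ∀ i ∈ ν, 0 < i) :
    ∃ L ∈ mixSpace ν.sum 1, ∃ R ∈ mixSpace ν.sum 2,
      HasDAMean θ L (fun K p => ν.sum / K * powProd ν p) ∧
      ∀ p A, powProd ν (fun l => p l - powDiff l A) = powProd ν p - L p A + R p A := by
  induction ν using Multiset.induction with
  | empty =>
    refine ⟨0, zero_mem _, 0, zero_mem _, ?_, by simp [powProd]⟩
    convert hasDAMean_left θ 0 using 3 with K p
    · simp
    · rw [Multiset.sum_zero, Nat.cast_zero, zero_div, zero_mul, Pi.zero_apply]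
  | cons i ν ih =>
    have hi : 0 < i := hν i (Multiset.mem_cons_self i ν)
    have hν' : ∀ i ∈ ν, 0 < i := fun i hi => hν i (Multiset.mem_cons_of_mem hi)
    obtain ⟨L, hL, R, hR, hm, he⟩ := ih hν'
    have hpi : (fun (p : ℕ → ℝ) (_ : ℕ → ℝ) => p i) ∈ mixSpace i 0 := by
      have := powProd_left_mem (ν := {i}) (by simpa using hi)
      simpa [powProd] using this
    have hpν := powProd_left_mem hν'
    have hq := powDiff_sub_mem hi
    have hsum : (i ::ₘ ν).sum = i + ν.sum := Multiset.sum_cons i ν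
    have m1 : (fun p _ => p i) * L ∈ mixSpace (i ::ₘ ν).sum 1 := by
      have := mul_mem_mixSpace hpi hL
      rwa [zero_add, ← hsum] at this
    have m2 : (fun (_ : ℕ → ℝ) A => A i) * (fun p _ => powProd ν p) ∈
        mixSpace (i ::ₘ ν).sum 1 := by
      have := mul_mem_mixSpace (coord_right_mem hi) hpν
      rwa [add_zero, ← hsum] at this
    have m3 : (fun p _ => p i) * R ∈ mixSpace (i ::ₘ ν).sum 2 := by
      have := mul_mem_mixSpace hpi hR
      rwa [zero_add, ← hsum] at this
    have m4 : (fun (_ : ℕ → ℝ) A => powDiff i A - i * A i) * (fun p _ => powProd ν p) ∈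
        mixSpace (i ::ₘ ν).sum 2 := by
      have := mul_mem_mixSpace hq.2 hpν
      rwa [add_zero, ← hsum] at this
    have m5 : (fun _ A => powDiff i A) * L ∈ mixSpace (i ::ₘ ν).sum 2 := by
      have := mul_mem_mixSpace hq.1 hL
      rwa [← hsum] at this
    have m6 : (fun _ A => powDiff i A) * R ∈ mixSpace (i ::ₘ ν).sum 2 := by
      have := mixSpace_anti (k := 2) (by norm_num) (mul_mem_mixSpace hq.1 hR)
      rwa [← hsum] at this
    refine ⟨(fun p _ => p i) * L + (i : ℝ) • ((fun _ A => A i) * (fun p _ => powProd ν p)),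
      add_mem m1 (Submodule.smul_mem _ _ m2),
      (fun p _ => p i) * R - (fun _ A => powDiff i A - i * A i) * (fun p _ => powProd ν p) +
        (fun _ A => powDiff i A) * L - (fun _ A => powDiff i A) * R,
      sub_mem (add_mem (sub_mem m3 m4) m5) m6, ?_, ?_⟩
    · convert (hm.mul_left (fun p => p i)).add
        ((hasDAMean_coord hθ hi).mul_left (fun p => i * powProd ν p)) using 1
      · funext p A
        simp
        ring
      · funext K p
        simp [powProd_cons]
        ring
    · intro p A
      simp only [powProd_cons, he, Pi.add_apply, Pi.mul_apply, Pi.smul_apply, Pi.sub_apply,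
        smul_eq_mul]
      ring

/-- Power sums of the affine images of the entries of a vector. -/
def affPS {n : ℕ} (c σ : ℝ) (u : Fin n → ℝ) (l : ℕ) : ℝ := ∑ i, ((u i - c) / σ) ^ l

lemma affPS_eq {n : ℕ} {b : Fin (n + 1) → ℝ} (hb : Function.Injective b) (a : Fin n → ℝ) (c : ℝ)
    {σ : ℝ} (hσ : σ ≠ 0) {l : ℕ} (hl : 0 < l) :
    affPS c σ a l =
      affPS c σ b l - powDiff l (lagMoment b (fun i => (b i - c) / σ) a) := by
  have hinj : Function.Injective fun i => (b i - c) / σ := fun i j h => by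
    rw [div_left_inj' hσ, sub_left_inj] at h
    exact hb h
  have e : lagMoment b (fun i => (b i - c) / σ) a =
      lagMoment (fun i => (b i - c) / σ) (fun i => (b i - c) / σ) (fun r => (a r - c) / σ) := by
    funext l
    simp only [lagMoment, lagW_affine b a c hσ]
  rw [e, powDiff_eq (Q := fun l => affPS c σ b l - affPS c σ a l) ?_
    (fun l => by exact_mod_cast lagMoment_newton hinj _ l) hl]
  · ring
  · simp only [lagMoment, pow_zero, mul_one]
    exact sum_lagW hinj _

/-- The mean of a product of power sums under the Dixon–Anderson density. -/
lemma exists_mean_powProd {θ : ℝ} (hθ : 0 < θ) {ν : Multiset ℕ} (hν : ∀ i ∈ ν, 0 < i) :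
    ∃ g : ℕ → (ℕ → ℝ) → ℝ, (∀ j, g j ∈ polySpace ν.sum) ∧
      ∀ (n : ℕ) (b s : Fin (n + 1) → ℝ) (c σ K : ℝ) (o p : ℕ → ℝ), σ ≠ 0 → StrictAnti b →
        (∀ i, 0 < s i) → ∑ i, s i = θ * K →
        (∀ l, 0 < l → ∑ i, s i * ((b i - c) / σ) ^ l = θ * p l) →
        (∀ l, 0 < l → p l = o l + affPS c σ b l) →
        IntegrableOn (fun a => powProd ν (fun l => o l + affPS c σ a l) * daWt b s a)
          {a | Interlaces a b} ∧
        ∫ a in {a | Interlaces a b}, powProd ν (fun l => o l + affPS c σ a l) * daWt b s a =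
          daZ b s * ((1 - ν.sum / K) * powProd ν p +
            ∑ j ∈ Finset.range ν.sum, g j p / risingFact (θ * K) (j + 2)) := by
  obtain ⟨L, -, R, hR, hm, he⟩ := exists_expand_powProd hθ ν hν
  obtain ⟨g, hg, hmR⟩ := exists_hasDAMean_mixSpace θ hR
  refine ⟨g, hg, fun n b s c σ K o p hσ hb hs hK hp ho => ?_⟩
  obtain ⟨h1, h2⟩ := (((hasDAMean_left θ (powProd ν)).add (hm.mul_left fun _ => -1)).add hmR)
    n b s (fun i => (b i - c) / σ) K p hb hs hK hp
  have e : ∀ a, powProd ν (fun l => o l + affPS c σ a l) =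
      powProd ν p - L p (lagMoment b (fun i => (b i - c) / σ) a) +
        R p (lagMoment b (fun i => (b i - c) / σ) a) := by
    intro a
    rw [← he]
    refine powProd_congr hν fun l hl => ?_
    rw [affPS_eq hb.injective a c hσ hl, ho l hl]
    ring
  simp only [e]
  constructor
  · convert h1 using 3
    simp only [Pi.add_apply]
    ring
  · convert h2 using 2
    · funext a
      simp only [Pi.add_apply]
      ring
    · simp only [Pi.add_apply]
      ring

/-! ### The chain of averaging operators on coefficient vectors -/

/-- The combination of products of power sums with coefficient vector `c`. -/
def pEval {d : ℕ} (c : Nat.Partition d → ℝ) (p : ℕ → ℝ) : ℝ := ∑ ν, c ν * powProd ν.parts p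

lemma exists_pEval {d : ℕ} {f : (ℕ → ℝ) → ℝ} (hf : f ∈ polySpace d) :
    ∃ c : Nat.Partition d → ℝ, ∀ p, f p = pEval c p := by
  obtain ⟨c, hc⟩ := (Submodule.mem_span_range_iff_exists_fun ℝ).mp hf
  exact ⟨c, fun p => by rw [← hc]; simp [pEval]⟩

lemma pEval_mem {d : ℕ} (c : Nat.Partition d → ℝ) : pEval c ∈ polySpace d := by
  have : pEval c = ∑ ν : Nat.Partition d, c ν • powProd ν.parts := by
    funext p
    simp [pEval]
  rw [this]
  exact sum_mem fun ν _ => Submodule.smul_mem _ _ (Submodule.subset_span ⟨ν, rfl⟩)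

lemma pEval_add {d : ℕ} (c c' : Nat.Partition d → ℝ) (p : ℕ → ℝ) :
    pEval (c + c') p = pEval c p + pEval c' p := by
  simp [pEval, add_mul, Finset.sum_add_distrib]

lemma pEval_smul {d : ℕ} (t : ℝ) (c : Nat.Partition d → ℝ) (p : ℕ → ℝ) :
    pEval (t • c) p = t * pEval c p := by
  simp [pEval, mul_assoc, Finset.mul_sum]

lemma pEval_sum {d : ℕ} {ι : Type*} (s : Finset ι) (c : ι → Nat.Partition d → ℝ) (p : ℕ → ℝ) :
    pEval (∑ i ∈ s, c i) p = ∑ i ∈ s, pEval (c i) p := by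
  simp only [pEval, Finset.sum_apply, Finset.sum_mul]
  exact Finset.sum_comm

lemma sq_le_risingFact {z : ℝ} (hz : 0 < z) (j : ℕ) : z ^ 2 ≤ risingFact z (j + 2) := by
  rw [risingFact, Finset.prod_range_succ', Finset.prod_range_succ']
  have h : (1 : ℝ) ≤ ∏ i ∈ Finset.range j, (z + ((i + 1 + 1 : ℕ) : ℝ)) :=
    Finset.one_le_prod fun i _ => by push_cast; linarith [(Nat.cast_nonneg i : (0 : ℝ) ≤ i)]
  push_cast at h ⊢
  nlinarith [mul_pos hz hz, mul_nonneg (sub_nonneg.mpr h) (mul_pos hz hz).le,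
    mul_nonneg (sub_nonneg.mpr h) hz.le]

/-- `T K` is the action on coefficient vectors of averaging over the Dixon–Anderson density with
total parameter `θ K`. -/
def IsDAStep (θ : ℝ) {d : ℕ}
    (T : ℝ → (Nat.Partition d → ℝ) →L[ℝ] (Nat.Partition d → ℝ)) : Prop :=
  ∀ (n : ℕ) (b s : Fin (n + 1) → ℝ) (c σ K : ℝ) (o p : ℕ → ℝ), σ ≠ 0 → StrictAnti b →
    (∀ i, 0 < s i) → ∑ i, s i = θ * K →
    (∀ l, 0 < l → ∑ i, s i * ((b i - c) / σ) ^ l = θ * p l) →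
    (∀ l, 0 < l → p l = o l + affPS c σ b l) →
    ∀ v : Nat.Partition d → ℝ,
    IntegrableOn (fun a => pEval v (fun l => o l + affPS c σ a l) * daWt b s a)
      {a | Interlaces a b} ∧
    ∫ a in {a | Interlaces a b}, pEval v (fun l => o l + affPS c σ a l) * daWt b s a =
      daZ b s * pEval (T K v) p

lemma exists_isDAStep {θ : ℝ} (hθ : 0 < θ) (d : ℕ) :
    ∃ T : ℝ → (Nat.Partition d → ℝ) →L[ℝ] (Nat.Partition d → ℝ), IsDAStep θ T ∧
      ∃ C : ℝ, ∀ K : ℝ, 0 < K →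
        ‖T K - (1 - d / K : ℝ) • ContinuousLinearMap.id ℝ (Nat.Partition d → ℝ)‖ ≤ C / K ^ 2 := by
  have h := fun ν : Nat.Partition d =>
    exists_mean_powProd hθ (ν := ν.parts) fun i hi => ν.parts_pos hi
  choose g hg h using h
  have hg' : ∀ (ν : Nat.Partition d) (j : ℕ), ∃ c : Nat.Partition d → ℝ,
      ∀ p, g ν j p = pEval c p := by
    intro ν j
    have := hg ν j
    rw [ν.parts_sum] at this
    exact exists_pEval this
  choose G hG using hg'
  let L : ℕ → (Nat.Partition d → ℝ) →L[ℝ] (Nat.Partition d → ℝ) := fun j =>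
    LinearMap.toContinuousLinearMap (Fintype.linearCombination ℝ fun ν => G ν j)
  have hL : ∀ j v p, pEval (L j v) p = ∑ ν, v ν * g ν j p := by
    intro j v p
    simp only [L, LinearMap.coe_toContinuousLinearMap', Fintype.linearCombination_apply,
      pEval_sum, pEval_smul, hG]
  refine ⟨fun K => (1 - d / K : ℝ) • ContinuousLinearMap.id ℝ (Nat.Partition d → ℝ) +
    ∑ j ∈ Finset.range d, (risingFact (θ * K) (j + 2))⁻¹ • L j, ?_, ?_⟩
  · intro n b s c σ K o p hσ hb hs hK hp ho v
    have hh := fun ν => h ν n b s c σ K o p hσ hb hs hK hp ho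
    have hInt := fun ν => (hh ν).1.const_mul (v ν)
    simp only [pEval, Finset.sum_mul]
    simp only [mul_assoc] at hInt ⊢
    refine ⟨integrable_finsetSum _ fun ν _ => hInt ν, ?_⟩
    rw [integral_finsetSum _ fun ν _ => hInt ν]
    simp_rw [integral_const_mul]
    have key : ∀ w : Nat.Partition d → ℝ, ∑ ν, w ν * powProd ν.parts p = pEval w p := fun w => rfl
    rw [key]
    simp only [_root_.add_apply, _root_.smul_apply,
      _root_.sum_apply, ContinuousLinearMap.id_apply, pEval_add, pEval_smul, pEval_sum,
      hL]
    rw [← key]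
    simp only [Finset.mul_sum]
    rw [Finset.sum_comm, ← Finset.sum_add_distrib, Finset.mul_sum]
    refine Finset.sum_congr rfl fun ν _ => ?_
    rw [(hh ν).2, ν.parts_sum, mul_left_comm, mul_add, Finset.mul_sum]
    congr 2
    · ring
    · exact Finset.sum_congr rfl fun j _ => by ring
  · refine ⟨(∑ j ∈ Finset.range d, ‖L j‖) / θ ^ 2, fun K hK => ?_⟩
    rw [add_sub_cancel_left, div_div, ← mul_pow, Finset.sum_div]
    refine norm_sum_le_of_le _ fun j _ => ?_
    have hz : 0 < θ * K := mul_pos hθ hK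
    rw [norm_smul, norm_inv, Real.norm_of_nonneg (risingFact_pos hz _).le, inv_mul_eq_div]
    gcongr
    exact sq_le_risingFact hz j

lemma exists_tendsto_of_summable_diff {E : Type*} [NormedAddCommGroup E] [CompleteSpace E]
    {y : ℕ → E} {a : ℕ → ℝ} (ha : Summable a) (ha0 : ∀ n, 0 ≤ a n)
    (h : ∀ n, ‖y (n + 1) - y n‖ ≤ a n * ‖y n‖) : ∃ z, Tendsto y atTop (𝓝 z) := by
  have hb : ∀ n, ‖y n‖ ≤ ‖y 0‖ * Real.exp (∑ k ∈ Finset.range n, a k) := by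
    intro n
    induction n with
    | zero => simp
    | succ n ih =>
      rw [Finset.sum_range_succ, Real.exp_add, ← mul_assoc]
      have h1 : ‖y (n + 1)‖ ≤ ‖y n‖ * (1 + a n) := by
        have := norm_le_norm_add_norm_sub' (y (n + 1)) (y n)
        linarith [h n]
      refine h1.trans ?_
      gcongr
      · linarith [ha0 n]
      · linarith [Real.add_one_le_exp (a n)]
  have hb' : ∀ n, ‖y n‖ ≤ ‖y 0‖ * Real.exp (∑' k, a k) := fun n => (hb n).trans (by
    gcongr
    exact ha.sum_le_tsum _ fun k _ => ha0 k)
  apply cauchySeq_tendsto_of_complete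
  refine cauchySeq_of_summable_dist (Summable.of_nonneg_of_le (fun _ => dist_nonneg) (fun n => ?_)
    (ha.mul_right (‖y 0‖ * Real.exp (∑' k, a k))))
  rw [dist_comm, dist_eq_norm]
  exact (h n).trans (mul_le_mul_of_nonneg_left (hb' n) (ha0 n))

lemma abs_one_sub_pow_sub_le (d : ℕ) {x : ℝ} (h0 : 0 ≤ x) (h1 : x ≤ 1) :
    |(1 - x) ^ d - (1 - d * x)| ≤ d ^ 2 * x ^ 2 := by
  induction d with
  | zero => simp
  | succ d ih =>
    have e : (1 - x) ^ (d + 1) - (1 - (d + 1 : ℕ) * x) =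
        (1 - x) * ((1 - x) ^ d - (1 - d * x)) + d * x ^ 2 := by
      push_cast
      ring
    rw [e]
    have hd : (0 : ℝ) ≤ d := Nat.cast_nonneg d
    calc _ ≤ |(1 - x) * ((1 - x) ^ d - (1 - d * x))| + |d * x ^ 2| := abs_add_le _ _
      _ ≤ 1 * (d ^ 2 * x ^ 2) + d * x ^ 2 := by
        rw [abs_mul, abs_of_nonneg (sub_nonneg.mpr h1), abs_of_nonneg (a := d * x ^ 2) (by positivity)]
        gcongr
        linarith
      _ ≤ _ := by
        push_cast
        nlinarith [mul_nonneg hd (sq_nonneg x), sq_nonneg x]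

/-- The coefficient vectors obtained by averaging repeatedly, starting from level `m`. -/
def coeffSeq {d : ℕ} (T : ℝ → (Nat.Partition d → ℝ) →L[ℝ] (Nat.Partition d → ℝ)) (m : ℕ)
    (c : Nat.Partition d → ℝ) : ℕ → Nat.Partition d → ℝ
  | 0 => c
  | n + 1 => T ((m + n + 1 : ℕ) : ℝ) (coeffSeq T m c n)

lemma exists_tendsto_coeffSeq {d : ℕ}
    {T : ℝ → (Nat.Partition d → ℝ) →L[ℝ] (Nat.Partition d → ℝ)} {C : ℝ}
    (hT : ∀ K : ℝ, 0 < K →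
      ‖T K - (1 - d / K : ℝ) • ContinuousLinearMap.id ℝ (Nat.Partition d → ℝ)‖ ≤ C / K ^ 2)
    {m : ℕ} (hm : 1 ≤ m) (c : Nat.Partition d → ℝ) :
    ∃ z, Tendsto (fun n : ℕ => ((m + n : ℕ) : ℝ) ^ d • coeffSeq T m c n) atTop (𝓝 z) := by
  have hC : 0 ≤ C := by simpa using (norm_nonneg _).trans (hT 1 one_pos)
  refine exists_tendsto_of_summable_diff
    (a := fun n => 2 ^ d * (C + d ^ 2) * (1 / ((n + 1 : ℕ) : ℝ) ^ 2)) ?_ (fun n => by positivity)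
    fun n => ?_
  · exact ((summable_nat_add_iff 1).mpr (Real.summable_one_div_nat_pow.mpr one_lt_two)).mul_left _
  set v := coeffSeq T m c n with hv
  have hm' : (1 : ℝ) ≤ m := by exact_mod_cast hm
  have hn : (0 : ℝ) ≤ n := Nat.cast_nonneg n
  set K : ℝ := ((m + n + 1 : ℕ) : ℝ) with hK
  have hKe : ((m + n : ℕ) : ℝ) = K - 1 := by rw [hK]; push_cast; ring
  have hK2 : 2 ≤ K := by rw [hK]; push_cast; linarith
  have hK0 : 0 < K := by linarith
  have e1 : coeffSeq T m c (n + 1) = T K v := rfl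
  have e2 : ((m + (n + 1) : ℕ) : ℝ) = K := by rw [hK]; push_cast; ring
  rw [e1, e2, hKe]
  have hpow : (K - 1) ^ d = K ^ d * (1 - 1 / K) ^ d := by
    rw [← mul_pow]
    congr 1
    field_simp
  have hx := abs_one_sub_pow_sub_le d (x := 1 / K) (by positivity)
    (by rw [div_le_one hK0]; linarith)
  have e3 : K ^ d • T K v - (K - 1) ^ d • v = K ^ d •
      ((T K - (1 - d / K : ℝ) • ContinuousLinearMap.id ℝ (Nat.Partition d → ℝ)) v -
        ((1 - 1 / K) ^ d - (1 - d * (1 / K))) • v) := by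
    rw [hpow]
    simp only [_root_.sub_apply, _root_.smul_apply,
      ContinuousLinearMap.id_apply]
    rw [mul_one_div]
    module
  rw [e3, norm_smul, norm_smul, Real.norm_of_nonneg (by positivity),
    Real.norm_of_nonneg (pow_nonneg (by linarith) d)]
  have h1 : ‖(T K - (1 - d / K : ℝ) • ContinuousLinearMap.id ℝ (Nat.Partition d → ℝ)) v -
        ((1 - 1 / K) ^ d - (1 - d * (1 / K))) • v‖ ≤ (C + d ^ 2) * (1 / K ^ 2) * ‖v‖ := by
    refine (norm_sub_le _ _).trans ?_
    have h2 := ContinuousLinearMap.le_of_opNorm_le _ (hT K hK0) v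
    rw [norm_smul, Real.norm_eq_abs]
    have h3 := mul_le_mul_of_nonneg_right hx (norm_nonneg v)
    calc _ ≤ C / K ^ 2 * ‖v‖ + d ^ 2 * (1 / K) ^ 2 * ‖v‖ := add_le_add h2 h3
      _ = _ := by field_simp
  have h2 : K ^ d ≤ 2 ^ d * (K - 1) ^ d := by
    rw [← mul_pow]
    gcongr
    linarith
  have h3 : 1 / K ^ 2 ≤ 1 / ((n + 1 : ℕ) : ℝ) ^ 2 := by
    gcongr
    rw [hK]
    push_cast
    linarith
  calc K ^ d * _ ≤ (2 ^ d * (K - 1) ^ d) *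
        ((C + d ^ 2) * (1 / ((n + 1 : ℕ) : ℝ) ^ 2) * ‖v‖) := by
        refine mul_le_mul h2 (h1.trans (by gcongr)) (norm_nonneg _)
          (mul_nonneg (by positivity) (pow_nonneg (by linarith) d))
    _ = _ := by ring

lemma tendsto_powProd_div {ν : Multiset ℕ} (hν : ∀ i ∈ ν, 0 < i) {ι : Type*} {F : Filter ι}
    {p : ι → ℕ → ℝ} {N : ι → ℝ} {q : ℕ → ℝ}
    (h : ∀ l, 0 < l → Tendsto (fun i => p i l / N i ^ l) F (𝓝 (q l))) :
    Tendsto (fun i => powProd ν (p i) / N i ^ ν.sum) F (𝓝 (powProd ν q)) := by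
  induction ν using Multiset.induction with
  | empty => simpa [powProd] using tendsto_const_nhds
  | cons l ν ih =>
    have h1 := (h l (hν l (Multiset.mem_cons_self l ν))).mul
      (ih fun i hi => hν i (Multiset.mem_cons_of_mem hi))
    rw [powProd_cons]
    refine h1.congr fun i => ?_
    rw [powProd_cons, Multiset.sum_cons, pow_add, div_mul_div_comm]

lemma tendsto_pEval {d : ℕ} {ι : Type*} {F : Filter ι} {c : ι → Nat.Partition d → ℝ}
    {p : ι → ℕ → ℝ} {N : ι → ℝ} {q : ℕ → ℝ} {z : Nat.Partition d → ℝ} (hN : ∀ i, N i ≠ 0)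
    (hc : Tendsto (fun i => N i ^ d • c i) F (𝓝 z))
    (h : ∀ l, 0 < l → Tendsto (fun i => p i l / N i ^ l) F (𝓝 (q l))) :
    Tendsto (fun i => pEval (c i) (p i)) F (𝓝 (pEval z q)) := by
  refine tendsto_finsetSum _ fun ν _ => ?_
  have h1 := (tendsto_pi_nhds.mp hc ν).mul
    (tendsto_powProd_div (ν := ν.parts) (fun i hi => ν.parts_pos hi) h)
  refine h1.congr fun i => ?_
  have := hN i
  rw [ν.parts_sum, Pi.smul_apply, smul_eq_mul]
  field_simp

/-! ### Densities of interlacing levels -/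

/-- The product of `|v s - u r| ^ (θ - 1)` over all pairs of entries of two levels. -/
def crossWt (θ : ℝ) {n k : ℕ} (u : Fin n → ℝ) (v : Fin k → ℝ) : ℝ :=
  ∏ s, ∏ r, |v s - u r| ^ (θ - 1)

lemma crossWt_eq (θ : ℝ) {n k : ℕ} (u : Fin n → ℝ) (v : Fin k → ℝ) :
    crossWt θ u v = (∏ s, ∏ r, |v s - u r|) ^ (θ - 1) := by
  rw [crossWt, ← Real.finsetProd_rpow _ _ fun s _ => Finset.prod_nonneg fun r _ => abs_nonneg _]
  exact Finset.prod_congr rfl fun s _ => Real.finsetProd_rpow _ _ (fun r _ => abs_nonneg _) _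

lemma crossWt_comm (θ : ℝ) {n k : ℕ} (u : Fin n → ℝ) (v : Fin k → ℝ) :
    crossWt θ u v = crossWt θ v u := by
  rw [crossWt, crossWt, Finset.prod_comm]
  simp only [abs_sub_comm]

lemma crossWt_nonneg (θ : ℝ) {n k : ℕ} (u : Fin n → ℝ) (v : Fin k → ℝ) : 0 ≤ crossWt θ u v :=
  Finset.prod_nonneg fun _ _ => Finset.prod_nonneg fun _ _ => Real.rpow_nonneg (abs_nonneg _) _

lemma prod_rpow_eq_vdm {n : ℕ} (x : Fin n → ℝ) (e : ℝ) :
    (∏ i : Fin n, ∏ j : Fin n, if i < j then |x i - x j| ^ e else 1) = vdm x ^ e := by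
  have h : ∀ i j : Fin n, 0 ≤ if i < j then |x i - x j| else 1 := fun i j => by
    split_ifs <;> positivity
  rw [vdm, ← Real.finsetProd_rpow _ _ fun i _ => Finset.prod_nonneg fun j _ => h i j]
  refine Finset.prod_congr rfl fun i _ => ?_
  rw [← Real.finsetProd_rpow _ _ fun j _ => h i j]
  exact Finset.prod_congr rfl fun j _ => by split_ifs <;> simp

lemma Interlaces.ne {n : ℕ} {a : Fin n → ℝ} {b : Fin (n + 1) → ℝ} (h : Interlaces a b)
    (i : Fin (n + 1)) (r : Fin n) : b i ≠ a r := by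
  intro e
  have := h.ratio_pos i r
  rw [e, sub_self, zero_div] at this
  exact this.false

lemma prod_abs_pos {n : ℕ} {a : Fin n → ℝ} {b : Fin (n + 1) → ℝ} (h : Interlaces a b) :
    0 < ∏ i, ∏ r, |b i - a r| :=
  Finset.prod_pos fun i _ => Finset.prod_pos fun r _ => abs_pos.mpr (sub_ne_zero.mpr (h.ne i r))

lemma lagW_eq_abs {n : ℕ} {a : Fin n → ℝ} {b : Fin (n + 1) → ℝ} (h : Interlaces a b)
    (i : Fin (n + 1)) :
    lagW b a i = (∏ r, |b i - a r|) / ∏ r, |b i - b (i.succAbove r)| := by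
  rw [← abs_of_pos (lagW_pos h i), lagW, Finset.abs_prod, ← Finset.prod_div_distrib]
  simp only [abs_div]

lemma daWt_const {n : ℕ} {a : Fin n → ℝ} {b : Fin (n + 1) → ℝ} (h : Interlaces a b) (θ : ℝ) :
    daWt b (fun _ => θ) a = vdm a * crossWt θ a b * vdm b ^ (2 - 2 * θ) := by
  have hv := vdm_pos h.strictAnti_right.injective
  rw [daWt, mul_assoc, Real.finsetProd_rpow _ _ fun i _ => (lagW_pos h i).le]
  simp only [lagW_eq_abs h]
  rw [Finset.prod_div_distrib, prod_succAbove_abs, crossWt_eq,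
    Real.div_rpow (prod_abs_pos h).le (by positivity), div_eq_mul_inv, ← Real.rpow_neg (by positivity),
    ← Real.rpow_natCast (vdm b) 2, ← Real.rpow_mul hv.le]
  congr 3
  push_cast
  ring

/-- The sequence `u` with the end points `L` and `-L` added. -/
def ends {n : ℕ} (L : ℝ) (u : Fin n → ℝ) : Fin (n + 2) → ℝ :=
  Fin.cons L (Fin.snoc u (-L) : Fin (n + 1) → ℝ)

lemma ends_eq_snoc {n : ℕ} (L : ℝ) (u : Fin n → ℝ) :
    ends L u = (Fin.snoc (Fin.cons L u : Fin (n + 1) → ℝ) (-L) : Fin (n + 2) → ℝ) :=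
  Fin.cons_snoc_eq_snoc_cons L u (-L)

lemma ends_zero {n : ℕ} (L : ℝ) (u : Fin n → ℝ) : ends L u 0 = L := rfl

lemma ends_succ {n : ℕ} (L : ℝ) (u : Fin n → ℝ) (i : Fin (n + 1)) :
    ends L u i.succ = (Fin.snoc u (-L) : Fin (n + 1) → ℝ) i := rfl

lemma ends_castSucc {n : ℕ} (L : ℝ) (u : Fin n → ℝ) (i : Fin (n + 1)) :
    ends L u i.castSucc = (Fin.cons L u : Fin (n + 1) → ℝ) i := by
  rw [ends_eq_snoc, Fin.snoc_castSucc]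

lemma ends_last {n : ℕ} (L : ℝ) (u : Fin n → ℝ) : ends L u (Fin.last _) = -L := by
  rw [ends_eq_snoc, Fin.snoc_last]

lemma prod_ends {n : ℕ} (L : ℝ) (u : Fin n → ℝ) (f : ℝ → ℝ) :
    ∏ i, f (ends L u i) = f L * (∏ j, f (u j)) * f (-L) := by
  rw [Fin.prod_univ_succ, ends_zero]
  simp only [ends_succ]
  rw [Fin.prod_univ_castSucc]
  simp [mul_assoc]

lemma sum_ends {n : ℕ} (L : ℝ) (u : Fin n → ℝ) (f : ℝ → ℝ) :
    ∑ i, f (ends L u i) = f L + (∑ j, f (u j)) + f (-L) := by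
  rw [Fin.sum_univ_succ, ends_zero]
  simp only [ends_succ]
  rw [Fin.sum_univ_castSucc]
  simp [add_assoc]

/-- The open chamber of strictly decreasing sequences in `(-L, L)`. -/
def boxChamber (n : ℕ) (L : ℝ) : Set (Fin n → ℝ) := {x | StrictAnti x ∧ ∀ i, |x i| < L}

lemma interlaces_ends_iff {n : ℕ} {L : ℝ} {u : Fin n → ℝ} {v : Fin (n + 1) → ℝ} :
    Interlaces v (ends L u) ↔ Interlaces u v ∧ ∀ i, |v i| < L := by
  constructor
  · intro h
    have h1 : Interlaces u v := fun i => by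
      have h1 := (h i.castSucc).2
      have h2 := (h i.succ).1
      rw [ends_succ, Fin.snoc_castSucc] at h1
      rw [ends_castSucc, Fin.cons_succ] at h2
      exact ⟨h1, h2⟩
    refine ⟨h1, fun i => abs_lt.mpr ⟨?_, ?_⟩⟩
    · have h2 := (h (Fin.last n)).2
      rw [ends_succ, Fin.snoc_last] at h2
      exact h2.trans_le (h1.strictAnti_right.antitone (Fin.le_last i))
    · have h2 := (h 0).1
      rw [ends_castSucc, Fin.cons_zero] at h2
      exact (h1.strictAnti_right.antitone (Fin.zero_le i)).trans_lt h2
  · rintro ⟨h1, h2⟩ i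
    constructor
    · rw [ends_castSucc]
      refine Fin.cases ?_ (fun j => ?_) i
      · exact (abs_lt.mp (h2 0)).2
      · exact (h1 j).2
    · rw [ends_succ]
      refine Fin.lastCases ?_ (fun j => ?_) i
      · simpa using (abs_lt.mp (h2 (Fin.last n))).1
      · simpa using (h1 j).1

lemma strictAnti_ends_iff {n : ℕ} {L : ℝ} (hL : 0 < L) {u : Fin n → ℝ} :
    StrictAnti (ends L u) ↔ u ∈ boxChamber n L := by
  constructor
  · intro h
    refine ⟨fun i j hij => ?_, fun i => abs_lt.mpr ⟨?_, ?_⟩⟩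
    · have := h (Fin.succ_lt_succ_iff.mpr (Fin.castSucc_lt_castSucc_iff.mpr hij))
      simpa [ends_succ] using this
    · have := h (Fin.succ_lt_succ_iff.mpr (Fin.castSucc_lt_last i))
      rwa [ends_succ, ends_succ, Fin.snoc_last, Fin.snoc_castSucc] at this
    · have := h (Fin.succ_pos i.castSucc)
      simpa [ends_succ, ends_zero] using this
  · rintro ⟨h1, h2⟩
    rw [Fin.strictAnti_iff_succ_lt]
    intro i
    rw [ends_succ, ends_castSucc]
    rcases Nat.eq_zero_or_pos n with rfl | hn
    · obtain rfl : i = Fin.last 0 := Fin.eq_zero i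
      rw [Fin.snoc_last]
      simpa using hL
    · induction i using Fin.cases with
      | zero =>
        obtain ⟨n, rfl⟩ : ∃ k, n = k + 1 := ⟨n - 1, by omega⟩
        rw [← Fin.castSucc_zero, Fin.snoc_castSucc, Fin.castSucc_zero, Fin.cons_zero]
        exact (abs_lt.mp (h2 0)).2
      | succ i =>
        rw [Fin.cons_succ]
        rcases Fin.eq_castSucc_or_eq_last i.succ with ⟨j, hj⟩ | hj
        · rw [hj, Fin.snoc_castSucc]
          refine h1 ?_
          have := congrArg Fin.val hj
          simp at this
          exact Fin.lt_def.mpr (by omega)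
        · rw [hj, Fin.snoc_last]
          exact (abs_lt.mp (h2 i)).1

lemma vdm_ends {n : ℕ} {L : ℝ} (hL : 0 < L) (u : Fin n → ℝ) :
    vdm (ends L u) = 2 * L * (∏ j, |L - u j| * |L + u j|) * vdm u := by
  have h : vdm (Fin.snoc u (-L) : Fin (n + 1) → ℝ) = (∏ j, |L + u j|) * vdm u := by
    rw [vdm, Fin.prod_univ_castSucc]
    simp only [Fin.prod_univ_castSucc, Fin.snoc_castSucc, Fin.snoc_last, Fin.castSucc_lt_last,
      Fin.castSucc_lt_castSucc_iff, if_true, if_false, not_lt_of_ge (Fin.le_last _)]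
    rw [Finset.prod_mul_distrib, mul_comm (∏ x, ∏ y, _)]
    simp [vdm, add_comm]
  rw [ends, vdm_cons, h, Fin.prod_univ_castSucc, Finset.prod_mul_distrib]
  simp only [Fin.snoc_castSucc, Fin.snoc_last, sub_neg_eq_add]
  rw [abs_of_pos (by linarith : 0 < L + L)]
  ring

/-- The parameters of the Dixon–Anderson density for a sequence with added end points. -/
def endsPar (n : ℕ) (β θ : ℝ) : Fin (n + 2) → ℝ :=
  Fin.cons β (Fin.snoc (fun _ => θ) β : Fin (n + 1) → ℝ)

lemma prod_endsPar {n : ℕ} (β θ : ℝ) (f : Fin (n + 2) → ℝ → ℝ) :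
    ∏ i, f i (endsPar n β θ i) =
      f 0 β * (∏ j : Fin n, f j.castSucc.succ θ) * f (Fin.last _) β := by
  rw [Fin.prod_univ_succ, Fin.prod_univ_castSucc, ← mul_assoc]
  simp [endsPar, Fin.snoc_castSucc, Fin.snoc_last]

lemma sum_endsPar {n : ℕ} (β θ : ℝ) (f : Fin (n + 2) → ℝ → ℝ) :
    ∑ i, f i (endsPar n β θ i) =
      f 0 β + (∑ j : Fin n, f j.castSucc.succ θ) + f (Fin.last _) β := by
  rw [Fin.sum_univ_succ, Fin.sum_univ_castSucc, ← add_assoc]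
  simp [endsPar, Fin.snoc_castSucc, Fin.snoc_last]

lemma endsPar_pos {n : ℕ} {β θ : ℝ} (hβ : 0 < β) (hθ : 0 < θ) (i : Fin (n + 2)) :
    0 < endsPar n β θ i := by
  refine Fin.cases hβ (fun i => ?_) i
  refine Fin.lastCases ?_ (fun j => ?_) i <;> simpa [endsPar]

/-- The product of `L ^ 2 - x j ^ 2`. -/
def edgeProd {n : ℕ} (L : ℝ) (x : Fin n → ℝ) : ℝ := ∏ j, (L ^ 2 - x j ^ 2)

lemma edgeProd_pos {n : ℕ} {L : ℝ} {x : Fin n → ℝ} (hx : ∀ i, |x i| < L) : 0 < edgeProd L x :=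
  Finset.prod_pos fun i _ => by
    have := abs_lt.mp (hx i)
    nlinarith

lemma prod_abs_eq_edgeProd {n : ℕ} {L : ℝ} {x : Fin n → ℝ} (hx : ∀ i, |x i| < L) :
    (∏ j, |L - x j|) * ∏ j, |L + x j| = edgeProd L x := by
  rw [← Finset.prod_mul_distrib]
  refine Finset.prod_congr rfl fun j _ => ?_
  have := abs_lt.mp (hx j)
  rw [abs_of_pos (by linarith), abs_of_pos (by linarith)]
  ring

/-- The Jacobi-type weight on `boxChamber n L`. -/
def boxWt (θ β L : ℝ) {n : ℕ} (x : Fin n → ℝ) : ℝ :=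
  vdm x ^ (2 * θ) * edgeProd L x ^ (β - 1)

/-- The joint weight of two interlacing levels. -/
def jointWt (θ β L : ℝ) {n : ℕ} (u : Fin n → ℝ) (v : Fin (n + 1) → ℝ) : ℝ :=
  vdm u * vdm v * crossWt θ u v * edgeProd L v ^ (β - 1)

lemma jointWt_eq_top {n : ℕ} {u : Fin n → ℝ} {v : Fin (n + 1) → ℝ} (h : Interlaces u v)
    (θ β L : ℝ) :
    jointWt θ β L u v =
      (vdm v ^ (2 * θ - 1) * edgeProd L v ^ (β - 1)) * daWt v (fun _ => θ) u := by
  have hv := vdm_pos h.strictAnti_right.injective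
  have e : vdm v ^ (2 - 2 * θ) * vdm v ^ (2 * θ - 1) = vdm v := by
    rw [← Real.rpow_add hv]
    ring_nf
    exact Real.rpow_one _
  rw [jointWt, daWt_const h]
  linear_combination -(vdm u * crossWt θ u v * edgeProd L v ^ (β - 1)) * e

lemma daZ_const {n : ℕ} {v : Fin (n + 1) → ℝ} (hv : StrictAnti v) (θ : ℝ) :
    vdm v ^ (2 * θ - 1) * daZ v (fun _ => θ) =
      Real.Gamma θ ^ (n + 1) / Real.Gamma ((n + 1) * θ) * vdm v ^ (2 * θ) := by
  have hv := vdm_pos hv.injective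
  have e : vdm v ^ (2 * θ - 1) * vdm v = vdm v ^ (2 * θ) := by
    rw [← Real.rpow_add_one hv.ne']
    ring_nf
  rw [daZ, ← e]
  simp
  ring

lemma daWt_endsPar {n : ℕ} {L : ℝ} (hL : 0 < L) {u : Fin n → ℝ} {v : Fin (n + 1) → ℝ}
    (h : Interlaces v (ends L u)) (θ β : ℝ) :
    daWt (ends L u) (endsPar n β θ) v =
      vdm v * crossWt θ u v * edgeProd L v ^ (β - 1) * ((2 * L) ^ (2 - 2 * β) *
        edgeProd L u ^ (2 - θ - β) * vdm u ^ (2 - 2 * θ)) := by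
  obtain ⟨huv, hvL⟩ := interlaces_ends_iff.mp h
  obtain ⟨hu, huL⟩ := (strictAnti_ends_iff hL).mp h.strictAnti_right
  have hP := edgeProd_pos hvL
  have hQ := edgeProd_pos huL
  have hD := vdm_pos hu.injective
  have h2L : 0 < 2 * L := by positivity
  have hvdm : vdm (ends L u) = 2 * L * edgeProd L u * vdm u := by
    rw [vdm_ends hL, Finset.prod_mul_distrib, prod_abs_eq_edgeProd huL]
  have hcross : crossWt θ v (ends L u) = edgeProd L v ^ (θ - 1) * crossWt θ u v := by
    have e : ∀ r, |-L - v r| = |L + v r| := fun r => by rw [← abs_neg]; ring_nf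
    have eL : ∏ r, |L - v r| ^ (θ - 1) = (∏ r, |L - v r|) ^ (θ - 1) :=
      Real.finsetProd_rpow _ _ (fun r _ => abs_nonneg _) _
    have eR : ∏ r, |-L - v r| ^ (θ - 1) = (∏ r, |L + v r|) ^ (θ - 1) := by
      simp only [e]
      exact Real.finsetProd_rpow _ _ (fun r _ => abs_nonneg _) _
    rw [crossWt, prod_ends L u (fun x => ∏ r, |x - v r| ^ (θ - 1)), eL, eR,
      ← prod_abs_eq_edgeProd hvL, Real.mul_rpow (Finset.prod_nonneg fun r _ => abs_nonneg _)
        (Finset.prod_nonneg fun r _ => abs_nonneg _), crossWt_comm θ u v, crossWt]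
    ring
  have hlag : lagW (ends L u) v 0 * lagW (ends L u) v (Fin.last _) =
      edgeProd L v / ((2 * L) ^ 2 * edgeProd L u) := by
    rw [lagW_eq_abs h, lagW_eq_abs h, div_mul_div_comm]
    simp only [Fin.succAbove_zero, Fin.succAbove_last, ends_zero, ends_last, ends_succ,
      ends_castSucc]
    have e : ∀ x, |-L - x| = |L + x| := fun x => by rw [← abs_neg]; ring_nf
    have e1 : ∏ r, |L - (Fin.snoc u (-L) : Fin (n + 1) → ℝ) r| =
        (∏ r, |L - u r|) * |L - -L| := by
      rw [Fin.prod_univ_castSucc]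
      simp only [Fin.snoc_castSucc, Fin.snoc_last]
    have e2 : ∏ r, |L + (Fin.cons L u : Fin (n + 1) → ℝ) r| = |L + L| * ∏ r, |L + u r| := by
      rw [Fin.prod_univ_succ]
      simp only [Fin.cons_zero, Fin.cons_succ]
    simp only [e]
    rw [e1, e2]
    rw [prod_abs_eq_edgeProd hvL, ← prod_abs_eq_edgeProd huL, sub_neg_eq_add,
      abs_of_pos (by linarith : 0 < L + L)]
    ring
  have hsplit : daWt (ends L u) (endsPar n β θ) v = daWt (ends L u) (fun _ => θ) v *
      (lagW (ends L u) v 0 * lagW (ends L u) v (Fin.last _)) ^ (β - θ) := by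
    have h0 := lagW_pos h 0
    have h1 := lagW_pos h (Fin.last _)
    rw [daWt, daWt, prod_endsPar β θ (fun i t => lagW (ends L u) v i ^ (t - 1)),
      Fin.prod_univ_succ, Fin.prod_univ_castSucc, Real.mul_rpow h0.le h1.le]
    have e : ∀ x : ℝ, 0 < x → x ^ (β - 1) = x ^ (θ - 1) * x ^ (β - θ) := fun x hx => by
      rw [← Real.rpow_add hx]
      ring_nf
    rw [e _ h0, e _ h1, Fin.succ_last]
    ring
  have eP : edgeProd L v ^ (β - 1) = edgeProd L v ^ (θ - 1) * edgeProd L v ^ (β - θ) := by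
    rw [← Real.rpow_add hP]
    ring_nf
  have eQ : edgeProd L u ^ (2 - θ - β) =
      edgeProd L u ^ (2 - 2 * θ) * (edgeProd L u ^ (β - θ))⁻¹ := by
    rw [← Real.rpow_neg hQ.le, ← Real.rpow_add hQ]
    ring_nf
  have eL : (2 * L) ^ (2 - 2 * β) = (2 * L) ^ (2 - 2 * θ) * (((2 * L) ^ 2) ^ (β - θ))⁻¹ := by
    rw [← Real.rpow_natCast (2 * L) 2, ← Real.rpow_mul h2L.le, ← Real.rpow_neg h2L.le,
      ← Real.rpow_add h2L]
    push_cast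
    ring_nf
  rw [hsplit, daWt_const h, hlag, hcross, hvdm, Real.div_rpow hP.le (by positivity),
    Real.mul_rpow (by positivity) hQ.le, Real.mul_rpow (by positivity) hD.le,
    Real.mul_rpow h2L.le hQ.le, eP, eQ, eL]
  field_simp

lemma jointWt_eq_ends {n : ℕ} {L : ℝ} (hL : 0 < L) {u : Fin n → ℝ} {v : Fin (n + 1) → ℝ}
    (h : Interlaces v (ends L u)) (θ β : ℝ) :
    jointWt θ β L u v =
      ((2 * L) ^ (2 * β - 2) * edgeProd L u ^ (θ + β - 2) * vdm u ^ (2 * θ - 1)) *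
        daWt (ends L u) (endsPar n β θ) v := by
  obtain ⟨hu, huL⟩ := (strictAnti_ends_iff hL).mp h.strictAnti_right
  have hQ := edgeProd_pos huL
  have hD := vdm_pos hu.injective
  have h2L : 0 < 2 * L := by positivity
  have e1 : (2 * L) ^ (2 * β - 2) * (2 * L) ^ (2 - 2 * β) = 1 := by
    rw [← Real.rpow_add h2L]; ring_nf; exact Real.rpow_zero _
  have e2 : edgeProd L u ^ (θ + β - 2) * edgeProd L u ^ (2 - θ - β) = 1 := by
    rw [← Real.rpow_add hQ]; ring_nf; exact Real.rpow_zero _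
  have e3 : vdm u ^ (2 * θ - 1) * vdm u ^ (2 - 2 * θ) = vdm u := by
    rw [← Real.rpow_add hD]; ring_nf; exact Real.rpow_one _
  rw [daWt_endsPar hL h, jointWt]
  calc _ = vdm v * crossWt θ u v * edgeProd L v ^ (β - 1) *
        (((2 * L) ^ (2 * β - 2) * (2 * L) ^ (2 - 2 * β)) *
          (edgeProd L u ^ (θ + β - 2) * edgeProd L u ^ (2 - θ - β)) *
          (vdm u ^ (2 * θ - 1) * vdm u ^ (2 - 2 * θ))) := by rw [e1, e2, e3]; ring
    _ = _ := by ring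

/-- The normalizing constant for integrating out the larger level. -/
def endsConst (n : ℕ) (θ β L : ℝ) : ℝ :=
  (2 * L) ^ (2 * β - 1) * (Real.Gamma β ^ 2 * Real.Gamma θ ^ n / Real.Gamma (2 * β + n * θ))

lemma daZ_endsPar {n : ℕ} {L : ℝ} (hL : 0 < L) {u : Fin n → ℝ} (hu : u ∈ boxChamber n L)
    (θ β : ℝ) :
    ((2 * L) ^ (2 * β - 2) * edgeProd L u ^ (θ + β - 2) * vdm u ^ (2 * θ - 1)) *
        daZ (ends L u) (endsPar n β θ) = endsConst n θ β L * boxWt θ (β + θ) L u := by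
  have hQ := edgeProd_pos hu.2
  have hD := vdm_pos hu.1.injective
  have h2L : 0 < 2 * L := by positivity
  have e1 : (2 * L) ^ (2 * β - 1) = (2 * L) ^ (2 * β - 2) * (2 * L) := by
    rw [← Real.rpow_add_one h2L.ne']; ring_nf
  have e2 : edgeProd L u ^ (β + θ - 1) = edgeProd L u ^ (θ + β - 2) * edgeProd L u := by
    rw [← Real.rpow_add_one hQ.ne']; ring_nf
  have e3 : vdm u ^ (2 * θ) = vdm u ^ (2 * θ - 1) * vdm u := by
    rw [← Real.rpow_add_one hD.ne']; ring_nf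
  have hvdm : vdm (ends L u) = 2 * L * edgeProd L u * vdm u := by
    rw [vdm_ends hL, Finset.prod_mul_distrib, prod_abs_eq_edgeProd hu.2]
  have hs : ∑ i, endsPar n β θ i = 2 * β + n * θ := by
    rw [sum_endsPar β θ fun _ t => t]
    simp
    ring
  rw [daZ, hs, hvdm, prod_endsPar β θ (fun _ t => Real.Gamma t), endsConst, boxWt, e1, e2, e3]
  simp
  ring

section Sections

variable {α β : Type*} [MeasurableSpace α] [MeasurableSpace β] {μ : Measure α} {ν : Measure β}
  [SFinite ν]

lemma lintegral_sections {D : Set (α × β)} {E : Set α} (hD : MeasurableSet D)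
    (hE : MeasurableSet E) (hDE : ∀ p ∈ D, p.1 ∈ E) {f : α × β → ℝ≥0∞} (hf : Measurable f) :
    ∫⁻ p in D, f p ∂(μ.prod ν) = ∫⁻ u in E, ∫⁻ v in {v | (u, v) ∈ D}, f (u, v) ∂ν ∂μ := by
  rw [← lintegral_indicator hD, lintegral_prod _ (hf.indicator hD).aemeasurable,
    ← lintegral_indicator hE]
  refine lintegral_congr fun u => ?_
  by_cases hu : u ∈ E
  · rw [Set.indicator_of_mem hu, ← lintegral_indicator
      (show MeasurableSet {v | (u, v) ∈ D} from measurable_prodMk_left hD)]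
    rfl
  · rw [Set.indicator_of_notMem hu]
    have : ∀ v, D.indicator f (u, v) = 0 :=
      fun v => Set.indicator_of_notMem (fun h => hu (hDE _ h)) _
    simp [this]

variable [SFinite μ]

lemma integral_sections {D : Set (α × β)} {E : Set α} (hD : MeasurableSet D)
    (hE : MeasurableSet E) (hDE : ∀ p ∈ D, p.1 ∈ E) {f : α × β → ℝ}
    (hf : IntegrableOn f D (μ.prod ν)) :
    ∫ p in D, f p ∂(μ.prod ν) = ∫ u in E, ∫ v in {v | (u, v) ∈ D}, f (u, v) ∂ν ∂μ := by
  rw [← integral_indicator hD, integral_prod _ (hf.integrable_indicator hD),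
    ← integral_indicator hE]
  refine integral_congr_ae (.of_forall fun u => ?_)
  by_cases hu : u ∈ E
  · dsimp only
    rw [Set.indicator_of_mem hu, ← integral_indicator
      (show MeasurableSet {v | (u, v) ∈ D} from measurable_prodMk_left hD)]
    rfl
  · dsimp only
    rw [Set.indicator_of_notMem hu]
    have : ∀ v, D.indicator f (u, v) = 0 :=
      fun v => Set.indicator_of_notMem (fun h => hu (hDE _ h)) _
    simp [this]

lemma lintegral_sections_swap {D : Set (α × β)} {E : Set β} (hD : MeasurableSet D)
    (hE : MeasurableSet E) (hDE : ∀ p ∈ D, p.2 ∈ E) {f : α × β → ℝ≥0∞} (hf : Measurable f) :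
    ∫⁻ p in D, f p ∂(μ.prod ν) = ∫⁻ v in E, ∫⁻ u in {u | (u, v) ∈ D}, f (u, v) ∂μ ∂ν := by
  rw [← lintegral_indicator hD, ← lintegral_prod_swap]
  have := lintegral_sections (μ := ν) (ν := μ) (measurable_swap hD) hE
    (fun p hp => hDE _ hp) (hf.comp measurable_swap)
  rw [← lintegral_indicator (measurable_swap hD)] at this
  exact this

lemma integral_sections_swap {D : Set (α × β)} {E : Set β} (hD : MeasurableSet D)
    (hE : MeasurableSet E) (hDE : ∀ p ∈ D, p.2 ∈ E) {f : α × β → ℝ}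
    (hf : IntegrableOn f D (μ.prod ν)) :
    ∫ p in D, f p ∂(μ.prod ν) = ∫ v in E, ∫ u in {u | (u, v) ∈ D}, f (u, v) ∂μ ∂ν := by
  rw [← integral_indicator hD, ← integral_prod_swap]
  have := integral_sections (μ := ν) (ν := μ) (measurable_swap hD) hE
    (fun p hp => hDE _ hp) (f := f ∘ Prod.swap) (by
      rw [← integrable_indicator_iff (measurable_swap hD)]
      exact (hf.integrable_indicator hD).swap)
  rw [← integral_indicator (measurable_swap hD)] at this
  exact this

end Sections

lemma isOpen_setOf_strictAnti {n : ℕ} : IsOpen {x : Fin n → ℝ | StrictAnti x} := by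
  simp only [StrictAnti, Set.ofPred_forall]
  exact isOpen_iInter_of_finite fun i => isOpen_iInter_of_finite fun j =>
    isOpen_iInter_of_finite fun _ => isOpen_lt (continuous_apply j) (continuous_apply i)

lemma measurableSet_boxChamber (n : ℕ) (L : ℝ) : MeasurableSet (boxChamber n L) := by
  have : boxChamber n L = {x | StrictAnti x} ∩ ⋂ i, {x | |x i| < L} := by
    ext x
    simp [boxChamber]
  rw [this]
  exact isOpen_setOf_strictAnti.measurableSet.inter
    (MeasurableSet.iInter fun i => measurableSet_lt (by fun_prop) (by fun_prop))

lemma measurable_boxWt (θ β L : ℝ) {n : ℕ} : Measurable (boxWt θ β L : (Fin n → ℝ) → ℝ) := by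
  have : Measurable (edgeProd L : (Fin n → ℝ) → ℝ) := by unfold edgeProd; fun_prop
  exact (measurable_vdm.pow_const _).mul (this.pow_const _)

lemma boxWt_pos (θ β : ℝ) {L : ℝ} {n : ℕ} {x : Fin n → ℝ} (hx : x ∈ boxChamber n L) :
    0 < boxWt θ β L x :=
  mul_pos (Real.rpow_pos_of_pos (vdm_pos hx.1.injective) _)
    (Real.rpow_pos_of_pos (edgeProd_pos hx.2) _)

/-- The pairs of interlacing sequences in the box of half-width `L`. -/
def jointDom (n : ℕ) (L : ℝ) : Set ((Fin n → ℝ) × (Fin (n + 1) → ℝ)) :=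
  {p | Interlaces p.2 (ends L p.1)}

lemma continuous_ends {n : ℕ} (L : ℝ) : Continuous (ends L : (Fin n → ℝ) → _) := by
  refine continuous_pi fun i => ?_
  refine Fin.cases ?_ (fun i => ?_) i
  · exact continuous_const
  · simp only [ends_succ]
    refine Fin.lastCases ?_ (fun j => ?_) i
    · simp only [Fin.snoc_last]
      exact continuous_const
    · simp only [Fin.snoc_castSucc]
      exact continuous_apply j

lemma measurableSet_jointDom (n : ℕ) (L : ℝ) : MeasurableSet (jointDom n L) :=
  (isOpen_setOf_interlaces continuous_snd ((continuous_ends L).comp continuous_fst)).measurableSet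

lemma measurable_crossWt (θ : ℝ) {n : ℕ} :
    Measurable fun p : (Fin n → ℝ) × (Fin (n + 1) → ℝ) => crossWt θ p.1 p.2 := by
  unfold crossWt
  fun_prop

lemma measurable_jointWt (θ β L : ℝ) {n : ℕ} :
    Measurable fun p : (Fin n → ℝ) × (Fin (n + 1) → ℝ) => jointWt θ β L p.1 p.2 := by
  have : Measurable (edgeProd L : (Fin (n + 1) → ℝ) → ℝ) := by unfold edgeProd; fun_prop
  exact (((measurable_vdm.comp measurable_fst).mul (measurable_vdm.comp measurable_snd)).mul
    (measurable_crossWt θ)).mul ((this.comp measurable_snd).pow_const _)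

lemma jointDom_fst_mem {n : ℕ} {L : ℝ} (hL : 0 < L) (p : (Fin n → ℝ) × (Fin (n + 1) → ℝ))
    (hp : p ∈ jointDom n L) : p.1 ∈ boxChamber n L :=
  (strictAnti_ends_iff hL).mp (Interlaces.strictAnti_right hp)

lemma jointDom_snd_mem {n : ℕ} {L : ℝ} (p : (Fin n → ℝ) × (Fin (n + 1) → ℝ))
    (hp : p ∈ jointDom n L) : p.2 ∈ boxChamber (n + 1) L :=
  have h := interlaces_ends_iff.mp hp
  ⟨h.1.strictAnti_right, h.2⟩

lemma jointDom_section {n : ℕ} {L : ℝ} {v : Fin (n + 1) → ℝ} (hv : v ∈ boxChamber (n + 1) L) :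
    {u | (u, v) ∈ jointDom n L} = {u | Interlaces u v} := by
  ext u
  exact interlaces_ends_iff.trans (and_iff_left hv.2)

/-- The constant in the one-step Dixon–Anderson integral with all parameters equal. -/
def topConst (n : ℕ) (θ : ℝ) : ℝ := Real.Gamma θ ^ (n + 1) / Real.Gamma ((n + 1) * θ)

lemma topConst_pos (n : ℕ) {θ : ℝ} (hθ : 0 < θ) : 0 < topConst n θ :=
  _root_.div_pos (pow_pos (Real.Gamma_pos_of_pos hθ) _) (Real.Gamma_pos_of_pos (by positivity))

lemma endsConst_pos (n : ℕ) {θ β L : ℝ} (hθ : 0 < θ) (hβ : 0 < β) (hL : 0 < L) :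
    0 < endsConst n θ β L :=
  mul_pos (Real.rpow_pos_of_pos (by positivity) _) (_root_.div_pos
    (mul_pos (pow_pos (Real.Gamma_pos_of_pos hβ) _) (pow_pos (Real.Gamma_pos_of_pos hθ) _))
    (Real.Gamma_pos_of_pos (by positivity)))

lemma lintegral_jointWt_fst {n : ℕ} {θ β L : ℝ} (hθ : 0 < θ) (hβ : 0 < β) (hL : 0 < L) :
    ∫⁻ p in jointDom n L, ENNReal.ofReal (jointWt θ β L p.1 p.2) =
      ENNReal.ofReal (endsConst n θ β L) *
        ∫⁻ u in boxChamber n L, ENNReal.ofReal (boxWt θ (β + θ) L u) := by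
  rw [Measure.volume_eq_prod, lintegral_sections (measurableSet_jointDom n L)
    (measurableSet_boxChamber n L) (jointDom_fst_mem hL)
    (measurable_jointWt θ β L).ennreal_ofReal,
    ← lintegral_const_mul _ (measurable_boxWt _ _ _).ennreal_ofReal]
  refine setLIntegral_congr_fun (measurableSet_boxChamber n L) fun u hu => ?_
  dsimp only
  have hb := (strictAnti_ends_iff hL).mpr hu
  have hs := fun i => endsPar_pos (n := n) hβ hθ i
  have hpre : 0 ≤ (2 * L) ^ (2 * β - 2) * edgeProd L u ^ (θ + β - 2) * vdm u ^ (2 * θ - 1) :=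
    mul_nonneg (mul_nonneg (Real.rpow_nonneg (by positivity) _)
      (Real.rpow_nonneg (edgeProd_pos hu.2).le _)) (Real.rpow_nonneg (vdm_nonneg _) _)
  rw [← ENNReal.ofReal_mul (endsConst_pos n hθ hβ hL).le, ← daZ_endsPar hL hu,
    ENNReal.ofReal_mul hpre, daZ, ← lintegral_daWt hb hs,
    ← lintegral_const_mul _ (measurable_daWt _ _).ennreal_ofReal]
  change ∫⁻ v in {v | Interlaces v (ends L u)}, _ = _
  refine setLIntegral_congr_fun (measurableSet_interlaces _) fun v hv => ?_
  rw [jointWt_eq_ends hL hv, ENNReal.ofReal_mul hpre]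

lemma lintegral_jointWt_snd {n : ℕ} {θ β L : ℝ} (hθ : 0 < θ) :
    ∫⁻ p in jointDom n L, ENNReal.ofReal (jointWt θ β L p.1 p.2) =
      ENNReal.ofReal (topConst n θ) *
        ∫⁻ v in boxChamber (n + 1) L, ENNReal.ofReal (boxWt θ β L v) := by
  rw [Measure.volume_eq_prod, lintegral_sections_swap (measurableSet_jointDom n L)
    (measurableSet_boxChamber (n + 1) L) jointDom_snd_mem
    (measurable_jointWt θ β L).ennreal_ofReal,
    ← lintegral_const_mul _ (measurable_boxWt _ _ _).ennreal_ofReal]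
  refine setLIntegral_congr_fun (measurableSet_boxChamber (n + 1) L) fun v hv => ?_
  dsimp only
  have hpre : 0 ≤ vdm v ^ (2 * θ - 1) * edgeProd L v ^ (β - 1) :=
    mul_nonneg (Real.rpow_nonneg (vdm_nonneg _) _) (Real.rpow_nonneg (edgeProd_pos hv.2).le _)
  have hz : topConst n θ * boxWt θ β L v =
      (vdm v ^ (2 * θ - 1) * edgeProd L v ^ (β - 1)) * daZ v (fun _ => θ) := by
    rw [topConst, boxWt, ← mul_assoc, ← daZ_const hv.1]
    ring
  rw [← ENNReal.ofReal_mul (topConst_pos n hθ).le, hz, jointDom_section hv,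
    ENNReal.ofReal_mul hpre, daZ, ← lintegral_daWt hv.1 fun _ => hθ,
    ← lintegral_const_mul _ (measurable_daWt _ _).ennreal_ofReal]
  refine setLIntegral_congr_fun (measurableSet_interlaces _) fun u hu => ?_
  rw [jointWt_eq_top hu, ENNReal.ofReal_mul hpre]

lemma lintegral_boxWt_ne {θ L : ℝ} (hθ : 0 < θ) (hL : 0 < L) (n : ℕ) : ∀ β : ℝ, 0 < β →
    (∫⁻ x in boxChamber n L, ENNReal.ofReal (boxWt θ β L x)) ≠ 0 ∧
    (∫⁻ x in boxChamber n L, ENNReal.ofReal (boxWt θ β L x)) ≠ ∞ := by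
  induction n with
  | zero =>
    intro β _
    have h : boxChamber 0 L = Set.univ := by
      ext x
      simp [boxChamber, StrictAnti]
    have : ∀ x : Fin 0 → ℝ, boxWt θ β L x = 1 := fun x => by simp [boxWt, vdm, edgeProd]
    simp [h, this, volume_pi]
  | succ n ih =>
    intro β hβ
    obtain ⟨h0, h1⟩ := ih (β + θ) (by positivity)
    have h := (lintegral_jointWt_fst (n := n) hθ hβ hL).symm.trans (lintegral_jointWt_snd hθ)
    have hE := endsConst_pos n hθ hβ hL
    have hT := topConst_pos n hθ
    constructor
    · intro h'
      rw [h', mul_zero] at h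
      exact mul_ne_zero (by simpa using hE) h0 h
    · intro h'
      rw [h', ENNReal.mul_top (by simpa using hT)] at h
      exact ENNReal.mul_ne_top ENNReal.ofReal_ne_top h1 h

lemma integral_boxWt_pos {θ β L : ℝ} (hθ : 0 < θ) (hβ : 0 < β) (hL : 0 < L) (n : ℕ) :
    0 < ∫ x in boxChamber n L, boxWt θ β L x := by
  rw [integral_eq_lintegral_of_nonneg_ae (ae_restrict_of_forall_mem
    (measurableSet_boxChamber n L) fun x hx => (boxWt_pos θ β hx).le)
    (measurable_boxWt θ β L).aestronglyMeasurable]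
  have := lintegral_boxWt_ne hθ hL n β hβ
  exact ENNReal.toReal_pos this.1 this.2

lemma jointWt_nonneg {θ β L : ℝ} {n : ℕ} {p : (Fin n → ℝ) × (Fin (n + 1) → ℝ)}
    (hp : p ∈ jointDom n L) : 0 ≤ jointWt θ β L p.1 p.2 :=
  mul_nonneg (mul_nonneg (mul_nonneg (vdm_nonneg _) (vdm_nonneg _)) (crossWt_nonneg ..))
    (Real.rpow_nonneg (edgeProd_pos (jointDom_snd_mem p hp).2).le _)

lemma integrableOn_jointWt {θ β L : ℝ} (hθ : 0 < θ) (hβ : 0 < β) (hL : 0 < L) (n : ℕ) :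
    IntegrableOn (fun p => jointWt θ β L p.1 p.2) (jointDom n L) := by
  refine ⟨(measurable_jointWt θ β L).aestronglyMeasurable, ?_⟩
  rw [hasFiniteIntegral_iff_ofReal]
  · rw [lintegral_jointWt_snd hθ]
    exact ENNReal.mul_lt_top ENNReal.ofReal_lt_top (lintegral_boxWt_ne hθ hL _ β hβ).2.lt_top
  · exact ae_restrict_of_forall_mem (measurableSet_jointDom n L) fun p hp => jointWt_nonneg hp

lemma continuous_powProd {X : Type*} [TopologicalSpace X] (ν : Multiset ℕ) {p : X → ℕ → ℝ}
    (hp : ∀ l, Continuous fun x => p x l) : Continuous fun x => powProd ν (p x) := by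
  unfold powProd
  exact continuous_multiset_prod _ fun l _ => hp l

lemma continuous_pEval {X : Type*} [TopologicalSpace X] {d : ℕ} (c : Nat.Partition d → ℝ)
    {p : X → ℕ → ℝ} (hp : ∀ l, Continuous fun x => p x l) :
    Continuous fun x => pEval c (p x) := by
  unfold pEval
  exact continuous_finsetSum _ fun ν _ => continuous_const.mul (continuous_powProd _ hp)

lemma continuous_affPS {n : ℕ} (c σ : ℝ) (l : ℕ) :
    Continuous fun u : Fin n → ℝ => affPS c σ u l := by
  unfold affPS
  fun_prop

lemma exists_bound_boxChamber {n : ℕ} (L : ℝ) {F : (Fin n → ℝ) → ℝ} (hF : Continuous F) :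
    ∃ M, ∀ x ∈ boxChamber n L, ‖F x‖ ≤ M := by
  have hK : IsCompact (Set.univ.pi fun _ : Fin n => Set.Icc (-L) L) :=
    isCompact_univ_pi fun _ => isCompact_Icc
  obtain ⟨M, hM⟩ := hK.exists_bound_of_continuousOn hF.continuousOn
  exact ⟨M, fun x hx => hM x fun i _ => abs_le.mp (hx.2 i).le⟩

lemma integrableOn_fst_mul_jointWt {θ β L : ℝ} (hθ : 0 < θ) (hβ : 0 < β) (hL : 0 < L) {n : ℕ}
    {F : (Fin n → ℝ) → ℝ} (hF : Continuous F) :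
    IntegrableOn (fun p => F p.1 * jointWt θ β L p.1 p.2) (jointDom n L) := by
  obtain ⟨M, hM⟩ := exists_bound_boxChamber L hF
  exact (integrableOn_jointWt hθ hβ hL n).bdd_mul
    (hF.comp continuous_fst).aestronglyMeasurable
    (ae_restrict_of_forall_mem (measurableSet_jointDom n L)
      fun p hp => hM _ (jointDom_fst_mem hL p hp))

lemma integrableOn_snd_mul_jointWt {θ β L : ℝ} (hθ : 0 < θ) (hβ : 0 < β) (hL : 0 < L) {n : ℕ}
    {G : (Fin (n + 1) → ℝ) → ℝ} (hG : Continuous G) :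
    IntegrableOn (fun p => G p.2 * jointWt θ β L p.1 p.2) (jointDom n L) := by
  obtain ⟨M, hM⟩ := exists_bound_boxChamber L hG
  exact (integrableOn_jointWt hθ hβ hL n).bdd_mul
    (hG.comp continuous_snd).aestronglyMeasurable
    (ae_restrict_of_forall_mem (measurableSet_jointDom n L)
      fun p hp => hM _ (jointDom_snd_mem p hp))

/-- Integrating a function of the pair against the joint weight, larger level first. -/
lemma integral_jointWt_inner_snd {θ β L : ℝ} (hL : 0 < L) {n : ℕ}
    {H : (Fin n → ℝ) → (Fin (n + 1) → ℝ) → ℝ} {g : (Fin n → ℝ) → ℝ}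
    (hH : IntegrableOn (fun p => H p.1 p.2 * jointWt θ β L p.1 p.2) (jointDom n L))
    (hg : ∀ u ∈ boxChamber n L,
      ∫ v in {v | Interlaces v (ends L u)}, H u v * daWt (ends L u) (endsPar n β θ) v =
        daZ (ends L u) (endsPar n β θ) * g u) :
    ∫ p in jointDom n L, H p.1 p.2 * jointWt θ β L p.1 p.2 =
      endsConst n θ β L * ∫ u in boxChamber n L, g u * boxWt θ (β + θ) L u := by
  rw [Measure.volume_eq_prod] at hH ⊢
  rw [integral_sections (measurableSet_jointDom n L) (measurableSet_boxChamber n L)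
    (jointDom_fst_mem hL) hH, ← integral_const_mul]
  refine setIntegral_congr_fun (measurableSet_boxChamber n L) fun u hu => ?_
  change ∫ v in {v | Interlaces v (ends L u)}, H u v * jointWt θ β L u v =
    endsConst n θ β L * (g u * boxWt θ (β + θ) L u)
  rw [mul_left_comm, ← daZ_endsPar hL hu, mul_left_comm, mul_comm (g u), ← hg u hu,
    ← integral_const_mul]
  refine setIntegral_congr_fun (measurableSet_interlaces _) fun v hv => ?_
  rw [jointWt_eq_ends hL hv]
  ring

/-- Integrating a function of the pair against the joint weight, smaller level first. -/
lemma integral_jointWt_inner_fst {θ β L : ℝ} {n : ℕ}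
    {H : (Fin n → ℝ) → (Fin (n + 1) → ℝ) → ℝ} {g : (Fin (n + 1) → ℝ) → ℝ}
    (hH : IntegrableOn (fun p => H p.1 p.2 * jointWt θ β L p.1 p.2) (jointDom n L))
    (hg : ∀ v, StrictAnti v →
      ∫ u in {u | Interlaces u v}, H u v * daWt v (fun _ => θ) u = daZ v (fun _ => θ) * g v) :
    ∫ p in jointDom n L, H p.1 p.2 * jointWt θ β L p.1 p.2 =
      topConst n θ * ∫ v in boxChamber (n + 1) L, g v * boxWt θ β L v := by
  rw [Measure.volume_eq_prod] at hH ⊢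
  rw [integral_sections_swap (measurableSet_jointDom n L) (measurableSet_boxChamber (n + 1) L)
    jointDom_snd_mem hH, ← integral_const_mul]
  refine setIntegral_congr_fun (measurableSet_boxChamber (n + 1) L) fun v hv => ?_
  dsimp only
  rw [jointDom_section hv]
  have hz : topConst n θ * (g v * boxWt θ β L v) =
      (vdm v ^ (2 * θ - 1) * edgeProd L v ^ (β - 1)) * (daZ v (fun _ => θ) * g v) := by
    have := daZ_const hv.1 θ
    rw [topConst, boxWt]
    linear_combination (-(g v) * edgeProd L v ^ (β - 1)) * this
  rw [hz, ← hg v hv.1, ← integral_const_mul]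
  refine setIntegral_congr_fun (measurableSet_interlaces _) fun u hu => ?_
  rw [jointWt_eq_top hu]
  ring

/-- The expectation under the normalized weight `boxWt`. -/
def boxMean (θ β L : ℝ) {n : ℕ} (F : (Fin n → ℝ) → ℝ) : ℝ :=
  (∫ x in boxChamber n L, F x * boxWt θ β L x) / ∫ x in boxChamber n L, boxWt θ β L x

lemma boxMean_eq_of_joint {θ β L : ℝ} (hθ : 0 < θ) (hβ : 0 < β) (hL : 0 < L) {n : ℕ}
    {F : (Fin n → ℝ) → ℝ} {G : (Fin (n + 1) → ℝ) → ℝ}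
    (h : endsConst n θ β L * ∫ u in boxChamber n L, F u * boxWt θ (β + θ) L u =
      topConst n θ * ∫ v in boxChamber (n + 1) L, G v * boxWt θ β L v) :
    boxMean θ (β + θ) L F = boxMean θ β L G := by
  have hone : endsConst n θ β L * ∫ u in boxChamber n L, boxWt θ (β + θ) L u =
      topConst n θ * ∫ v in boxChamber (n + 1) L, boxWt θ β L v := by
    have hI : IntegrableOn (fun p => (fun _ _ => (1 : ℝ)) p.1 p.2 * jointWt θ β L p.1 p.2)
        (jointDom n L) := by
      simpa using integrableOn_jointWt hθ hβ hL n
    have h1 := integral_jointWt_inner_snd (H := fun _ _ => 1) (g := fun _ => 1) hL hI fun u hu => by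
      simpa using integral_daWt ((strictAnti_ends_iff hL).mpr hu) fun i => endsPar_pos hβ hθ i
    have h2 := integral_jointWt_inner_fst (H := fun _ _ => 1) (g := fun _ => 1) hI fun v hv => by
      simpa using integral_daWt hv fun _ => hθ
    simpa using h1.symm.trans h2
  have h1 := integral_boxWt_pos hθ (add_pos hβ hθ) hL n
  have h2 := integral_boxWt_pos hθ hβ hL (n + 1)
  have hE := endsConst_pos n hθ hβ hL
  have hT := topConst_pos n hθ
  rw [boxMean, boxMean, div_eq_div_iff h1.ne' h2.ne']
  refine mul_left_cancel₀ (mul_pos hE hT).ne' ?_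
  calc _ = (endsConst n θ β L * ∫ u in boxChamber n L, F u * boxWt θ (β + θ) L u) *
        (topConst n θ * ∫ v in boxChamber (n + 1) L, boxWt θ β L v) := by ring
    _ = _ := by rw [h, ← hone]; ring

lemma boxMean_step_up {θ β L : ℝ} (hθ : 0 < θ) (hβ : 0 < β) (hL : 0 < L) {d : ℕ}
    {T : ℝ → (Nat.Partition d → ℝ) →L[ℝ] (Nat.Partition d → ℝ)} (hT : IsDAStep θ T) (n : ℕ)
    (c : Nat.Partition d → ℝ) :
    boxMean θ (β + θ) L (fun u : Fin n → ℝ => pEval c (affPS 0 1 u)) =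
      boxMean θ β L (fun v : Fin (n + 1) → ℝ => pEval (T (n + 1) c) (affPS 0 1 v)) := by
  refine boxMean_eq_of_joint hθ hβ hL ?_
  have hc : Continuous fun u : Fin n → ℝ => pEval c (affPS 0 1 u) :=
    continuous_pEval c fun l => continuous_affPS 0 1 l
  have hI := integrableOn_fst_mul_jointWt hθ hβ hL hc
  rw [← integral_jointWt_inner_snd hL (H := fun u _ => pEval c (affPS 0 1 u)) hI,
    ← integral_jointWt_inner_fst (H := fun u _ => pEval c (affPS 0 1 u)) hI]
  · intro v hv
    have := (hT n v (fun _ => θ) 0 1 (n + 1) 0 (affPS 0 1 v) one_ne_zero hv (fun _ => hθ)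
      (by simp [mul_comm]) (fun l _ => by rw [affPS, Finset.mul_sum]) (fun l _ => by simp) c).2
    simpa using this
  · intro u hu
    rw [integral_const_mul, integral_daWt ((strictAnti_ends_iff hL).mpr hu)
      fun i => endsPar_pos hβ hθ i, mul_comm]

/-- The power sums of the two end points. -/
def endPS (L : ℝ) (l : ℕ) : ℝ := L ^ l + (-L) ^ l

lemma boxMean_step_down {θ ρ L : ℝ} (hθ : 0 < θ) (hρ : 0 < ρ) (hL : 0 < L) {d : ℕ}
    {T : ℝ → (Nat.Partition d → ℝ) →L[ℝ] (Nat.Partition d → ℝ)} (hT : IsDAStep θ T) (n : ℕ)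
    (c : Nat.Partition d → ℝ) :
    boxMean θ (θ * ρ) L (fun v : Fin (n + 1) → ℝ =>
        pEval c fun l => (ρ - 1) * endPS L l + affPS 0 1 v l) =
      boxMean θ (θ * ρ + θ) L (fun u : Fin n → ℝ =>
        pEval (T (2 * ρ + n) c) fun l => ρ * endPS L l + affPS 0 1 u l) := by
  have hβ : 0 < θ * ρ := by positivity
  symm
  refine boxMean_eq_of_joint hθ hβ hL ?_
  have hc : Continuous fun v : Fin (n + 1) → ℝ =>
      pEval c fun l => (ρ - 1) * endPS L l + affPS 0 1 v l :=
    continuous_pEval c fun l => continuous_const.add (continuous_affPS 0 1 l)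
  have hI := integrableOn_snd_mul_jointWt hθ hβ hL hc
  rw [← integral_jointWt_inner_snd hL
      (H := fun _ v => pEval c fun l => (ρ - 1) * endPS L l + affPS 0 1 v l) hI,
    ← integral_jointWt_inner_fst
      (H := fun _ v => pEval c fun l => (ρ - 1) * endPS L l + affPS 0 1 v l) hI]
  · intro v hv
    rw [integral_const_mul, integral_daWt hv fun _ => hθ, mul_comm]
  · intro u hu
    refine (hT (n + 1) (ends L u) (endsPar n (θ * ρ) θ) 0 1 (2 * ρ + n)
      (fun l => (ρ - 1) * endPS L l) (fun l => ρ * endPS L l + affPS 0 1 u l) one_ne_zero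
      ((strictAnti_ends_iff hL).mpr hu) (fun i => endsPar_pos hβ hθ i) ?_ ?_ ?_ c).2
    · rw [sum_endsPar (θ * ρ) θ fun _ t => t]
      simp
      ring
    · intro l _
      rw [sum_endsPar (θ * ρ) θ fun i t => t * ((ends L u i - 0) / 1) ^ l]
      simp only [ends_zero, ends_last, ends_succ, Fin.snoc_castSucc, affPS, endPS,
        ← Finset.mul_sum]
      ring
    · intro l _
      simp only [affPS]
      rw [sum_ends L u fun x => ((x - 0) / 1) ^ l, endPS]
      ring

lemma boxMean_up {θ L : ℝ} (hθ : 0 < θ) (hL : 0 < L) {d : ℕ}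
    {T : ℝ → (Nat.Partition d → ℝ) →L[ℝ] (Nat.Partition d → ℝ)} (hT : IsDAStep θ T) (m : ℕ)
    (c : Nat.Partition d → ℝ) (k : ℕ) : ∀ ρ : ℝ, 0 < ρ →
    boxMean θ (θ * (ρ + k)) L (fun u : Fin m → ℝ => pEval c (affPS 0 1 u)) =
      boxMean θ (θ * ρ) L
        (fun v : Fin (m + k) → ℝ => pEval (coeffSeq T m c k) (affPS 0 1 v)) := by
  induction k with
  | zero => intro ρ _; simp [coeffSeq]
  | succ k ih =>
    intro ρ hρ
    have h1 := ih (ρ + 1) (by positivity)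
    have h2 := boxMean_step_up hθ (mul_pos hθ hρ) hL hT (m + k) (coeffSeq T m c k)
    rw [show θ * (ρ + ((k + 1 : ℕ) : ℝ)) = θ * (ρ + 1 + k) by push_cast; ring, h1,
      show θ * (ρ + 1) = θ * ρ + θ by ring, h2, coeffSeq]
    push_cast
    rfl

lemma boxMean_down {θ L : ℝ} (hθ : 0 < θ) (hL : 0 < L) {d : ℕ}
    {T : ℝ → (Nat.Partition d → ℝ) →L[ℝ] (Nat.Partition d → ℝ)} (hT : IsDAStep θ T) (m : ℕ)
    (c : Nat.Partition d → ℝ) (k j : ℕ) : ∀ n, n + j = m + k →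
    boxMean θ θ L (fun v : Fin (m + k) → ℝ => pEval (coeffSeq T m c k) (affPS 0 1 v)) =
      boxMean θ (θ * (1 + j)) L (fun u : Fin n → ℝ =>
        pEval (coeffSeq T m c (k + j)) fun l => j * endPS L l + affPS 0 1 u l) := by
  induction j with
  | zero => rintro n rfl; simp
  | succ j ih =>
    intro n hn
    have h1 := ih (n + 1) (by omega)
    have h2 := boxMean_step_down hθ (by positivity : (0 : ℝ) < 1 + j) hL hT n
      (coeffSeq T m c (k + j))
    simp only [add_sub_cancel_left] at h2
    rw [h1, h2, show θ * (1 + ((j + 1 : ℕ) : ℝ)) = θ * (1 + j) + θ by push_cast; ring,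
      ← Nat.add_assoc, coeffSeq]
    have e : (2 * (1 + j) + n : ℝ) = ((m + (k + j) + 1 : ℕ) : ℝ) := by
      rw [← Nat.add_assoc, ← hn]
      push_cast
      ring
    rw [e]
    push_cast
    simp only [add_comm (1 : ℝ)]

/-- Exact evaluation of the polynomial moments of the box ensemble. -/
lemma boxMean_pEval {θ L : ℝ} (hθ : 0 < θ) (hL : 0 < L) {d : ℕ}
    {T : ℝ → (Nat.Partition d → ℝ) →L[ℝ] (Nat.Partition d → ℝ)} (hT : IsDAStep θ T) (m : ℕ)
    (c : Nat.Partition d → ℝ) (k : ℕ) :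
    boxMean θ (θ * (1 + k)) L (fun u : Fin m → ℝ => pEval c (affPS 0 1 u)) =
      pEval (coeffSeq T m c (k + (m + k))) fun l => ((m + k : ℕ) : ℝ) * endPS L l := by
  have h1 := boxMean_up hθ hL hT m c k 1 one_pos
  have h2 := boxMean_down hθ hL hT m c k (m + k) 0 (zero_add _)
  rw [h1, mul_one, h2]
  have h := integral_boxWt_pos hθ (by positivity : 0 < θ * (1 + ((m + k : ℕ) : ℝ))) hL 0
  simp only [boxMean, affPS, Finset.univ_eq_empty, Finset.sum_empty, add_zero]
  rw [integral_const_mul, mul_div_assoc, div_self h.ne', mul_one]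

/-- Functions on `ℝⁿ` of at most exponential growth. -/
def ExpBdd {n : ℕ} (F : (Fin n → ℝ) → ℝ) : Prop :=
  ∃ C q : ℝ, 0 ≤ C ∧ 0 ≤ q ∧ ∀ x, |F x| ≤ C * Real.exp (q * ∑ i, |x i|)

namespace ExpBdd

variable {n : ℕ} {F G : (Fin n → ℝ) → ℝ}

lemma const (c : ℝ) : ExpBdd fun _ : Fin n → ℝ => c :=
  ⟨|c|, 0, abs_nonneg c, le_rfl, fun x => by simp⟩

lemma mono (hG : ExpBdd G) (h : ∀ x, |F x| ≤ |G x|) : ExpBdd F := by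
  obtain ⟨C, q, hC, hq, hb⟩ := hG
  exact ⟨C, q, hC, hq, fun x => (h x).trans (hb x)⟩

lemma add (hF : ExpBdd F) (hG : ExpBdd G) : ExpBdd fun x => F x + G x := by
  obtain ⟨C, q, hC, hq, hb⟩ := hF
  obtain ⟨C', q', hC', hq', hb'⟩ := hG
  refine ⟨C + C', max q q', by positivity, by positivity, fun x => (abs_add_le _ _).trans ?_⟩
  have hs : 0 ≤ ∑ i, |x i| := Finset.sum_nonneg fun i _ => abs_nonneg _
  rw [add_mul]
  refine add_le_add ((hb x).trans ?_) ((hb' x).trans ?_)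
  · gcongr
    exact le_max_left _ _
  · gcongr
    exact le_max_right _ _

lemma mul (hF : ExpBdd F) (hG : ExpBdd G) : ExpBdd fun x => F x * G x := by
  obtain ⟨C, q, hC, hq, hb⟩ := hF
  obtain ⟨C', q', hC', hq', hb'⟩ := hG
  refine ⟨C * C', q + q', by positivity, by positivity, fun x => ?_⟩
  rw [abs_mul, add_mul, Real.exp_add, mul_mul_mul_comm]
  exact mul_le_mul (hb x) (hb' x) (abs_nonneg _) (by positivity)

lemma sum {ι : Type*} (s : Finset ι) {F : ι → (Fin n → ℝ) → ℝ} (h : ∀ i ∈ s, ExpBdd (F i)) :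
    ExpBdd fun x => ∑ i ∈ s, F i x := by
  classical
  induction s using Finset.induction_on with
  | empty => simpa using const 0
  | insert a s ha ih =>
    simp only [Finset.sum_insert ha]
    exact (h a (by simp)).add (ih fun i hi => h i (by simp [hi]))

lemma prod {ι : Type*} (s : Finset ι) {F : ι → (Fin n → ℝ) → ℝ} (h : ∀ i ∈ s, ExpBdd (F i)) :
    ExpBdd fun x => ∏ i ∈ s, F i x := by
  classical
  induction s using Finset.induction_on with
  | empty => simpa using const 1
  | insert a s ha ih =>
    simp only [Finset.prod_insert ha]
    exact (h a (by simp)).mul (ih fun i hi => h i (by simp [hi]))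

lemma pow (hF : ExpBdd F) (k : ℕ) : ExpBdd fun x => F x ^ k := by
  simpa using prod (Finset.range k) fun _ _ => hF

lemma rpow (hF : ExpBdd F) (h0 : ∀ x, 0 ≤ F x) {s : ℝ} (hs : 0 ≤ s) :
    ExpBdd fun x => F x ^ s := by
  obtain ⟨C, q, hC, hq, hb⟩ := hF
  refine ⟨C ^ s, q * s, Real.rpow_nonneg hC _, by positivity, fun x => ?_⟩
  rw [abs_of_nonneg (Real.rpow_nonneg (h0 x) _), mul_right_comm, Real.exp_mul,
    ← Real.mul_rpow hC (Real.exp_nonneg _)]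
  exact Real.rpow_le_rpow (h0 x) ((le_abs_self _).trans (hb x)) hs

lemma coord (i : Fin n) : ExpBdd fun x => x i := by
  refine ⟨1, 1, by positivity, by positivity, fun x => ?_⟩
  have h1 : |x i| ≤ ∑ i, |x i| :=
    Finset.single_le_sum (f := fun i => |x i|) (fun i _ => abs_nonneg _) (Finset.mem_univ i)
  have h2 := Real.add_one_le_exp (∑ i, |x i|)
  rw [one_mul, one_mul]
  linarith

lemma vdm : ExpBdd (vdm : (Fin n → ℝ) → ℝ) := by
  refine prod _ fun i _ => prod _ fun j _ => ?_
  split_ifs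
  · exact ((coord i).add ((const (-1)).mul (coord j))).mono fun x => by
      rw [abs_abs]
      exact le_of_eq (by ring_nf)
  · exact const 1

lemma affPS (l : ℕ) : ExpBdd fun x : Fin n → ℝ => affPS 0 1 x l := by
  simpa [_root_.affPS] using sum Finset.univ fun i _ => (coord i).pow l

lemma pEval {d : ℕ} (c : Nat.Partition d → ℝ) :
    ExpBdd fun x : Fin n → ℝ => pEval c (_root_.affPS 0 1 x) := by
  refine sum _ fun ν _ => (const _).mul ?_
  unfold powProd
  induction ν.parts using Multiset.induction_on with
  | empty => simpa using const 1
  | cons a s ih => simpa using (affPS a).mul ih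

end ExpBdd

lemma integrable_exp_neg_sum_sq {n : ℕ} {b : ℝ} (hb : 0 < b) :
    Integrable fun x : Fin n → ℝ => Real.exp (-b * ∑ i, x i ^ 2) := by
  have := Integrable.fintype_prod (fun _ : Fin n => integrable_exp_neg_mul_sq hb)
  simp only [Finset.mul_sum, Real.exp_sum]
  exact this

lemma ExpBdd.integrable {n : ℕ} {F : (Fin n → ℝ) → ℝ} (hF : ExpBdd F)
    (hm : AEStronglyMeasurable F) {b : ℝ} (hb : 0 < b) :
    Integrable fun x => F x * Real.exp (-b * ∑ i, x i ^ 2) := by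
  obtain ⟨C, q, hC, hq, h⟩ := hF
  refine ((integrable_exp_neg_sum_sq (n := n) (b := b / 2) (by positivity)).const_mul
    (C * Real.exp (n * (q ^ 2 / (2 * b))))).mono' (hm.mul
      (Continuous.aestronglyMeasurable (by fun_prop)))
    (.of_forall fun x => ?_)
  rw [norm_mul, Real.norm_eq_abs, Real.norm_eq_abs, Real.abs_exp]
  refine (mul_le_mul_of_nonneg_right (h x) (Real.exp_nonneg _)).trans ?_
  rw [mul_assoc, mul_assoc, ← Real.exp_add, ← Real.exp_add]
  refine mul_le_mul_of_nonneg_left (Real.exp_le_exp.mpr ?_) hC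
  have hi : ∀ i, q * |x i| + -b * x i ^ 2 ≤ q ^ 2 / (2 * b) + -(b / 2) * x i ^ 2 := fun i => by
    have h1 : (0 : ℝ) ≤ (q - b * |x i|) ^ 2 / (2 * b) := by positivity
    have h2 : (q - b * |x i|) ^ 2 / (2 * b) = q ^ 2 / (2 * b) - q * |x i| + b / 2 * x i ^ 2 := by
      rw [← sq_abs (x i)]
      field_simp
      ring
    linarith
  have := Finset.sum_le_sum fun i (_ : i ∈ Finset.univ) => hi i
  simpa only [Finset.sum_add_distrib, ← Finset.mul_sum, Finset.sum_const, Finset.card_univ,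
    Fintype.card_fin, nsmul_eq_mul] using this

/-- The weight of the Gaussian beta ensemble. -/
def gaussWt (θ : ℝ) {n : ℕ} (x : Fin n → ℝ) : ℝ :=
  vdm x ^ (2 * θ) * Real.exp (-(θ / 2) * ∑ i, x i ^ 2)

lemma gaussWt_pos (θ : ℝ) {n : ℕ} {x : Fin n → ℝ} (hx : StrictAnti x) : 0 < gaussWt θ x :=
  mul_pos (Real.rpow_pos_of_pos (vdm_pos hx.injective) _) (Real.exp_pos _)

lemma ExpBdd.integrable_gaussWt {θ : ℝ} (hθ : 0 < θ) {n : ℕ} {F : (Fin n → ℝ) → ℝ}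
    (hF : ExpBdd F) (hm : Measurable F) : Integrable fun x => F x * gaussWt θ x := by
  have := (hF.mul (ExpBdd.vdm.rpow vdm_nonneg (by positivity : 0 ≤ 2 * θ))).integrable
    (hm.mul (measurable_vdm.pow_const _)).aestronglyMeasurable (by positivity : 0 < θ / 2)
  simpa [gaussWt, mul_assoc] using this

lemma integral_gaussWt_pos {θ : ℝ} (hθ : 0 < θ) (n : ℕ) :
    0 < ∫ x in {x : Fin n → ℝ | StrictAnti x}, gaussWt θ x := by
  have hI : Integrable (gaussWt θ : (Fin n → ℝ) → ℝ) := by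
    simpa using (ExpBdd.const 1).integrable_gaussWt hθ measurable_const
  have hO := isOpen_setOf_strictAnti (n := n)
  rw [setIntegral_pos_iff_support_of_nonneg_ae
    (ae_restrict_of_forall_mem hO.measurableSet fun x hx => (gaussWt_pos θ hx).le)
    hI.integrableOn]
  have : (Function.support (gaussWt θ) ∩ {x : Fin n → ℝ | StrictAnti x}) =
      {x : Fin n → ℝ | StrictAnti x} :=
    Set.inter_eq_right.mpr fun x hx => (gaussWt_pos θ hx).ne'
  rw [this]
  refine hO.measure_pos _ ⟨fun i => -(i : ℝ), fun i j h => ?_⟩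
  exact neg_lt_neg (by exact_mod_cast h)

/-- The expectation under the Gaussian beta ensemble. -/
def gaussMean (θ : ℝ) {n : ℕ} (F : (Fin n → ℝ) → ℝ) : ℝ :=
  (∫ x in {x : Fin n → ℝ | StrictAnti x}, F x * gaussWt θ x) /
    ∫ x in {x : Fin n → ℝ | StrictAnti x}, gaussWt θ x

/-- The half-width squared of the box approximating the Gaussian ensemble. -/
def boxSq (m k : ℕ) : ℝ := 2 * ((m + k : ℕ) : ℝ)

lemma tendsto_boxSq (m : ℕ) : Tendsto (boxSq m) atTop atTop := by
  refine Tendsto.const_mul_atTop two_pos (tendsto_natCast_atTop_atTop.comp ?_)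
  exact tendsto_atTop_mono (fun k => Nat.le_add_left k m) tendsto_id

lemma boxSq_pos {m : ℕ} (hm : 1 ≤ m) (k : ℕ) : 0 < boxSq m k := by
  unfold boxSq
  have : 0 < m + k := by omega
  positivity

lemma tendsto_exponent_div (θ : ℝ) (m : ℕ) :
    Tendsto (fun k : ℕ => (θ * (1 + k) - 1) / boxSq m k) atTop (𝓝 (θ / 2)) := by
  have h := (tendsto_inv_atTop_zero.comp (tendsto_boxSq m)).const_mul (θ * (1 - m) - 1)
  have h2 := h.const_add (θ / 2)
  rw [mul_zero, add_zero] at h2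
  refine h2.congr' ?_
  filter_upwards [(tendsto_boxSq m).eventually_gt_atTop 0] with k hk
  have : (k : ℝ) = boxSq m k / 2 - m := by
    unfold boxSq
    push_cast
    ring
  rw [this]
  simp only [Function.comp]
  field_simp
  ring

/-- The normalized edge factor on the box. -/
def boxCut (θ : ℝ) (m k : ℕ) (x : Fin m → ℝ) : ℝ :=
  {x : Fin m → ℝ | ∀ i, |x i| < √(boxSq m k)}.indicator
    (fun x => ∏ i, (1 - x i ^ 2 / boxSq m k) ^ (θ * (1 + k) - 1)) x

lemma one_sub_div_pos {m k : ℕ} (hm : 1 ≤ m) {t : ℝ} (ht : |t| < √(boxSq m k)) :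
    0 < 1 - t ^ 2 / boxSq m k := by
  have h := boxSq_pos hm k
  rw [sub_pos, div_lt_one h, ← sq_abs, ← Real.lt_sqrt (abs_nonneg _)]
  exact ht

lemma boxWt_eq_boxCut (θ : ℝ) {m : ℕ} (hm : 1 ≤ m) (k : ℕ) {x : Fin m → ℝ}
    (hx : ∀ i, |x i| < √(boxSq m k)) :
    boxWt θ (θ * (1 + k)) √(boxSq m k) x =
      (boxSq m k ^ (θ * (1 + k) - 1)) ^ m * (vdm x ^ (2 * θ) * boxCut θ m k x) := by
  have h := boxSq_pos hm k
  have e : edgeProd √(boxSq m k) x = ∏ i, boxSq m k * (1 - x i ^ 2 / boxSq m k) := by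
    refine Finset.prod_congr rfl fun i _ => ?_
    rw [Real.sq_sqrt h.le, mul_sub, mul_div_cancel₀ _ h.ne', mul_one]
  rw [boxWt, e, boxCut, Set.indicator_of_mem (by exact hx),
    ← Real.finsetProd_rpow _ _ fun i _ => (mul_pos h (one_sub_div_pos hm (hx i))).le]
  simp only [Real.mul_rpow h.le (one_sub_div_pos hm (hx _)).le]
  rw [Finset.prod_mul_distrib, Finset.prod_const, Finset.card_univ, Fintype.card_fin]
  ring

lemma integral_box_eq (θ : ℝ) {m : ℕ} (hm : 1 ≤ m) (k : ℕ) (F : (Fin m → ℝ) → ℝ) :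
    ∫ x in boxChamber m √(boxSq m k), F x * boxWt θ (θ * (1 + k)) √(boxSq m k) x =
      (boxSq m k ^ (θ * (1 + k) - 1)) ^ m *
        ∫ x in {x : Fin m → ℝ | StrictAnti x}, F x * vdm x ^ (2 * θ) * boxCut θ m k x := by
  rw [← integral_const_mul, ← integral_indicator (measurableSet_boxChamber _ _),
    ← integral_indicator isOpen_setOf_strictAnti.measurableSet]
  refine integral_congr_ae (.of_forall fun x => ?_)
  by_cases hx : StrictAnti x
  · by_cases hb : ∀ i, |x i| < √(boxSq m k)
    · rw [Set.indicator_of_mem (show x ∈ boxChamber m √(boxSq m k) from ⟨hx, hb⟩),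
        Set.indicator_of_mem (show x ∈ {x : Fin m → ℝ | StrictAnti x} from hx),
        boxWt_eq_boxCut θ hm k hb]
      ring
    · rw [Set.indicator_of_notMem (fun h : x ∈ boxChamber m √(boxSq m k) => hb h.2),
        Set.indicator_of_mem (show x ∈ {x : Fin m → ℝ | StrictAnti x} from hx), boxCut,
        Set.indicator_of_notMem (by exact hb)]
      simp
  · rw [Set.indicator_of_notMem (fun h : x ∈ boxChamber m √(boxSq m k) => hx h.1),
      Set.indicator_of_notMem (by exact hx)]

lemma tendsto_boxCut (θ : ℝ) {m : ℕ} (x : Fin m → ℝ) :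
    Tendsto (fun k => boxCut θ m k x) atTop (𝓝 (Real.exp (-(θ / 2) * ∑ i, x i ^ 2))) := by
  have hL : Tendsto (fun k => √(boxSq m k)) atTop atTop :=
    Real.tendsto_sqrt_atTop.comp (tendsto_boxSq m)
  have hev : ∀ᶠ k in atTop, ∀ i, |x i| < √(boxSq m k) :=
    eventually_all.mpr fun i => hL.eventually_gt_atTop _
  rw [Finset.mul_sum, Real.exp_sum]
  have hlim : Tendsto (fun k : ℕ => ∏ i, (1 - x i ^ 2 / boxSq m k) ^ (θ * (1 + k) - 1)) atTop
      (𝓝 (∏ i, Real.exp (-(θ / 2) * x i ^ 2))) := by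
    refine tendsto_finsetProd _ fun i _ => ?_
    have h1 := ((Real.tendsto_one_add_div_rpow_exp (-(x i ^ 2))).comp (tendsto_boxSq m)).rpow
      (tendsto_exponent_div θ m) (.inl (Real.exp_ne_zero _))
    rw [← Real.exp_mul, show -(x i ^ 2) * (θ / 2) = -(θ / 2) * x i ^ 2 by ring] at h1
    refine h1.congr' ?_
    filter_upwards [(tendsto_boxSq m).eventually_gt_atTop (x i ^ 2),
      (tendsto_boxSq m).eventually_gt_atTop 0] with k hk h0
    have hp : 0 ≤ 1 + -(x i ^ 2) / boxSq m k := by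
      rw [neg_div, ← sub_eq_add_neg, sub_nonneg, div_le_one h0]
      exact hk.le
    simp only [Function.comp]
    rw [← Real.rpow_mul hp, mul_div_cancel₀ _ h0.ne', neg_div, ← sub_eq_add_neg]
  refine hlim.congr' ?_
  filter_upwards [hev] with k hk
  rw [boxCut, Set.indicator_of_mem (by exact hk)]

lemma boxCut_le {θ : ℝ} (hθ : 0 < θ) {m : ℕ} (hm : 1 ≤ m) :
    ∀ᶠ k in atTop, ∀ x : Fin m → ℝ,
      |boxCut θ m k x| ≤ Real.exp (-(θ / 4) * ∑ i, x i ^ 2) := by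
  filter_upwards [(tendsto_exponent_div θ m).eventually
    (lt_mem_nhds (by linarith : θ / 4 < θ / 2))] with k hk x
  have h0 := boxSq_pos hm k
  by_cases hx : ∀ i, |x i| < √(boxSq m k)
  · rw [boxCut, Set.indicator_of_mem (by exact hx), Finset.abs_prod, Finset.mul_sum, Real.exp_sum]
    refine Finset.prod_le_prod (fun i _ => abs_nonneg _) fun i _ => ?_
    have hp := one_sub_div_pos hm (hx i)
    have hκ : 0 ≤ θ * (1 + k) - 1 := by
      rw [lt_div_iff₀ h0] at hk
      nlinarith
    rw [abs_of_pos (Real.rpow_pos_of_pos hp _)]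
    calc _ ≤ (Real.exp (-(x i ^ 2 / boxSq m k))) ^ (θ * (1 + k) - 1) :=
          Real.rpow_le_rpow hp.le (Real.one_sub_le_exp_neg _) hκ
      _ = Real.exp (-((θ * (1 + k) - 1) / boxSq m k) * x i ^ 2) := by
          rw [← Real.exp_mul]
          ring_nf
      _ ≤ _ := Real.exp_le_exp.mpr
          (mul_le_mul_of_nonneg_right (neg_le_neg hk.le) (sq_nonneg _))
  · rw [boxCut, Set.indicator_of_notMem (by exact hx), abs_zero]
    exact Real.exp_nonneg _

lemma measurable_boxCut (θ : ℝ) (m k : ℕ) : Measurable (boxCut θ m k) := by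
  refine Measurable.indicator (by fun_prop) ?_
  simp only [Set.ofPred_forall]
  exact MeasurableSet.iInter fun i => measurableSet_lt (by fun_prop) (by fun_prop)

lemma tendsto_integral_boxCut {θ : ℝ} (hθ : 0 < θ) {m : ℕ} (hm : 1 ≤ m)
    {F : (Fin m → ℝ) → ℝ} (hF : ExpBdd F) (hFm : Measurable F) :
    Tendsto (fun k => ∫ x in {x : Fin m → ℝ | StrictAnti x},
        F x * vdm x ^ (2 * θ) * boxCut θ m k x) atTop
      (𝓝 (∫ x in {x : Fin m → ℝ | StrictAnti x}, F x * gaussWt θ x)) := by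
  have hmeas : Measurable fun x => F x * vdm x ^ (2 * θ) :=
    hFm.mul (measurable_vdm.pow_const _)
  refine tendsto_integral_filter_of_dominated_convergence
    (fun x => |F x * vdm x ^ (2 * θ)| * Real.exp (-(θ / 4) * ∑ i, x i ^ 2)) ?_ ?_ ?_ ?_
  · exact .of_forall fun k => (hmeas.mul (measurable_boxCut θ m k)).aestronglyMeasurable
  · filter_upwards [boxCut_le hθ hm] with k hk
    refine .of_forall fun x => ?_
    rw [norm_mul]
    exact mul_le_mul_of_nonneg_left (hk x) (abs_nonneg _)
  · have := (hF.mul (ExpBdd.vdm.rpow vdm_nonneg (by positivity : 0 ≤ 2 * θ))).integrable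
      hmeas.aestronglyMeasurable (by positivity : 0 < θ / 4)
    refine (this.norm.congr (.of_forall fun x => ?_)).integrableOn
    simp [norm_mul]
  · refine .of_forall fun x => ?_
    simpa only [gaussWt, mul_assoc] using (tendsto_boxCut θ x).const_mul (F x * vdm x ^ (2 * θ))

lemma tendsto_boxMean {θ : ℝ} (hθ : 0 < θ) {m : ℕ} (hm : 1 ≤ m)
    {F : (Fin m → ℝ) → ℝ} (hF : ExpBdd F) (hFm : Measurable F) :
    Tendsto (fun k : ℕ => boxMean θ (θ * (1 + k)) √(boxSq m k) F) atTop
      (𝓝 (gaussMean θ F)) := by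
  have h1 := tendsto_integral_boxCut hθ hm hF hFm
  have h2 := tendsto_integral_boxCut hθ hm (ExpBdd.const 1) measurable_const
  simp only [one_mul] at h2
  refine (h1.div h2 (integral_gaussWt_pos hθ m).ne').congr fun k => ?_
  have e1 := integral_box_eq θ hm k F
  have e2 := integral_box_eq θ hm k fun _ => 1
  simp only [one_mul] at e2
  rw [boxMean, e1, e2, mul_div_mul_left]
  · rfl
  exact (pow_pos (Real.rpow_pos_of_pos (boxSq_pos hm k) _) _).ne'

/-- The power sums (beyond the zeroth) of the limiting, centred and normalized spectrum. -/
def limPS (l : ℕ) : ℝ := if l = 2 then 1 else 0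

lemma tendsto_endPS {m : ℕ} (hm : 1 ≤ m) {l : ℕ} (hl : 0 < l) :
    Tendsto (fun k : ℕ => ((m + k : ℕ) : ℝ) * endPS √(boxSq m k) l / boxSq m k ^ l) atTop
      (𝓝 (limPS l)) := by
  have hN : ∀ k, ((m + k : ℕ) : ℝ) = √(boxSq m k) ^ 2 / 2 := fun k => by
    rw [Real.sq_sqrt (boxSq_pos hm k).le, boxSq]
    ring
  have hB : ∀ k, boxSq m k ^ l = √(boxSq m k) ^ l * √(boxSq m k) ^ l := fun k => by
    rw [← mul_pow, Real.mul_self_sqrt (boxSq_pos hm k).le]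
  have hS : ∀ k, √(boxSq m k) ≠ 0 := fun k => (Real.sqrt_pos.mpr (boxSq_pos hm k)).ne'
  have hL : Tendsto (fun k => √(boxSq m k)) atTop atTop :=
    Real.tendsto_sqrt_atTop.comp (tendsto_boxSq m)
  simp only [hN, hB, endPS]
  rcases Nat.lt_or_ge l 3 with h3 | h3
  · interval_cases l
    · simp [limPS]
    · refine tendsto_const_nhds.congr fun k => ?_
      have := hS k
      rw [limPS, if_pos rfl]
      field_simp
      ring
  · rw [limPS, if_neg (by omega)]
    obtain ⟨j, rfl⟩ := Nat.exists_eq_add_of_le' h3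
    have hz := ((tendsto_pow_atTop (Nat.succ_ne_zero j)).comp hL).inv_tendsto_atTop.const_mul
      ((1 + (-1) ^ (j + 3)) / 2)
    rw [mul_zero] at hz
    refine hz.congr fun k => ?_
    have := hS k
    simp only [Function.comp, Pi.inv_apply, Nat.succ_eq_add_one]
    rw [neg_pow √(boxSq m k)]
    field_simp
    ring

/-- Identification of the asymptotics of the coefficient sequences with Gaussian moments. -/
lemma exists_tendsto_coeffSeq_gaussMean {θ : ℝ} (hθ : 0 < θ) {d : ℕ}
    {T : ℝ → (Nat.Partition d → ℝ) →L[ℝ] (Nat.Partition d → ℝ)} {C : ℝ} (hT : IsDAStep θ T)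
    (hTC : ∀ K : ℝ, 0 < K →
      ‖T K - (1 - d / K : ℝ) • ContinuousLinearMap.id ℝ (Nat.Partition d → ℝ)‖ ≤ C / K ^ 2)
    {m : ℕ} (hm : 1 ≤ m) (c : Nat.Partition d → ℝ) :
    ∃ z, Tendsto (fun n : ℕ => ((m + n : ℕ) : ℝ) ^ d • coeffSeq T m c n) atTop (𝓝 z) ∧
      pEval z limPS = gaussMean θ fun x : Fin m → ℝ => pEval c (affPS 0 1 x) := by
  obtain ⟨z, hz⟩ := exists_tendsto_coeffSeq hTC hm c
  refine ⟨z, hz, ?_⟩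
  have h1 := tendsto_boxMean hθ hm (ExpBdd.pEval c)
    (continuous_pEval c fun l => continuous_affPS 0 1 l).measurable
  have hsub : Tendsto (fun k => k + (m + k)) atTop atTop :=
    tendsto_atTop_mono (fun k => Nat.le_add_right k (m + k)) tendsto_id
  have h2 : Tendsto (fun k => pEval (coeffSeq T m c (k + (m + k)))
      fun l => ((m + k : ℕ) : ℝ) * endPS √(boxSq m k) l) atTop (𝓝 (pEval z limPS)) := by
    refine tendsto_pEval (N := boxSq m) (fun k => (boxSq_pos hm k).ne') ?_
      fun l hl => tendsto_endPS hm hl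
    refine (hz.comp hsub).congr fun k => ?_
    simp only [Function.comp, boxSq]
    congr 2
    push_cast
    ring
  refine tendsto_nhds_unique h2 (h1.congr fun k => ?_)
  exact boxMean_pEval hθ (Real.sqrt_pos.mpr (boxSq_pos hm k)) hT m c k

/-- The array with lower levels `x` and top level `y`. -/
def triSnoc {M : ℕ} (y : Fin (M + 1) → ℝ) (x : Tri M) : Tri (M + 1) :=
  Fin.snoc (α := fun k : Fin (M + 1) => Fin (k.1 + 1) → ℝ) x y

lemma triSnoc_castSucc {M : ℕ} (y : Fin (M + 1) → ℝ) (x : Tri M) (k : Fin M) :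
    triSnoc y x k.castSucc = x k :=
  Fin.snoc_castSucc (α := fun k : Fin (M + 1) => Fin (k.1 + 1) → ℝ) y x k

lemma triSnoc_last {M : ℕ} (y : Fin (M + 1) → ℝ) (x : Tri M) :
    triSnoc y x (Fin.last M) = y :=
  Fin.snoc_last (α := fun k : Fin (M + 1) => Fin (k.1 + 1) → ℝ) y x

lemma triSnoc_of_lt {M : ℕ} (y : Fin (M + 1) → ℝ) (x : Tri M) {k : ℕ} (hk : k < M + 1)
    (h : k < M) : triSnoc y x ⟨k, hk⟩ = x ⟨k, h⟩ :=
  triSnoc_castSucc y x ⟨k, h⟩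

lemma continuous_triSnoc {M : ℕ} :
    Continuous fun p : (Fin (M + 1) → ℝ) × Tri M => triSnoc p.1 p.2 := by
  refine continuous_pi fun k => ?_
  induction k using Fin.lastCases with
  | last =>
    simp only [triSnoc_last]
    exact continuous_fst
  | cast k =>
    simp only [triSnoc_castSucc]
    exact (continuous_apply k).comp continuous_snd

/-- Splitting off the top level of a triangular array. -/
def triEquiv (M : ℕ) : (Fin (M + 1) → ℝ) × Tri M ≃ᵐ Tri (M + 1) where
  toFun p := triSnoc p.1 p.2
  invFun x := (x (Fin.last M), fun k => x k.castSucc)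
  left_inv p := by
    ext1
    · exact triSnoc_last _ _
    · funext k
      exact triSnoc_castSucc _ _ k
  right_inv x := by
    funext k
    induction k using Fin.lastCases with
    | last => exact triSnoc_last _ _
    | cast k => exact triSnoc_castSucc _ _ k
  measurable_toFun := continuous_triSnoc.measurable
  measurable_invFun := (measurable_pi_apply _).prodMk
    (measurable_pi_lambda _ fun k => measurable_pi_apply _)

lemma measurePreserving_triEquiv (M : ℕ) : MeasurePreserving (triEquiv M) := by
  refine ⟨(triEquiv M).measurable, ?_⟩
  refine (Measure.pi_eq fun s hs => ?_).symm
  rw [(triEquiv M).map_apply]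
  have : (triEquiv M) ⁻¹' Set.univ.pi s =
      s (Fin.last M) ×ˢ Set.univ.pi fun k : Fin M => s k.castSucc := by
    ext p
    simp only [Set.mem_preimage, Set.mem_pi, Set.mem_univ, true_imp_iff, Set.mem_prod]
    refine (Fin.forall_fin_succ').trans (and_comm.trans (and_congr ?_ (forall_congr' fun k => ?_)))
    · exact iff_of_eq (congrArg (· ∈ s (Fin.last M)) (triSnoc_last p.1 p.2))
    · exact iff_of_eq (congrArg (· ∈ s k.castSucc) (triSnoc_castSucc p.1 p.2 k))
  rw [this, Fin.prod_univ_castSucc, mul_comm]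
  exact (Measure.prod_prod _ _).trans (congrArg _ (Measure.pi_pi _ _))

/-- The density `obpWt`, on arrays of the expected shape. -/
def cornersWt (θ : ℝ) {M : ℕ} (b : Fin (M + 1) → ℝ) (x : Tri M) : ℝ := obpWt θ b x

/-- The domain `obpDomain`, as a set of arrays of the expected shape. -/
def cornersDom {M : ℕ} (b : Fin (M + 1) → ℝ) : Set (Tri M) := obpDomain b

lemma lvl_triSnoc {M : ℕ} (b : Fin (M + 2) → ℝ) (y : Fin (M + 1) → ℝ) (x : Tri M) {k : ℕ}
    (hk : k < M + 1) (hk' : k < M + 2) : lvl b (triSnoc y x) k hk' = lvl y x k hk := by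
  unfold lvl
  rw [dif_pos (show k < M + 2 - 1 from hk)]
  by_cases h : k < M
  · rw [dif_pos (show k < M + 1 - 1 from h)]
    funext i
    exact congrFun (triSnoc_of_lt y x hk h) i
  · rw [dif_neg (show ¬ k < M + 1 - 1 from h)]
    obtain rfl : k = M := by omega
    funext i
    exact congrFun (triSnoc_last y x) i

lemma lvl_top {M : ℕ} (b : Fin (M + 1) → ℝ) (x : Tri M) (h : M < M + 1) : lvl b x M h = b := by
  unfold lvl
  rw [dif_neg (show ¬ M < M + 1 - 1 from lt_irrefl M)]

lemma cornersWt_triSnoc (θ : ℝ) {M : ℕ} (b : Fin (M + 2) → ℝ) (y : Fin (M + 1) → ℝ) (x : Tri M) :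
    cornersWt θ b (triSnoc y x) =
      cornersWt θ y x * (vdm y ^ (2 - 2 * θ) * crossWt θ y b) := by
  unfold cornersWt obpWt
  refine (Fin.prod_univ_castSucc (n := M) _).trans (congrArg₂ _ (Finset.prod_congr rfl fun k _ => ?_) ?_)
  · have h1 := lvl_triSnoc b y x (k := k.1 + 1) (by have := k.isLt; omega)
      (by have := k.isLt; omega)
    have h2 := triSnoc_castSucc y x k
    simp only [Fin.val_castSucc]
    rw [h1, h2]
  · rw [← prod_rpow_eq_vdm, crossWt]
    have h1 := lvl_top b (triSnoc y x) (Nat.lt_succ_self _)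
    have h2 := triSnoc_last y x
    simp only [Fin.val_last]
    rw [h1, h2]

lemma triSnoc_mem_cornersDom {M : ℕ} {b : Fin (M + 2) → ℝ} {y : Fin (M + 1) → ℝ} {x : Tri M} :
    triSnoc y x ∈ cornersDom b ↔ Interlaces y b ∧ x ∈ cornersDom y := by
  unfold cornersDom obpDomain
  refine (Fin.forall_fin_succ' (n := M)).trans (and_comm.trans (and_congr ?_ ?_))
  · have h1 := lvl_top b (triSnoc y x) (Nat.lt_succ_self _)
    have h2 := triSnoc_last y x
    simp only [Fin.val_last]
    rw [h1, h2]
  · refine forall_congr' fun k => ?_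
    have h1 := lvl_triSnoc b y x (k := k.1 + 1) (by have := k.isLt; omega)
      (by have := k.isLt; omega)
    have h2 := triSnoc_castSucc y x k
    simp only [Fin.val_castSucc]
    rw [h1, h2]

lemma continuous_lvl {M : ℕ} (k : ℕ) (hk : k < M + 1) :
    Continuous fun p : (Fin (M + 1) → ℝ) × Tri M => lvl p.1 p.2 k hk := by
  unfold lvl
  by_cases h : k < M + 1 - 1
  · simp only [dif_pos h]
    exact (continuous_apply (A := fun k : Fin M => Fin (k.1 + 1) → ℝ) ⟨k, h⟩).comp continuous_snd
  · simp only [dif_neg h]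
    fun_prop

lemma measurable_cornersWt (θ : ℝ) (M : ℕ) :
    Measurable fun p : (Fin (M + 1) → ℝ) × Tri M => cornersWt θ p.1 p.2 := by
  unfold cornersWt obpWt
  refine Finset.measurable_prod _ fun k _ => ?_
  have hl := continuous_lvl (M := M) (k.1 + 1) (by have := k.isLt; omega)
  have hx : Continuous fun p : (Fin (M + 1) → ℝ) × Tri M => p.2 k :=
    (continuous_apply (A := fun k : Fin M => Fin (k.1 + 1) → ℝ) k).comp continuous_snd
  refine Measurable.mul (Finset.measurable_prod _ fun i _ => Finset.measurable_prod _ fun j _ => ?_)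
    (Finset.measurable_prod _ fun s _ => Finset.measurable_prod _ fun r _ => ?_)
  · split_ifs
    · exact (((continuous_apply i).comp hx).sub ((continuous_apply j).comp hx)).abs.measurable.pow_const _
    · exact measurable_const
  · exact (((continuous_apply s).comp hl).sub ((continuous_apply r).comp hx)).abs.measurable.pow_const _

lemma isOpen_cornersDom (M : ℕ) :
    IsOpen {p : (Fin (M + 1) → ℝ) × Tri M | p.2 ∈ cornersDom p.1} := by
  have : {p : (Fin (M + 1) → ℝ) × Tri M | p.2 ∈ cornersDom p.1} =
      ⋂ k : Fin M, {p | Interlaces (p.2 k) (lvl p.1 p.2 (k.1 + 1) (by have := k.isLt; omega))} := by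
    ext p
    simp only [Set.mem_iInter]
    rfl
  rw [this]
  refine isOpen_iInter_of_finite fun k => isOpen_setOf_interlaces ?_
    (continuous_lvl (M := M) (k.1 + 1) (by have := k.isLt; omega))
  exact (continuous_apply (A := fun k : Fin M => Fin (k.1 + 1) → ℝ) k).comp continuous_snd

lemma measurableSet_cornersDom {M : ℕ} (b : Fin (M + 1) → ℝ) : MeasurableSet (cornersDom b) :=
  ((isOpen_cornersDom M).preimage (Continuous.prodMk_right b)).measurableSet

lemma cornersWt_nonneg (θ : ℝ) {M : ℕ} (b : Fin (M + 1) → ℝ) (x : Tri M) : 0 ≤ cornersWt θ b x := by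
  unfold cornersWt obpWt
  refine Finset.prod_nonneg fun k _ => ?_
  rw [prod_rpow_eq_vdm]
  exact mul_nonneg (Real.rpow_nonneg (vdm_nonneg _) _) (crossWt_nonneg θ _ _)

lemma Interlaces.norm_le {n : ℕ} {u : Fin n → ℝ} {v : Fin (n + 1) → ℝ} (h : Interlaces u v) :
    ‖u‖ ≤ ‖v‖ := by
  refine (pi_norm_le_iff_of_nonneg (norm_nonneg _)).mpr fun i => abs_le.mpr ⟨?_, ?_⟩
  · have := (abs_le.mp (norm_le_pi_norm v i.succ)).1
    linarith [(h i).2]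
  · exact (h i).1.le.trans ((le_abs_self _).trans (norm_le_pi_norm v i.castSucc))

lemma norm_le_of_mem_cornersDom {M : ℕ} {b : Fin (M + 1) → ℝ} {x : Tri M}
    (hx : x ∈ cornersDom b) : ‖x‖ ≤ ‖b‖ := by
  induction M with
  | zero => exact (pi_norm_le_iff_of_nonneg (norm_nonneg _)).mpr fun i => i.elim0
  | succ M ih =>
    obtain ⟨⟨y, x⟩, rfl⟩ := (triEquiv M).surjective x
    obtain ⟨h1, h2⟩ := triSnoc_mem_cornersDom.mp hx
    refine (pi_norm_le_iff_of_nonneg (norm_nonneg _)).mpr fun k => ?_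
    refine le_trans ?_ h1.norm_le
    change ‖triSnoc y x k‖ ≤ _
    induction k using Fin.lastCases with
    | last => rw [triSnoc_last]
    | cast k =>
      rw [triSnoc_castSucc]
      exact (norm_le_pi_norm x k).trans (ih h2)

lemma strictAnti_of_mem_cornersDom {M : ℕ} {b : Fin (M + 1) → ℝ} {x : Tri M}
    (hx : x ∈ cornersDom b) : StrictAnti b := by
  cases M with
  | zero => exact fun i j h => absurd h (by omega)
  | succ M =>
    obtain ⟨⟨y, x⟩, rfl⟩ := (triEquiv M).surjective x
    exact (triSnoc_mem_cornersDom.mp hx).1.strictAnti_right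

section Normalized

variable {α : Type*} [MeasureSpace α]

/-- The probability measure with density proportional to `w` on `D`. -/
def normMeasure (D : Set α) (w : α → ℝ) : Measure α :=
  (ENNReal.ofReal (∫ x in D, w x))⁻¹ •
    volume.withDensity fun x => ENNReal.ofReal (D.indicator w x)

variable {D : Set α} {w : α → ℝ}

lemma integral_normMeasure (hD : MeasurableSet D) (hw : Measurable w) (h0 : ∀ x ∈ D, 0 ≤ w x)
    (Φ : α → ℝ) :
    ∫ x, Φ x ∂(normMeasure D w) = (∫ x in D, Φ x * w x) / ∫ x in D, w x := by
  have hn : 0 ≤ ∫ x in D, w x := setIntegral_nonneg hD h0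
  rw [normMeasure, integral_smul_measure, integral_withDensity_eq_integral_toReal_smul (E := ℝ)
    (hw.indicator hD).ennreal_ofReal (.of_forall fun x => ENNReal.ofReal_lt_top),
    ENNReal.toReal_inv, ENNReal.toReal_ofReal hn, smul_eq_mul, inv_mul_eq_div,
    ← integral_indicator (f := fun x => Φ x * w x) hD]
  refine congrArg (· / _) (integral_congr_ae (.of_forall fun x => ?_))
  by_cases hx : x ∈ D
  · simp [hx, ENNReal.toReal_ofReal (h0 x hx), mul_comm]
  · simp [hx]

lemma isProbabilityMeasure_normMeasure (hD : MeasurableSet D) (h0 : ∀ x ∈ D, 0 ≤ w x)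
    (hi : IntegrableOn w D) (hpos : 0 < ∫ x in D, w x) :
    IsProbabilityMeasure (normMeasure D w) := by
  constructor
  have h1 : ∀ x, ENNReal.ofReal (D.indicator w x) = D.indicator (fun x => ENNReal.ofReal (w x)) x :=
    fun x => by by_cases hx : x ∈ D <;> simp [hx]
  rw [normMeasure, Measure.smul_apply, withDensity_apply _ .univ, setLIntegral_univ, smul_eq_mul]
  simp only [h1]
  have hn : 0 ≤ᵐ[volume.restrict D] w := (ae_restrict_mem hD).mono h0
  rw [lintegral_indicator hD, ← ofReal_integral_eq_lintegral_ofReal hi hn]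
  exact ENNReal.inv_mul_cancel (by simpa using hpos) ENNReal.ofReal_ne_top

lemma integrable_normMeasure (hD : MeasurableSet D) (hw : Measurable w) (h0 : ∀ x ∈ D, 0 ≤ w x)
    (hpos : 0 < ∫ x in D, w x) {Φ : α → ℝ} (hΦ : IntegrableOn (fun x => Φ x * w x) D) :
    Integrable Φ (normMeasure D w) := by
  refine Integrable.smul_measure ?_ (by simpa using hpos)
  rw [integrable_withDensity_iff_integrable_smul' (hw.indicator hD).ennreal_ofReal
    (.of_forall fun x => ENNReal.ofReal_lt_top)]
  refine (hΦ.integrable_indicator hD).congr (.of_forall fun x => ?_)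
  by_cases hx : x ∈ D
  · simp [hx, ENNReal.toReal_ofReal (h0 x hx), mul_comm]
  · simp [hx]

lemma ae_mem_normMeasure (hD : MeasurableSet D) : ∀ᵐ x ∂(normMeasure D w), x ∈ D := by
  rw [normMeasure]
  refine Measure.ae_smul_measure ?_ _
  rw [ae_iff]
  change volume.withDensity _ Dᶜ = 0
  rw [withDensity_apply _ hD.compl]
  refine (setLIntegral_congr_fun (g := 0) hD.compl fun x hx => ?_).trans (by simp)
  simp only [Set.indicator_of_notMem hx, ENNReal.ofReal_zero, Pi.zero_apply]

end Normalized

/-- The orbital beta process, as a measure on arrays of the expected shape. -/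
def corners (θ : ℝ) {M : ℕ} (b : Fin (M + 1) → ℝ) : Measure (Tri M) :=
  normMeasure (cornersDom b) (cornersWt θ b)

section Split

variable {M : ℕ} {D : Set (Tri (M + 1))} {E : Set (Fin (M + 1) → ℝ)}

lemma measurableSet_of_split (hE : MeasurableSet E)
    (hD : ∀ y x, triSnoc y x ∈ D ↔ y ∈ E ∧ x ∈ cornersDom y) :
    MeasurableSet ((triEquiv M) ⁻¹' D) := by
  have : (triEquiv M) ⁻¹' D = {p | p.1 ∈ E} ∩ {p | p.2 ∈ cornersDom p.1} :=
    Set.ext fun p => hD p.1 p.2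
  rw [this]
  exact (measurable_fst hE).inter (isOpen_cornersDom M).measurableSet

lemma lintegral_split (hE : MeasurableSet E)
    (hD : ∀ y x, triSnoc y x ∈ D ↔ y ∈ E ∧ x ∈ cornersDom y) {F : Tri (M + 1) → ℝ≥0∞}
    (hF : Measurable F) :
    ∫⁻ x in D, F x = ∫⁻ y in E, ∫⁻ x in cornersDom y, F (triSnoc y x) := by
  rw [← (measurePreserving_triEquiv M).setLIntegral_comp_preimage_emb
    (triEquiv M).measurableEmbedding]
  refine (lintegral_sections (measurableSet_of_split hE hD) hE (fun p hp => ((hD _ _).mp hp).1)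
    (hF.comp (triEquiv M).measurable)).trans (setLIntegral_congr_fun hE fun y hy => ?_)
  have : {x | (y, x) ∈ (triEquiv M) ⁻¹' D} = cornersDom y :=
    Set.ext fun x => (hD y x).trans (and_iff_right hy)
  simp only [this]
  rfl

lemma integral_split (hE : MeasurableSet E)
    (hD : ∀ y x, triSnoc y x ∈ D ↔ y ∈ E ∧ x ∈ cornersDom y) {F : Tri (M + 1) → ℝ}
    (hF : IntegrableOn F D) :
    ∫ x in D, F x = ∫ y in E, ∫ x in cornersDom y, F (triSnoc y x) := by
  rw [← (measurePreserving_triEquiv M).setIntegral_preimage_emb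
    (triEquiv M).measurableEmbedding]
  refine (integral_sections (f := F ∘ triEquiv M) (measurableSet_of_split hE hD) hE
    (fun p hp => ((hD _ _).mp hp).1)
    (((measurePreserving_triEquiv M).integrableOn_comp_preimage
      (triEquiv M).measurableEmbedding).mpr hF)).trans
    (setIntegral_congr_fun hE fun y hy => ?_)
  have : {x | (y, x) ∈ (triEquiv M) ⁻¹' D} = cornersDom y :=
    Set.ext fun x => (hD y x).trans (and_iff_right hy)
  simp only [this]
  rfl

end Split

/-- The normalization constant of the orbital beta process. -/
def cornersZ (θ : ℝ) : ℕ → ℝ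
  | 0 => 1
  | M + 1 => cornersZ θ M * topConst (M + 1) θ

lemma cornersZ_pos {θ : ℝ} (hθ : 0 < θ) (M : ℕ) : 0 < cornersZ θ M := by
  induction M with
  | zero => exact one_pos
  | succ M ih => exact mul_pos ih (topConst_pos _ hθ)

lemma vdm_crossWt_eq_daWt {n : ℕ} {y : Fin n → ℝ} {b : Fin (n + 1) → ℝ} (h : Interlaces y b)
    (θ : ℝ) :
    vdm y ^ (2 - 2 * θ) * crossWt θ y b * vdm y ^ (2 * θ - 1) =
      vdm b ^ (2 * θ - 2) * daWt b (fun _ => θ) y := by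
  have hy := vdm_pos h.strictAnti_left.injective
  have hb := vdm_pos h.strictAnti_right.injective
  have e1 : vdm y ^ (2 - 2 * θ) * vdm y ^ (2 * θ - 1) = vdm y := by
    rw [← Real.rpow_add hy]
    ring_nf
    exact Real.rpow_one _
  have e2 : vdm b ^ (2 * θ - 2) * vdm b ^ (2 - 2 * θ) = 1 := by
    rw [← Real.rpow_add hb]
    ring_nf
    exact Real.rpow_zero _
  rw [daWt_const h]
  linear_combination crossWt θ y b * e1 - vdm y * crossWt θ y b * e2

lemma vdm_rpow_mul_daZ {n : ℕ} {b : Fin (n + 1) → ℝ} (hb : StrictAnti b) (θ : ℝ) :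
    vdm b ^ (2 * θ - 2) * daZ b (fun _ => θ) = topConst n θ * vdm b ^ (2 * θ - 1) := by
  have hv := vdm_pos hb.injective
  have e1 : vdm b ^ (2 * θ - 2) * vdm b = vdm b ^ (2 * θ - 1) := by
    rw [← Real.rpow_add_one hv.ne']
    ring_nf
  have e2 : vdm b ^ (2 * θ - 1) * vdm b = vdm b ^ (2 * θ) := by
    rw [← Real.rpow_add_one hv.ne']
    ring_nf
  have h := daZ_const hb θ
  rw [← e2] at h
  refine mul_right_cancel₀ hv.ne' ?_
  rw [topConst]
  linear_combination h + daZ b (fun _ => θ) * e1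

lemma measurable_cornersWt_right (θ : ℝ) {M : ℕ} (b : Fin (M + 1) → ℝ) :
    Measurable (cornersWt θ b) := by
  have h : Measurable fun x : Tri M => (b, x) := measurable_const.prodMk measurable_id
  have := (measurable_cornersWt θ M).comp h
  simpa only [Function.comp_def] using this

lemma lintegral_cornersWt {θ : ℝ} (hθ : 0 < θ) {M : ℕ} {b : Fin (M + 1) → ℝ}
    (hb : StrictAnti b) :
    ∫⁻ x in cornersDom b, ENNReal.ofReal (cornersWt θ b x) =
      ENNReal.ofReal (cornersZ θ M * vdm b ^ (2 * θ - 1)) := by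
  induction M with
  | zero =>
    have h1 : cornersDom b = Set.univ := Set.eq_univ_of_forall fun x k => k.elim0
    have h2 : ∀ x, cornersWt θ b x = 1 := fun x => rfl
    have h3 : vdm b = 1 := by
      refine Finset.prod_eq_one fun i _ => Finset.prod_eq_one fun j _ => if_neg (by omega)
    have h4 : (volume : Measure (Tri 0)) Set.univ = 1 := by
      rw [volume_pi, Measure.pi_univ, Finset.univ_eq_empty, Finset.prod_empty]
    simp [h1, h2, h3, h4, cornersZ]
  | succ M ih =>
    have hm : Measurable fun x => ENNReal.ofReal (cornersWt θ b x) :=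
      (measurable_cornersWt_right θ b).ennreal_ofReal
    rw [lintegral_split (measurableSet_interlaces b) (fun y x => triSnoc_mem_cornersDom) hm]
    have h : ∀ y ∈ {y | Interlaces y b},
        ∫⁻ x in cornersDom y, ENNReal.ofReal (cornersWt θ b (triSnoc y x)) =
          ENNReal.ofReal (cornersZ θ M * vdm b ^ (2 * θ - 2)) *
            ENNReal.ofReal (daWt b (fun _ => θ) y) := fun y hy => by
      have hn : 0 ≤ vdm y ^ (2 - 2 * θ) * crossWt θ y b :=
        mul_nonneg (Real.rpow_nonneg (vdm_nonneg _) _) (crossWt_nonneg _ _ _)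
      simp only [cornersWt_triSnoc, ENNReal.ofReal_mul (cornersWt_nonneg θ y _)]
      rw [lintegral_mul_const _ (measurable_cornersWt_right θ y).ennreal_ofReal, ih hy.strictAnti_left, ← ENNReal.ofReal_mul
        (mul_nonneg (cornersZ_pos hθ M).le (Real.rpow_nonneg (vdm_nonneg _) _)),
        ← ENNReal.ofReal_mul (mul_nonneg (cornersZ_pos hθ M).le
          (Real.rpow_nonneg (vdm_nonneg _) _))]
      congr 1
      linear_combination cornersZ θ M * vdm_crossWt_eq_daWt hy θ
    rw [setLIntegral_congr_fun (measurableSet_interlaces b) h, lintegral_const_mul _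
      (measurable_daWt _ _).ennreal_ofReal, lintegral_daWt hb fun _ => hθ,
      ← ENNReal.ofReal_mul (mul_nonneg (cornersZ_pos hθ M).le (Real.rpow_nonneg (vdm_nonneg _) _))]
    congr 1
    rw [cornersZ]
    refine Eq.trans ?_ (congrArg (cornersZ θ M * ·) (vdm_rpow_mul_daZ hb θ)) |>.trans ?_
    · rw [mul_assoc]
      rfl
    · rw [mul_assoc]

lemma integrableOn_cornersWt {θ : ℝ} (hθ : 0 < θ) {M : ℕ} {b : Fin (M + 1) → ℝ}
    (hb : StrictAnti b) : IntegrableOn (cornersWt θ b) (cornersDom b) := by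
  refine ⟨(measurable_cornersWt_right θ b).aestronglyMeasurable, ?_⟩
  rw [hasFiniteIntegral_iff_ofReal (.of_forall fun x => cornersWt_nonneg θ b x),
    lintegral_cornersWt hθ hb]
  exact ENNReal.ofReal_lt_top

lemma integral_cornersWt {θ : ℝ} (hθ : 0 < θ) {M : ℕ} {b : Fin (M + 1) → ℝ}
    (hb : StrictAnti b) :
    ∫ x in cornersDom b, cornersWt θ b x = cornersZ θ M * vdm b ^ (2 * θ - 1) := by
  rw [integral_eq_lintegral_of_nonneg_ae (.of_forall fun x => cornersWt_nonneg θ b x)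
    (measurable_cornersWt_right θ b).aestronglyMeasurable, lintegral_cornersWt hθ hb,
    ENNReal.toReal_ofReal (mul_nonneg (cornersZ_pos hθ M).le (Real.rpow_nonneg (vdm_nonneg _) _))]

lemma integral_cornersWt_pos {θ : ℝ} (hθ : 0 < θ) {M : ℕ} {b : Fin (M + 1) → ℝ}
    (hb : StrictAnti b) : 0 < ∫ x in cornersDom b, cornersWt θ b x := by
  rw [integral_cornersWt hθ hb]
  exact mul_pos (cornersZ_pos hθ M) (Real.rpow_pos_of_pos (vdm_pos hb.injective) _)

lemma isProbabilityMeasure_corners {θ : ℝ} (hθ : 0 < θ) {M : ℕ} {b : Fin (M + 1) → ℝ}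
    (hb : StrictAnti b) : IsProbabilityMeasure (corners θ b) :=
  isProbabilityMeasure_normMeasure (measurableSet_cornersDom b)
    (fun x _ => cornersWt_nonneg θ b x) (integrableOn_cornersWt hθ hb) (integral_cornersWt_pos hθ hb)

/-- Disintegration of a corner measure along its top level. -/
lemma integral_top_level {θ : ℝ} (hθ : 0 < θ) {M : ℕ} {D : Set (Tri (M + 1))}
    {E : Set (Fin (M + 1) → ℝ)} (hE : MeasurableSet E) (hE' : ∀ y ∈ E, StrictAnti y)
    (hD : ∀ y x, triSnoc y x ∈ D ↔ y ∈ E ∧ x ∈ cornersDom y)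
    {W : Tri (M + 1) → ℝ} (hWm : Measurable W) {V : (Fin (M + 1) → ℝ) → ℝ} (hV : ∀ y ∈ E, 0 ≤ V y)
    (hW : ∀ y ∈ E, ∀ x, W (triSnoc y x) = cornersWt θ y x * V y)
    {Φ : Tri (M + 1) → ℝ} (hΦm : Measurable Φ) {G : (Fin (M + 1) → ℝ) → ℝ}
    (hΦ : ∀ y ∈ E, ∀ x ∈ cornersDom y, |Φ (triSnoc y x)| ≤ G y)
    (hG : IntegrableOn (fun y => G y * (V y * vdm y ^ (2 * θ - 1))) E) :
    IntegrableOn (fun x => Φ x * W x) D ∧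
      ∫ x in D, Φ x * W x = cornersZ θ M *
        ∫ y in E, (∫ x, Φ (triSnoc y x) ∂(corners θ y)) * (V y * vdm y ^ (2 * θ - 1)) := by
  have hZ := cornersZ_pos hθ M
  have hInt : IntegrableOn (fun x => Φ x * W x) D := by
    refine ⟨(hΦm.mul hWm).aestronglyMeasurable, ?_⟩
    rw [hasFiniteIntegral_iff_norm, lintegral_split hE hD (by fun_prop)]
    refine lt_of_le_of_lt ?_ (hG.const_mul (cornersZ θ M)).lintegral_lt_top
    refine setLIntegral_mono' hE fun y hy => ?_
    calc ∫⁻ x in cornersDom y, ENNReal.ofReal ‖Φ (triSnoc y x) * W (triSnoc y x)‖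
        ≤ ∫⁻ x in cornersDom y, ENNReal.ofReal (cornersWt θ y x) * ENNReal.ofReal (G y * V y) := by
          refine setLIntegral_mono' (measurableSet_cornersDom y) fun x hx => ?_
          rw [← ENNReal.ofReal_mul (cornersWt_nonneg θ y x)]
          refine ENNReal.ofReal_le_ofReal ?_
          rw [hW y hy, norm_mul, Real.norm_eq_abs, Real.norm_eq_abs, abs_mul,
            abs_of_nonneg (cornersWt_nonneg θ y x), abs_of_nonneg (hV y hy), mul_left_comm]
          exact mul_le_mul_of_nonneg_left (mul_le_mul_of_nonneg_right (hΦ y hy x hx) (hV y hy))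
            (cornersWt_nonneg θ y x)
      _ = _ := by
          rw [lintegral_mul_const _ (measurable_cornersWt_right θ y).ennreal_ofReal,
            lintegral_cornersWt hθ (hE' y hy), ← ENNReal.ofReal_mul
              (mul_nonneg hZ.le (Real.rpow_nonneg (vdm_nonneg _) _))]
          congr 1
          ring
  refine ⟨hInt, ?_⟩
  rw [integral_split hE hD hInt, ← integral_const_mul]
  refine setIntegral_congr_fun hE fun y hy => ?_
  simp only [hW y hy]
  rw [corners, integral_normMeasure (measurableSet_cornersDom y)
    (measurable_cornersWt_right θ y) fun x _ => cornersWt_nonneg θ y x,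
    integral_cornersWt hθ (hE' y hy)]
  simp only [← mul_assoc]
  rw [integral_mul_const]
  have := (Real.rpow_pos_of_pos (vdm_pos (hE' y hy).injective) (2 * θ - 1)).ne'
  field_simp

lemma Continuous.exists_bound_closedBall {E : Type*} [PseudoMetricSpace E] [ProperSpace E]
    {Φ : E → ℝ} (hΦ : Continuous Φ) (z : E) (R : ℝ) :
    ∃ C, ∀ x ∈ Metric.closedBall z R, |Φ x| ≤ C :=
  (isCompact_closedBall z R).exists_bound_of_continuousOn hΦ.continuousOn

lemma integral_corners_succ {θ : ℝ} (hθ : 0 < θ) {M : ℕ} {b : Fin (M + 2) → ℝ} (hb : StrictAnti b)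
    {Φ : Tri (M + 1) → ℝ} (hΦ : Continuous Φ) :
    ∫ x, Φ x ∂(corners θ b) =
      (∫ y in {y | Interlaces y b}, (∫ x, Φ (triSnoc y x) ∂(corners θ y)) *
        daWt b (fun _ => θ) y) / daZ b (fun _ => θ) := by
  obtain ⟨C, hC⟩ := hΦ.exists_bound_closedBall 0 ‖b‖
  have hv := vdm_pos hb.injective
  have hE := measurableSet_interlaces b
  have hV : ∀ y ∈ {y | Interlaces y b},
      (vdm y ^ (2 - 2 * θ) * crossWt θ y b) * vdm y ^ (2 * θ - 1) =
        vdm b ^ (2 * θ - 2) * daWt b (fun _ => θ) y := fun y hy => vdm_crossWt_eq_daWt hy θ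
  have key := integral_top_level hθ hE (fun y hy => hy.strictAnti_left)
    (fun y x => triSnoc_mem_cornersDom) (measurable_cornersWt_right θ b)
    (V := fun y => vdm y ^ (2 - 2 * θ) * crossWt θ y b)
    (fun y _ => mul_nonneg (Real.rpow_nonneg (vdm_nonneg _) _) (crossWt_nonneg _ _ _))
    (fun y _ x => cornersWt_triSnoc θ b y x) hΦ.measurable (G := fun _ => C)
    (fun y hy x hx => hC _ (mem_closedBall_zero_iff.mpr
      (norm_le_of_mem_cornersDom (triSnoc_mem_cornersDom.mpr ⟨hy, hx⟩))))
    (IntegrableOn.congr_fun ((integrableOn_daWt hb fun _ => hθ).const_mul (C * vdm b ^ (2 * θ - 2)))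
      (fun y hy => by
        rw [hV y hy]
        ring) hE)
  rw [corners, integral_normMeasure (measurableSet_cornersDom b) (measurable_cornersWt_right θ b)
    fun x _ => cornersWt_nonneg θ b x, key.2, integral_cornersWt hθ hb,
    setIntegral_congr_fun (g := fun y => vdm b ^ (2 * θ - 2) *
      ((∫ x, Φ (triSnoc y x) ∂(corners θ y)) * daWt b (fun _ => θ) y)) hE (fun y hy => by
        dsimp only
        rw [hV y hy]
        ring), integral_const_mul, cornersZ, mul_assoc (cornersZ θ M), ← vdm_rpow_mul_daZ hb,
    mul_div_mul_left _ _ (cornersZ_pos hθ M).ne',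
    mul_div_mul_left _ _ (Real.rpow_pos_of_pos hv _).ne']

lemma triSnoc_eq_lvl {M : ℕ} (y : Fin (M + 1) → ℝ) (x : Tri M) {k : ℕ} (hk : k < M + 1) :
    triSnoc y x ⟨k, hk⟩ = lvl y x k hk := by
  unfold lvl
  by_cases h : k < M
  · rw [dif_pos (show k < M + 1 - 1 from h)]
    exact triSnoc_of_lt y x hk h
  · rw [dif_neg (show ¬ k < M + 1 - 1 from h)]
    obtain rfl : k = M := by omega
    exact triSnoc_last y x

lemma triSnoc_mem_triDomain {M : ℕ} {y : Fin (M + 1) → ℝ} {x : Tri M} :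
    triSnoc y x ∈ triDomain (M + 1) ↔ y ∈ {y : Fin (M + 1) → ℝ | StrictAnti y} ∧
      x ∈ cornersDom y := by
  have key : triSnoc y x ∈ triDomain (M + 1) ↔ x ∈ cornersDom y := by
    constructor
    · intro h k
      have := h k.castSucc (by have : k.1 < M := k.isLt; simp only [Fin.val_castSucc]; omega)
      rw [triSnoc_castSucc, triSnoc_eq_lvl] at this
      exact this
    · intro h k hk
      have := h ⟨k.1, by omega⟩
      rw [triSnoc_eq_lvl y x hk]
      rw [← triSnoc_of_lt y x k.isLt (by omega)] at this
      exact this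
  rw [key]
  exact ⟨fun h => ⟨strictAnti_of_mem_cornersDom h, h⟩, fun h => h.2⟩

lemma gbcWt_triSnoc (θ : ℝ) {M : ℕ} (hm : 1 ≤ M + 1) {y : Fin (M + 1) → ℝ} (hy : StrictAnti y)
    (x : Tri M) :
    gbcWt θ hm (triSnoc y x) =
      cornersWt θ y x * (vdm y * Real.exp (-(θ / 2) * ∑ i, y i ^ 2)) := by
  have ht : topLvl hm (triSnoc y x) = y := by
    funext i
    exact congrFun (triSnoc_last y x) i
  have hv : (∏ i : Fin (M + 1), ∏ j : Fin (M + 1), if i < j then y i - y j else 1) = vdm y := by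
    refine Finset.prod_congr rfl fun i _ => Finset.prod_congr rfl fun j _ => ?_
    split_ifs with h
    · rw [abs_of_pos (sub_pos.mpr (hy h))]
    · rfl
  unfold gbcWt cornersWt obpWt
  rw [ht, hv, mul_comm]
  congr 1
  refine Finset.prod_congr rfl fun k _ => ?_
  have hk : k.1 < M := k.isLt
  have h1 := triSnoc_of_lt y x (k := k.1) (by omega) hk
  have h2 := triSnoc_eq_lvl y x (k := k.1 + 1) (by omega)
  rw [h1, h2]
  exact congrArg _ (crossWt_comm θ _ _)

lemma volume_setOf_eq {m : ℕ} {k l : Fin m} (hkl : k ≠ l) (i : Fin (k.1 + 1)) (j : Fin (l.1 + 1)) :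
    volume {x : Tri m | x k i = x l j} = 0 := by
  let φ : Tri m →ₗ[ℝ] ℝ :=
    { toFun := fun x => x k i - x l j
      map_add' := fun x y => by simp only [Pi.add_apply]; ring
      map_smul' := fun r x => by
        simp only [Pi.smul_apply, smul_eq_mul, RingHom.id_apply]
        ring }
  have hφ : {x : Tri m | x k i = x l j} = (LinearMap.ker φ : Set (Tri m)) := by
    ext x
    simp [φ, sub_eq_zero]
  rw [hφ]
  refine Measure.addHaar_submodule _ _ fun h => ?_
  have h1 : φ (Pi.single k fun _ => 1) = 0 := LinearMap.mem_ker.mp (h ▸ Submodule.mem_top)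
  simp [φ, Pi.single_eq_of_ne hkl.symm] at h1

lemma gtPoly_ae_eq_triDomain (m : ℕ) : gtPoly m =ᵐ[volume] triDomain m := by
  have h : ∀ᵐ x : Tri m, ∀ k l : Fin m, k ≠ l → ∀ (i : Fin (k.1 + 1)) (j : Fin (l.1 + 1)),
      x k i ≠ x l j := by
    simp only [ae_all_iff]
    intro k l hkl i j
    rw [ae_iff]
    simpa only [ne_eq, not_not] using volume_setOf_eq hkl i j
  filter_upwards [h] with x hx
  refine propext ⟨fun hg k hk i => ?_, fun ht k hk i => ?_⟩
  · have hne : k ≠ ⟨k.1 + 1, hk⟩ := fun h => by simpa using congrArg Fin.val h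
    exact ⟨(hg k hk i).1.lt_of_ne (hx _ _ hne _ _), (hg k hk i).2.lt_of_ne (hx _ _ hne.symm _ _)⟩
  · exact ⟨(ht k hk i).1.le, (ht k hk i).2.le⟩

lemma gbc_eq_normMeasure (θ : ℝ) {m : ℕ} (hm : 1 ≤ m) :
    gbc θ hm = normMeasure (triDomain m) (gbcWt θ hm) := by
  have h := gtPoly_ae_eq_triDomain m
  rw [gbc, normMeasure, setIntegral_congr_set h]
  congr 1
  refine withDensity_congr_ae ?_
  filter_upwards [indicator_ae_eq_of_ae_eq_set (f := gbcWt θ hm) h] with x hx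
  rw [hx]

lemma measurable_gbcWt (θ : ℝ) {m : ℕ} (hm : 1 ≤ m) : Measurable (gbcWt θ hm) := by
  have hx : ∀ (k : Fin m) (i : Fin (k.1 + 1)), Measurable fun x : Tri m => x k i := fun k i =>
    (measurable_pi_apply i).comp (measurable_pi_apply k)
  have ht : ∀ i, Measurable fun x : Tri m => topLvl hm x i := fun i => hx _ _
  unfold gbcWt
  refine Measurable.mul (Measurable.mul (Finset.measurable_prod _ fun i _ =>
    Finset.measurable_prod _ fun j _ => ?_) ?_) (Finset.measurable_prod _ fun k _ =>
      Measurable.mul (Finset.measurable_prod _ fun i _ => Finset.measurable_prod _ fun j _ => ?_)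
        (Finset.measurable_prod _ fun i _ => Finset.measurable_prod _ fun j _ => ?_))
  · split_ifs
    · exact (ht i).sub (ht j)
    · exact measurable_const
  · exact ((Finset.measurable_sum _ fun i _ => (ht i).pow_const 2).const_mul _).exp
  · split_ifs
    · exact (((hx ⟨k.1, by omega⟩ i).sub (hx ⟨k.1, by omega⟩ j)).abs).pow_const _
    · exact measurable_const
  · exact (((hx ⟨k.1, by omega⟩ i).sub (hx ⟨k.1 + 1, by omega⟩ j)).abs).pow_const _

lemma gbcWt_nonneg (θ : ℝ) {M : ℕ} (hm : 1 ≤ M + 1) :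
    ∀ x ∈ triDomain (M + 1), 0 ≤ gbcWt θ hm x := by
  intro x hx
  obtain ⟨⟨y, x⟩, rfl⟩ := (triEquiv M).surjective x
  change triSnoc y x ∈ _ at hx
  change 0 ≤ gbcWt θ hm (triSnoc y x)
  rw [gbcWt_triSnoc θ hm (triSnoc_mem_triDomain.mp hx).1]
  exact mul_nonneg (cornersWt_nonneg _ _ _) (mul_nonneg (vdm_nonneg _) (Real.exp_nonneg _))

lemma measurableSet_triDomain (m : ℕ) : MeasurableSet (triDomain m) := by
  have : triDomain m = ⋂ (k : Fin m) (hk : k.1 + 1 < m), {x | Interlaces (x k) (x ⟨k.1 + 1, hk⟩)} := by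
    ext x
    simp only [Set.mem_iInter]
    rfl
  rw [this]
  exact MeasurableSet.iInter fun k => MeasurableSet.iInter fun hk =>
    (isOpen_setOf_interlaces (continuous_apply _) (continuous_apply _)).measurableSet

lemma integrableOn_mul_gbcWt {θ : ℝ} (hθ : 0 < θ) {M : ℕ} (hm : 1 ≤ M + 1)
    {Φ : Tri (M + 1) → ℝ} (hΦm : Measurable Φ) {G : (Fin (M + 1) → ℝ) → ℝ} (hG : ExpBdd G)
    (hGm : Measurable G)
    (hΦ : ∀ y, StrictAnti y → ∀ x ∈ cornersDom y, |Φ (triSnoc y x)| ≤ G y) :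
    IntegrableOn (fun x => Φ x * gbcWt θ hm x) (triDomain (M + 1)) ∧
      ∫ x in triDomain (M + 1), Φ x * gbcWt θ hm x = cornersZ θ M *
        ∫ y in {y : Fin (M + 1) → ℝ | StrictAnti y},
          (∫ x, Φ (triSnoc y x) ∂(corners θ y)) * gaussWt θ y := by
  have hE := (isOpen_setOf_strictAnti (n := M + 1)).measurableSet
  have hV : ∀ y ∈ {y : Fin (M + 1) → ℝ | StrictAnti y},
      (vdm y * Real.exp (-(θ / 2) * ∑ i, y i ^ 2)) * vdm y ^ (2 * θ - 1) = gaussWt θ y :=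
    fun y hy => by
      rw [gaussWt, mul_right_comm, ← Real.rpow_one_add' (vdm_nonneg _) (by linarith)]
      ring_nf
  have key := integral_top_level hθ hE (fun y hy => hy) (fun y x => triSnoc_mem_triDomain)
    (measurable_gbcWt θ hm) (V := fun y => vdm y * Real.exp (-(θ / 2) * ∑ i, y i ^ 2))
    (fun y _ => mul_nonneg (vdm_nonneg _) (Real.exp_nonneg _))
    (fun y hy x => gbcWt_triSnoc θ hm hy x) hΦm (G := G) hΦ
    ((hG.integrable_gaussWt hθ hGm).integrableOn.congr_fun
      (fun y hy => by dsimp only; rw [hV y hy]) hE)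
  refine ⟨key.1, key.2.trans (congrArg _ (setIntegral_congr_fun hE fun y hy => ?_))⟩
  rw [hV y hy]

lemma integral_gbcWt {θ : ℝ} (hθ : 0 < θ) {M : ℕ} (hm : 1 ≤ M + 1) :
    IntegrableOn (gbcWt θ hm) (triDomain (M + 1)) ∧
    ∫ x in triDomain (M + 1), gbcWt θ hm x = cornersZ θ M *
        ∫ y in {y : Fin (M + 1) → ℝ | StrictAnti y}, gaussWt θ y := by
  have h := integrableOn_mul_gbcWt hθ hm (Φ := fun _ => 1) measurable_const (ExpBdd.const 1)
    measurable_const fun y _ x _ => abs_one.le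
  simp only [one_mul] at h
  refine ⟨h.1, h.2.trans (congrArg _ (setIntegral_congr_fun
    isOpen_setOf_strictAnti.measurableSet fun y hy => ?_))⟩
  have := isProbabilityMeasure_corners hθ (M := M) hy
  simp

lemma integral_gbcWt_pos {θ : ℝ} (hθ : 0 < θ) {M : ℕ} (hm : 1 ≤ M + 1) :
    0 < ∫ x in triDomain (M + 1), gbcWt θ hm x := by
  rw [(integral_gbcWt hθ hm).2]
  exact mul_pos (cornersZ_pos hθ M) (integral_gaussWt_pos hθ _)

lemma isProbabilityMeasure_gbc {θ : ℝ} (hθ : 0 < θ) {M : ℕ} (hm : 1 ≤ M + 1) :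
    IsProbabilityMeasure (gbc θ hm) := by
  rw [gbc_eq_normMeasure]
  exact isProbabilityMeasure_normMeasure (measurableSet_triDomain _) (gbcWt_nonneg θ hm)
    (integral_gbcWt hθ hm).1 (integral_gbcWt_pos hθ hm)

lemma ae_gbc (θ : ℝ) {m : ℕ} (hm : 1 ≤ m) : ∀ᵐ x ∂(gbc θ hm), x ∈ triDomain m := by
  rw [gbc_eq_normMeasure]
  exact ae_mem_normMeasure (measurableSet_triDomain _)

lemma integral_gbc {θ : ℝ} (hθ : 0 < θ) {M : ℕ} (hm : 1 ≤ M + 1)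
    {Φ : Tri (M + 1) → ℝ} (hΦm : Measurable Φ) {G : (Fin (M + 1) → ℝ) → ℝ} (hG : ExpBdd G)
    (hGm : Measurable G)
    (hΦ : ∀ y, StrictAnti y → ∀ x ∈ cornersDom y, |Φ (triSnoc y x)| ≤ G y) :
    Integrable Φ (gbc θ hm) ∧
      ∫ x, Φ x ∂(gbc θ hm) = gaussMean θ fun y => ∫ x, Φ (triSnoc y x) ∂(corners θ y) := by
  have h := integrableOn_mul_gbcWt hθ hm hΦm hG hGm hΦ
  rw [gbc_eq_normMeasure]
  refine ⟨integrable_normMeasure (measurableSet_triDomain _) (measurable_gbcWt θ hm)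
    (gbcWt_nonneg θ hm) (integral_gbcWt_pos hθ hm) h.1, ?_⟩
  rw [integral_normMeasure (measurableSet_triDomain _) (measurable_gbcWt θ hm)
    (gbcWt_nonneg θ hm), h.2, (integral_gbcWt hθ hm).2,
    mul_div_mul_left _ _ (cornersZ_pos hθ M).ne', gaussMean]

lemma integral_corners_step {θ : ℝ} (hθ : 0 < θ) {d : ℕ}
    {T : ℝ → (Nat.Partition d → ℝ) →L[ℝ] (Nat.Partition d → ℝ)} (hT : IsDAStep θ T) {M : ℕ}
    {Φ : Tri (M + 1) → ℝ} (hΦ : Continuous Φ) {c σ : ℝ} (hσ : σ ≠ 0) {v : Nat.Partition d → ℝ}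
    (h : ∀ y : Fin (M + 1) → ℝ, StrictAnti y →
      ∫ x, Φ (triSnoc y x) ∂(corners θ y) = pEval v (affPS c σ y))
    {b : Fin (M + 2) → ℝ} (hb : StrictAnti b) :
    ∫ x, Φ x ∂(corners θ b) = pEval (T ((M + 2 : ℕ) : ℝ) v) (affPS c σ b) := by
  have hZ := daZ_pos hb (s := fun _ => θ) fun _ => hθ
  have key := (hT (M + 1) b (fun _ => θ) c σ ((M + 2 : ℕ) : ℝ) 0 (affPS c σ b) hσ hb
    (fun _ => hθ) (by rw [Finset.sum_const, Finset.card_univ, Fintype.card_fin, nsmul_eq_mul,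
      mul_comm]) (fun l _ => by rw [affPS, Finset.mul_sum])
    (fun l _ => by simp) v).2
  simp only [Pi.zero_apply, zero_add] at key
  rw [integral_corners_succ hθ hb hΦ, setIntegral_congr_fun
    (g := fun y => pEval v (affPS c σ y) * daWt b (fun _ => θ) y) (measurableSet_interlaces b)
    (fun y hy => by rw [h y hy.strictAnti_left]), key, mul_div_cancel_left₀ _ hZ.ne']

/-- The product over the levels of `x` of the functions `f k`, evaluated at the power sums of the
affinely rescaled levels. -/
def levelProd (f : ℕ → (ℕ → ℝ) → ℝ) (c σ : ℝ) {M : ℕ} (x : Tri M) : ℝ :=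
  ∏ k : Fin M, f k (affPS c σ (x k))

lemma levelProd_triSnoc (f : ℕ → (ℕ → ℝ) → ℝ) (c σ : ℝ) {M : ℕ} (y : Fin (M + 1) → ℝ) (x : Tri M) :
    levelProd f c σ (triSnoc y x) = levelProd f c σ x * f M (affPS c σ y) := by
  rw [levelProd, Fin.prod_univ_castSucc, triSnoc_last]
  simp only [triSnoc_castSucc]
  rfl

lemma continuous_of_mem_polySpace {X : Type*} [TopologicalSpace X] {d : ℕ} {f : (ℕ → ℝ) → ℝ}
    (hf : f ∈ polySpace d) {p : X → ℕ → ℝ} (hp : ∀ l, Continuous fun x => p x l) :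
    Continuous fun x => f (p x) := by
  obtain ⟨c, hc⟩ := exists_pEval hf
  simp only [hc]
  exact continuous_pEval c hp

lemma continuous_levelProd {f : ℕ → (ℕ → ℝ) → ℝ} {d : ℕ → ℕ} (hf : ∀ k, f k ∈ polySpace (d k))
    (c σ : ℝ) (M : ℕ) : Continuous (levelProd f c σ : Tri M → ℝ) :=
  continuous_finsetProd _ fun k _ => continuous_of_mem_polySpace (hf k) fun l =>
    (continuous_affPS c σ l).comp (continuous_apply k)

lemma exists_integral_levelProd {θ : ℝ} (hθ : 0 < θ) {f : ℕ → (ℕ → ℝ) → ℝ} {d : ℕ → ℕ}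
    (hf : ∀ k, f k ∈ polySpace (d k)) (M : ℕ) :
    ∃ v : Nat.Partition (∑ k ∈ Finset.range (M + 1), d k) → ℝ, ∀ c σ : ℝ, σ ≠ 0 →
      ∀ y : Fin (M + 1) → ℝ, StrictAnti y →
        ∫ x, levelProd f c σ (triSnoc y x) ∂(corners θ y) = pEval v (affPS c σ y) := by
  have hstep : ∀ M, (∃ h ∈ polySpace (∑ k ∈ Finset.range M, d k), ∀ c σ : ℝ, σ ≠ 0 →
      ∀ y : Fin (M + 1) → ℝ, StrictAnti y →
        ∫ x, levelProd f c σ x ∂(corners θ y) = h (affPS c σ y)) →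
      ∃ v : Nat.Partition (∑ k ∈ Finset.range (M + 1), d k) → ℝ, ∀ c σ : ℝ, σ ≠ 0 →
      ∀ y : Fin (M + 1) → ℝ, StrictAnti y →
        ∫ x, levelProd f c σ (triSnoc y x) ∂(corners θ y) = pEval v (affPS c σ y) := by
    rintro M ⟨h, hh, hI⟩
    rw [Finset.sum_range_succ]
    obtain ⟨v, hv⟩ := exists_pEval (mul_mem_polySpace hh (hf M))
    refine ⟨v, fun c σ hσ y hy => ?_⟩
    simp only [levelProd_triSnoc]
    rw [integral_mul_const, hI c σ hσ y hy, ← hv, Pi.mul_apply]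
  refine hstep M ?_
  induction M with
  | zero =>
    refine ⟨1, one_mem_polySpace, fun c σ _ y hy => ?_⟩
    have := isProbabilityMeasure_corners hθ hy
    simp [levelProd]
  | succ M ih =>
    obtain ⟨v, hv⟩ := hstep M ih
    obtain ⟨T, hT, -⟩ := exists_isDAStep hθ (∑ k ∈ Finset.range (M + 1), d k)
    exact ⟨_, pEval_mem (T ((M + 2 : ℕ) : ℝ) v), fun c σ hσ y hy =>
      integral_corners_step hθ hT (continuous_levelProd hf c σ _) hσ (hv c σ hσ) hy⟩

/-- The bottom `m` levels of a triangular array. -/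
def triRestrict {m M : ℕ} (h : m ≤ M) (x : Tri M) : Tri m := fun k => x ⟨k.1, k.isLt.trans_le h⟩

lemma continuous_triRestrict {m M : ℕ} (h : m ≤ M) : Continuous (triRestrict h) :=
  continuous_pi fun _ => continuous_apply _

lemma integral_levelProd_triRestrict {θ : ℝ} (hθ : 0 < θ) {f : ℕ → (ℕ → ℝ) → ℝ} {d : ℕ → ℕ}
    (hf : ∀ k, f k ∈ polySpace (d k)) {e M : ℕ}
    {T : ℝ → (Nat.Partition e → ℝ) →L[ℝ] (Nat.Partition e → ℝ)} (hT : IsDAStep θ T) {c σ : ℝ}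
    (hσ : σ ≠ 0) {v : Nat.Partition e → ℝ}
    (h : ∀ y : Fin (M + 1) → ℝ, StrictAnti y →
      ∫ x, levelProd f c σ (triSnoc y x) ∂(corners θ y) = pEval v (affPS c σ y)) (n : ℕ) :
    ∀ b : Fin (M + 1 + n + 1) → ℝ, StrictAnti b →
      ∫ x, levelProd f c σ (triRestrict (Nat.le_add_right (M + 1) n) x) ∂(corners θ b) =
        pEval (coeffSeq T (M + 1) v (n + 1)) (affPS c σ b) := by
  induction n with
  | zero => exact fun b hb => integral_corners_step hθ hT (continuous_levelProd hf c σ _) hσ h hb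
  | succ n ih =>
    intro b hb
    refine integral_corners_step (M := M + 1 + n) hθ hT
      ((continuous_levelProd hf c σ _).comp (continuous_triRestrict _)) hσ (fun y hy => ?_) hb
    rw [← ih y hy]
    refine integral_congr_ae (Eventually.of_forall fun x => ?_)
    refine congrArg (levelProd f c σ) (funext fun k => ?_)
    exact triSnoc_of_lt y x (k := k.1) _ (by have := k.isLt; omega)

lemma norm_triSnoc_le {M : ℕ} {y : Fin (M + 1) → ℝ} {x : Tri M} (hx : x ∈ cornersDom y) :
    ‖triSnoc y x‖ ≤ ∑ i, |y i| := by
  have hy : ‖y‖ ≤ ∑ i, |y i| := by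
    refine (pi_norm_le_iff_of_nonneg (Finset.sum_nonneg fun i _ => abs_nonneg _)).mpr fun i => ?_
    exact Finset.single_le_sum (f := fun i => |y i|) (fun i _ => abs_nonneg _) (Finset.mem_univ i)
  refine le_trans ((pi_norm_le_iff_of_nonneg (norm_nonneg y)).mpr fun k => ?_) hy
  refine Fin.lastCases ?_ (fun k => ?_) k
  · rw [triSnoc_last]
  · rw [triSnoc_castSucc]
    exact (norm_le_pi_norm x k).trans (norm_le_of_mem_cornersDom hx)

lemma integral_gbc_of_exp_bound {θ : ℝ} (hθ : 0 < θ) {M : ℕ} (hm : 1 ≤ M + 1)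
    {Φ : Tri (M + 1) → ℝ} (hΦm : Measurable Φ) {C q : ℝ} (hC : 0 ≤ C) (hq : 0 ≤ q)
    (hΦ : ∀ x, |Φ x| ≤ C * Real.exp (q * ‖x‖)) :
    Integrable Φ (gbc θ hm) ∧
      ∫ x, Φ x ∂(gbc θ hm) = gaussMean θ fun y => ∫ x, Φ (triSnoc y x) ∂(corners θ y) := by
  refine integral_gbc hθ hm hΦm (G := fun y => C * Real.exp (q * ∑ i, |y i|))
    ⟨C, q, hC, hq, fun x => (abs_of_nonneg (by positivity)).le⟩ (by fun_prop) fun y hy x hx => ?_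
  refine (hΦ _).trans ?_
  gcongr
  exact norm_triSnoc_le hx

lemma exists_levelProd_bound {f : ℕ → (ℕ → ℝ) → ℝ} {d : ℕ → ℕ}
    (hf : ∀ k, f k ∈ polySpace (d k)) (M : ℕ) :
    ∃ C q : ℝ, 0 ≤ C ∧ 0 ≤ q ∧ ∀ x : Tri M, |levelProd f 0 1 x| ≤ C * Real.exp (q * ‖x‖) := by
  have h : ∀ k : Fin M, ExpBdd fun y : Fin (k.1 + 1) → ℝ => f k (affPS 0 1 y) := fun k => by
    obtain ⟨c, hc⟩ := exists_pEval (hf k)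
    simp only [hc]
    exact ExpBdd.pEval c
  choose C q hC hq hb using h
  refine ⟨∏ k, C k, ∑ k, q k * (k.1 + 1), Finset.prod_nonneg fun k _ => hC k,
    Finset.sum_nonneg fun k _ => mul_nonneg (hq k) (by positivity), fun x => ?_⟩
  rw [levelProd, Finset.abs_prod, Finset.sum_mul, Real.exp_sum, ← Finset.prod_mul_distrib]
  refine Finset.prod_le_prod (fun k _ => abs_nonneg _) fun k _ => (hb k _).trans ?_
  have hx : ∑ i, |x k i| ≤ (k.1 + 1) * ‖x‖ := by
    refine (Finset.sum_le_card_nsmul _ _ ‖x‖ fun i _ =>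
      (norm_le_pi_norm (x k) i).trans (norm_le_pi_norm x k)).trans ?_
    simp
  rw [mul_assoc]
  have := hC k
  have := hq k
  gcongr

lemma tendsto_integral_levelProd {θ : ℝ} (hθ : 0 < θ) {f : ℕ → (ℕ → ℝ) → ℝ} {d : ℕ → ℕ}
    (hf : ∀ k, f k ∈ polySpace (d k)) {M : ℕ} (hm : 1 ≤ M + 1)
    {b : ∀ n : ℕ, Fin (M + 1 + n + 1) → ℝ} (hb : ∀ n, StrictAnti (b n)) {c σ : ℕ → ℝ}
    (hσ : ∀ n, σ n ≠ 0)
    (h : ∀ l, 0 < l → Tendsto (fun n => affPS (c n) (σ n) (b n) l / ((M + 1 + n + 1 : ℕ) : ℝ) ^ l)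
      atTop (𝓝 (limPS l))) :
    Integrable (levelProd f 0 1) (gbc θ hm) ∧
    Tendsto (fun n => ∫ x, levelProd f (c n) (σ n)
        (triRestrict (Nat.le_add_right (M + 1) n) x) ∂(corners θ (b n))) atTop
      (𝓝 (∫ x, levelProd f 0 1 x ∂(gbc θ hm))) := by
  obtain ⟨v, hv⟩ := exists_integral_levelProd hθ hf M
  obtain ⟨T, hT, C, hTC⟩ := exists_isDAStep hθ (∑ k ∈ Finset.range (M + 1), d k)
  obtain ⟨z, hz, hzG⟩ := exists_tendsto_coeffSeq_gaussMean hθ hT hTC hm v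
  obtain ⟨A, q, hA, hq, hAq⟩ := exists_levelProd_bound hf (M + 1)
  obtain ⟨hI, hG⟩ := integral_gbc_of_exp_bound hθ hm (continuous_levelProd hf 0 1 _).measurable
    hA hq hAq
  refine ⟨hI, ?_⟩
  have hlim : ∫ x, levelProd f 0 1 x ∂(gbc θ hm) = pEval z limPS := by
    rw [hG, hzG, gaussMean, gaussMean, setIntegral_congr_fun
      isOpen_setOf_strictAnti.measurableSet fun y hy => by rw [hv 0 1 one_ne_zero y hy]]
  rw [hlim]
  have hz' : Tendsto (fun n : ℕ => ((M + 1 + n + 1 : ℕ) : ℝ) ^ (∑ k ∈ Finset.range (M + 1), d k) •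
      coeffSeq T (M + 1) v (n + 1)) atTop (𝓝 z) :=
    (hz.comp (tendsto_add_atTop_nat 1)).congr fun n => by
      rw [Function.comp_apply, ← add_assoc]
  refine (tendsto_pEval (N := fun n => ((M + 1 + n + 1 : ℕ) : ℝ))
    (fun n => Nat.cast_ne_zero.mpr (Nat.succ_ne_zero _)) hz' h).congr fun n => ?_
  exact (integral_levelProd_triRestrict hθ hf hT (hσ n) (hv (c n) (σ n) (hσ n)) n (b n)
    (hb n)).symm

lemma integral_empMeasure {N : ℕ} (a : Fin N → ℝ) (f : ℝ → ℝ) :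
    ∫ t, f t ∂(empMeasure a) = (N : ℝ)⁻¹ * ∑ i, f (a i / N) := by
  rw [empMeasure, integral_smul_measure, integral_finsetSum_measure fun i _ =>
    integrable_dirac (by simp)]
  simp

lemma RegularSeq.exists_bound {a : (N : ℕ) → Fin N → ℝ} {μ : Measure ℝ} (h : RegularSeq a μ) :
    ∃ C : ℝ, 0 ≤ C ∧ (∀ N (i : Fin N), |a N i / N| ≤ C) ∧ ∀ᵐ t ∂μ, |t| ≤ C := by
  obtain ⟨hanti, ⟨C, hC⟩, -, ⟨R, hR⟩, -⟩ := h
  refine ⟨max (max C R) 0, le_max_right _ _, fun N i => ?_, ?_⟩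
  · have hN : 1 ≤ N := by have := i.isLt; omega
    have hN' : (0 : ℝ) < N := by exact_mod_cast hN
    have h0 : a N i ≤ a N ⟨0, by omega⟩ := (hanti N hN).antitone (Fin.mk_le_mk.mpr (Nat.zero_le _))
    have h1 : a N ⟨N - 1, by omega⟩ ≤ a N i := (hanti N hN).antitone
      (Fin.le_def.mpr (by have := i.isLt; simp only; omega))
    obtain ⟨h2, h3⟩ := hC N hN
    rw [abs_div, Nat.abs_cast, div_le_iff₀ hN']
    refine le_trans (abs_le.mpr ⟨?_, ?_⟩) (mul_le_mul_of_nonneg_right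
      ((le_max_left C R).trans (le_max_left _ 0)) hN'.le)
    · linarith [(abs_le.mp h3).1]
    · linarith [(abs_le.mp h2).2]
  · have : ∀ᵐ t ∂μ, |t| ≤ R := hR
    filter_upwards [this] with t ht
    exact ht.trans ((le_max_right C R).trans (le_max_left _ 0))

lemma RegularSeq.tendsto_integral {a : (N : ℕ) → Fin N → ℝ} {μ : Measure ℝ} (h : RegularSeq a μ)
    {g : ℝ → ℝ} (hg : Continuous g) :
    Tendsto (fun N => ∫ t, g t ∂(empMeasure (a N))) atTop (𝓝 (∫ t, g t ∂μ)) := by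
  obtain ⟨C, hC0, hC, hμ⟩ := h.exists_bound
  have hcl : ∀ t, |t| ≤ C → max (-C) (min C t) = t := fun t ht => by
    rw [min_eq_right (abs_le.mp ht).2, max_eq_right (abs_le.mp ht).1]
  obtain ⟨B, hB⟩ := isCompact_Icc.exists_bound_of_continuousOn
    (s := Set.Icc (-C) C) hg.continuousOn
  let f : BoundedContinuousFunction ℝ ℝ := BoundedContinuousFunction.ofNormedAddCommGroup
    (fun t => g (max (-C) (min C t))) (hg.comp (by fun_prop)) B fun t =>
      hB _ ⟨le_max_left _ _, max_le (by linarith) (min_le_left _ _)⟩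
  have hf : ∀ t, |t| ≤ C → f t = g t := fun t ht => congrArg g (hcl t ht)
  have key := h.2.2.2.2 f
  rw [integral_congr_ae (hμ.mono hf)] at key
  refine key.congr fun N => ?_
  rw [integral_empMeasure, integral_empMeasure]
  exact congrArg _ (Finset.sum_congr rfl fun i _ => hf _ (hC N i))

lemma meanM_empMeasure {N : ℕ} (a : Fin N → ℝ) :
    meanM (empMeasure a) = (N : ℝ)⁻¹ * ∑ i, a i / N :=
  integral_empMeasure a fun t => t

lemma varM_empMeasure {N : ℕ} (hN : N ≠ 0) (a : Fin N → ℝ) :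
    varM (empMeasure a) = (N : ℝ)⁻¹ * ∑ i, (a i / N - meanM (empMeasure a)) ^ 2 := by
  have h0 : (N : ℝ) ≠ 0 := Nat.cast_ne_zero.mpr hN
  have h : ∑ i, a i / N = N * meanM (empMeasure a) := by
    rw [meanM_empMeasure, mul_inv_cancel_left₀ h0]
  have : ∀ i, (a i / N - meanM (empMeasure a)) ^ 2 = (a i / N) ^ 2 -
      2 * meanM (empMeasure a) * (a i / N) + meanM (empMeasure a) ^ 2 := fun i => by ring
  simp only [this, Finset.sum_add_distrib, Finset.sum_sub_distrib, ← Finset.mul_sum, h,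
    Finset.sum_const, Finset.card_univ, Fintype.card_fin, nsmul_eq_mul]
  rw [varM, integral_empMeasure]
  field_simp
  ring

lemma RegularSeq.tendsto_affPS {a : (N : ℕ) → Fin N → ℝ} {μ : Measure ℝ} (h : RegularSeq a μ)
    (hv : 0 < varM μ) {l : ℕ} (hl : 0 < l) :
    Tendsto (fun N : ℕ => affPS (N * meanM (empMeasure (a N))) √(N * varM μ) (a N) l / (N : ℝ) ^ l)
      atTop (𝓝 (limPS l)) := by
  have hform : ∀ N : ℕ, N ≠ 0 →
      affPS (N * meanM (empMeasure (a N))) √(N * varM μ) (a N) l / (N : ℝ) ^ l =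
        (∑ i, (a N i / N - meanM (empMeasure (a N))) ^ l) / √(N * varM μ) ^ l := fun N hN => by
    have h0 : (N : ℝ) ≠ 0 := Nat.cast_ne_zero.mpr hN
    rw [affPS, Finset.sum_div, Finset.sum_div]
    refine Finset.sum_congr rfl fun i _ => ?_
    rw [← div_pow, ← div_pow]
    congr 1
    field_simp
  refine Tendsto.congr' (EventuallyEq.symm ((eventually_ne_atTop 0).mono hform)) ?_
  rcases (by omega : l = 1 ∨ l = 2 ∨ 3 ≤ l) with rfl | rfl | hl3
  · refine Tendsto.congr' ((eventually_ne_atTop 0).mono fun N hN => ?_)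
      (tendsto_const_nhds (x := (0 : ℝ)))
    have h0 : (N : ℝ) ≠ 0 := Nat.cast_ne_zero.mpr hN
    simp only [pow_one, Finset.sum_sub_distrib, Finset.sum_const, Finset.card_univ,
      Fintype.card_fin, nsmul_eq_mul]
    rw [meanM_empMeasure, mul_inv_cancel_left₀ h0, sub_self, zero_div]
  · have h2 : Tendsto (fun N => varM (empMeasure (a N))) atTop (𝓝 (varM μ)) :=
      (h.tendsto_integral (continuous_pow 2)).sub ((h.tendsto_integral continuous_id).pow 2)
    have h3 := h2.div_const (varM μ)
    rw [div_self hv.ne'] at h3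
    refine Tendsto.congr' ((eventually_ne_atTop 0).mono fun N hN => ?_) h3
    dsimp only
    rw [varM_empMeasure hN, Real.sq_sqrt (by positivity)]
    have h0 : (N : ℝ) ≠ 0 := Nat.cast_ne_zero.mpr hN
    field_simp
  · obtain ⟨C, hC0, hC, -⟩ := h.exists_bound
    have hlim : limPS l = 0 := if_neg (by omega)
    rw [hlim]
    obtain ⟨k, rfl⟩ := Nat.exists_eq_add_of_le hl3
    have hsq : Tendsto (fun N : ℕ => √(N : ℝ)) atTop atTop :=
      Real.tendsto_sqrt_atTop.comp tendsto_natCast_atTop_atTop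
    have hdec : Tendsto (fun N : ℕ => (2 * C / √(varM μ)) ^ (3 + k) / √(N : ℝ) ^ (k + 1)) atTop
        (𝓝 0) := tendsto_const_nhds.div_atTop ((tendsto_pow_atTop (by omega)).comp hsq)
    refine squeeze_zero_norm' ((eventually_ne_atTop 0).mono fun N hN => ?_) hdec
    have h0 : (0 : ℝ) < N := Nat.cast_pos.mpr (Nat.pos_of_ne_zero hN)
    have hs : 0 < √(N : ℝ) := Real.sqrt_pos.mpr h0
    have hsv : 0 < √(varM μ) := Real.sqrt_pos.mpr hv
    have hmean : |meanM (empMeasure (a N))| ≤ C := by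
      rw [meanM_empMeasure, abs_mul, abs_of_pos (inv_pos.mpr h0), inv_mul_le_iff₀ h0]
      refine (Finset.abs_sum_le_sum_abs _ _).trans
        ((Finset.sum_le_card_nsmul _ _ C fun i _ => hC N i).trans ?_)
      simp
    have hsum : |∑ i, (a N i / N - meanM (empMeasure (a N))) ^ (3 + k)| ≤
        N * (2 * C) ^ (3 + k) := by
      refine (Finset.abs_sum_le_sum_abs _ _).trans
        ((Finset.sum_le_card_nsmul _ _ ((2 * C) ^ (3 + k)) fun i _ => ?_).trans ?_)
      · rw [abs_pow]
        refine pow_le_pow_left₀ (abs_nonneg _) ((abs_sub _ _).trans ?_) _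
        linarith [hC N i]
      · simp
    rw [Real.norm_eq_abs, abs_div, abs_of_nonneg (by positivity : 0 ≤ √(N * varM μ) ^ (3 + k)),
      Real.sqrt_mul h0.le, mul_pow, div_le_iff₀ (by positivity)]
    refine hsum.trans (le_of_eq ?_)
    rw [div_pow]
    nth_rewrite 1 [← Real.sq_sqrt h0.le]
    field_simp
    ring

lemma norm_exp_mul_sub_sum_le {ω : ℂ} (hω : ‖ω‖ = 1) (h : ∀ y : ℝ, ‖Complex.exp (ω * y)‖ ≤ 1)
    (M : ℕ) : ∀ y : ℝ, 0 ≤ y →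
      ‖Complex.exp (ω * y) - ∑ k ∈ Finset.range M, (ω * y) ^ k / k.factorial‖ ≤
        y ^ M / M.factorial := by
  induction M with
  | zero => intro y _; simpa using h y
  | succ M ih =>
    intro y hy
    have hd : ∀ y : ℝ, HasDerivAt (fun y : ℝ => Complex.exp (ω * y) -
        ∑ k ∈ Finset.range (M + 1), (ω * y) ^ k / k.factorial)
        (ω * (Complex.exp (ω * y) - ∑ k ∈ Finset.range M, (ω * y) ^ k / k.factorial)) y := by
      intro y
      have h0 : HasDerivAt (fun y : ℝ => ω * (y : ℂ)) ω y := by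
        simpa using (Complex.ofRealCLM.hasDerivAt (x := y)).const_mul ω
      have h1 : HasDerivAt (fun y : ℝ => ∑ k ∈ Finset.range (M + 1), (ω * y) ^ k / k.factorial)
          (∑ k ∈ Finset.range (M + 1), (k * (ω * y) ^ (k - 1) * ω) / k.factorial) y :=
        HasDerivAt.fun_sum fun k _ => (h0.pow k).div_const _
      refine (h0.cexp.sub h1).congr_deriv ?_
      rw [Finset.sum_range_succ', mul_sub, Finset.mul_sum]
      have h2 : ∀ k ∈ Finset.range M, (((k + 1 : ℕ) : ℂ) * (ω * y) ^ (k + 1 - 1) * ω) /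
          (k + 1).factorial = ω * ((ω * y) ^ k / k.factorial) := fun k _ => by
        have : (k.factorial : ℂ) ≠ 0 := Nat.cast_ne_zero.mpr k.factorial_ne_zero
        have : ((k : ℂ) + 1) ≠ 0 := by exact_mod_cast Nat.succ_ne_zero k
        rw [Nat.factorial_succ]
        push_cast
        field_simp
      rw [Finset.sum_congr rfl h2]
      simp [mul_comm]
    have hB : ∀ y : ℝ, HasDerivAt (fun y : ℝ => y ^ (M + 1) / (M + 1).factorial)
        (y ^ M / M.factorial) y := by
      intro y
      refine ((hasDerivAt_pow (M + 1) y).div_const ((M + 1).factorial : ℝ)).congr_deriv ?_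
      have : (M.factorial : ℝ) ≠ 0 := Nat.cast_ne_zero.mpr M.factorial_ne_zero
      rw [Nat.factorial_succ]
      push_cast
      field_simp
    refine image_norm_le_of_norm_deriv_right_le_deriv_boundary (a := 0) (b := y)
      (fun y _ => (hd y).continuousAt.continuousWithinAt)
      (fun y _ => (hd y).hasDerivWithinAt) ?_ hB (fun x hx => ?_) ⟨hy, le_rfl⟩
    · simp [Finset.sum_range_succ']
    · rw [norm_mul, hω, one_mul]
      exact ih x hx.1

lemma norm_exp_mul_I_sub_sum_le (M : ℕ) (y : ℝ) :
    ‖Complex.exp (y * Complex.I) - ∑ k ∈ Finset.range M, (y * Complex.I) ^ k / k.factorial‖ ≤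
      |y| ^ M / M.factorial := by
  rcases le_total 0 y with hy | hy
  · have := norm_exp_mul_sub_sum_le (ω := Complex.I) (by simp)
      (fun y => by rw [mul_comm, Complex.norm_exp_ofReal_mul_I]) M y hy
    rwa [abs_of_nonneg hy, mul_comm (y : ℂ)]
  · have := norm_exp_mul_sub_sum_le (ω := -Complex.I) (by simp)
      (fun y => by
        rw [neg_mul, mul_comm, ← neg_mul, ← Complex.ofReal_neg, Complex.norm_exp_ofReal_mul_I])
      M (-y) (by linarith)
    rw [Complex.ofReal_neg, neg_mul_neg] at this
    rwa [abs_of_nonpos hy, mul_comm (y : ℂ)]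

lemma norm_integral_sum_exp_sub_le {Z ι : Type*} [MeasurableSpace Z] [Fintype ι] {Q : Measure Z}
    [IsProbabilityMeasure Q] {V : ι → Z → ℝ} (hV : ∀ j, Measurable (V j))
    (hVi : ∀ j k, Integrable (fun z => V j z ^ k) Q) (M : ℕ) :
    ‖∫ z, ∑ j, Complex.exp (V j z * Complex.I) ∂Q -
        ∑ k ∈ Finset.range M, ((∫ z, ∑ j, V j z ^ k ∂Q : ℝ) : ℂ) * (Complex.I ^ k / k.factorial)‖ ≤
      (∫ z, ∑ j, |V j z| ^ M ∂Q) / M.factorial := by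
  have hexp : Integrable (fun z => ∑ j, Complex.exp (V j z * Complex.I)) Q :=
    integrable_finsetSum _ fun j _ => Integrable.of_bound
      (Complex.measurable_ofReal.comp (hV j) |>.mul_const _).cexp.aestronglyMeasurable 1
      (Eventually.of_forall fun z => (Complex.norm_exp_ofReal_mul_I _).le)
  have hpow : ∀ k, Integrable (fun z => ∑ j, V j z ^ k) Q := fun k =>
    integrable_finsetSum _ fun j _ => hVi j k
  have hterm : ∀ k ∈ Finset.range M, Integrable (fun z => ((∑ j, V j z ^ k : ℝ) : ℂ) *
      (Complex.I ^ k / k.factorial)) Q := fun k _ => (hpow k).ofReal.mul_const _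
  have habs : Integrable (fun z => ∑ j, |V j z| ^ M) Q :=
    integrable_finsetSum _ fun j _ => by simpa [abs_pow] using (hVi j M).abs
  have hsum : ∑ k ∈ Finset.range M, ((∫ z, ∑ j, V j z ^ k ∂Q : ℝ) : ℂ) *
      (Complex.I ^ k / k.factorial) = ∫ z, ∑ k ∈ Finset.range M, ((∑ j, V j z ^ k : ℝ) : ℂ) *
        (Complex.I ^ k / k.factorial) ∂Q := by
    rw [integral_finsetSum _ hterm]
    refine Finset.sum_congr rfl fun k _ => ?_
    rw [integral_mul_const, integral_complex_ofReal]
  rw [hsum, ← integral_sub hexp (integrable_finsetSum _ hterm), ← integral_div]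
  refine norm_integral_le_of_norm_le (habs.div_const _) (Eventually.of_forall fun z => ?_)
  have : ∑ k ∈ Finset.range M, ((∑ j, V j z ^ k : ℝ) : ℂ) * (Complex.I ^ k / k.factorial) =
      ∑ j, ∑ k ∈ Finset.range M, (V j z * Complex.I) ^ k / k.factorial := by
    rw [Finset.sum_comm]
    refine Finset.sum_congr rfl fun k _ => ?_
    push_cast
    rw [Finset.sum_mul]
    refine Finset.sum_congr rfl fun j _ => ?_
    rw [mul_pow, mul_div_assoc]
  rw [this, ← Finset.sum_sub_distrib, Finset.sum_div]
  exact (norm_sum_le _ _).trans (Finset.sum_le_sum fun j _ => norm_exp_mul_I_sub_sum_le M _)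

/-- Convergence of all moments of a finite family of random variables with exponential moments in
the limit implies convergence of the sums of the characteristic functions. -/
lemma tendsto_integral_sum_exp_mul_I {X ι : Type*} [MeasurableSpace X] [Fintype ι]
    {Y : ℕ → Type*} [∀ n, MeasurableSpace (Y n)] {P : ∀ n, Measure (Y n)}
    [∀ n, IsProbabilityMeasure (P n)] {μ : Measure X} [IsProbabilityMeasure μ]
    {S : ι → X → ℝ} (hS : ∀ j, Measurable (S j)) {R : ∀ n, ι → Y n → ℝ}
    (hR : ∀ n j, Measurable (R n j)) (hRi : ∀ n j k, Integrable (fun y => R n j y ^ k) (P n))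
    (hexp : ∀ j, Integrable (fun x => Real.exp |S j x|) μ)
    (hmom : ∀ k : ℕ, Tendsto (fun n => ∫ y, ∑ j, R n j y ^ k ∂(P n)) atTop
      (𝓝 (∫ x, ∑ j, S j x ^ k ∂μ))) :
    Tendsto (fun n => ∫ y, ∑ j, Complex.exp (R n j y * Complex.I) ∂(P n)) atTop
      (𝓝 (∫ x, ∑ j, Complex.exp (S j x * Complex.I) ∂μ)) := by
  have hfac : ∀ k : ℕ, (0 : ℝ) < k.factorial := fun k => Nat.cast_pos.mpr k.factorial_pos
  have hSi : ∀ j (k : ℕ), Integrable (fun x => |S j x| ^ k) μ := fun j k => by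
    refine ((hexp j).const_mul (k.factorial : ℝ)).mono' ((hS j).abs.pow_const k).aestronglyMeasurable
      (Eventually.of_forall fun x => ?_)
    rw [Real.norm_of_nonneg (by positivity), mul_comm, ← div_le_iff₀ (hfac k)]
    exact Real.pow_div_factorial_le_exp _ (abs_nonneg _) k
  have hSi' : ∀ j (k : ℕ), Integrable (fun x => S j x ^ k) μ := fun j k =>
    (hSi j k).mono' ((hS j).pow_const k).aestronglyMeasurable
      (Eventually.of_forall fun x => by rw [norm_pow, Real.norm_eq_abs])
  have hdecay : Tendsto (fun M : ℕ => ∫ x, ∑ j, |S j x| ^ M / M.factorial ∂μ) atTop (𝓝 0) := by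
    have := tendsto_integral_of_dominated_convergence (μ := μ)
      (F := fun (M : ℕ) x => ∑ j, |S j x| ^ M / M.factorial) (f := fun _ => 0)
      (fun x => ∑ j, Real.exp |S j x|)
      (fun M => (Finset.measurable_sum _ fun j _ =>
        ((hS j).abs.pow_const M).div_const _).aestronglyMeasurable)
      (integrable_finsetSum _ fun j _ => hexp j)
      (fun M => Eventually.of_forall fun x => by
        rw [Real.norm_of_nonneg (Finset.sum_nonneg fun j _ => by positivity)]
        exact Finset.sum_le_sum fun j _ => Real.pow_div_factorial_le_exp _ (abs_nonneg _) M)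
      (Eventually.of_forall fun x => by
        simpa using tendsto_finsetSum Finset.univ fun j _ =>
          FloorSemiring.tendsto_pow_div_factorial_atTop |S j x|)
    simpa using this
  have hSint : ∀ M : ℕ, (∫ x, ∑ j, |S j x| ^ M ∂μ) / M.factorial =
      ∫ x, ∑ j, |S j x| ^ M / M.factorial ∂μ := fun M => by
    rw [← integral_div]
    simp only [Finset.sum_div]
  rw [Metric.tendsto_nhds]
  intro ε hε
  have hodd : Tendsto (fun r : ℕ => 2 * r) atTop atTop :=
    tendsto_atTop_mono (fun r => Nat.le_mul_of_pos_left r two_pos) tendsto_id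
  obtain ⟨r, hr⟩ := ((hdecay.comp hodd).eventually (gt_mem_nhds (half_pos hε))).exists
  have heven : ∀ y : ℝ, |y| ^ (2 * r) = y ^ (2 * r) := fun y => (even_two_mul r).pow_abs y
  have hbound : Tendsto (fun n => (∫ y, ∑ j, |R n j y| ^ (2 * r) ∂(P n)) / (2 * r).factorial +
      ‖∑ k ∈ Finset.range (2 * r), ((∫ y, ∑ j, R n j y ^ k ∂(P n) : ℝ) : ℂ) *
          (Complex.I ^ k / k.factorial) -
        ∑ k ∈ Finset.range (2 * r), ((∫ x, ∑ j, S j x ^ k ∂μ : ℝ) : ℂ) *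
          (Complex.I ^ k / k.factorial)‖ +
      (∫ x, ∑ j, |S j x| ^ (2 * r) ∂μ) / (2 * r).factorial) atTop
      (𝓝 ((∫ x, ∑ j, |S j x| ^ (2 * r) ∂μ) / (2 * r).factorial + ‖(0 : ℂ)‖ +
        (∫ x, ∑ j, |S j x| ^ (2 * r) ∂μ) / (2 * r).factorial)) := by
    refine ((Tendsto.div_const ?_ _).add (Tendsto.norm ?_)).add tendsto_const_nhds
    · simp only [heven]
      exact hmom (2 * r)
    · rw [← sub_self (∑ k ∈ Finset.range (2 * r), ((∫ x, ∑ j, S j x ^ k ∂μ : ℝ) : ℂ) *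
          (Complex.I ^ k / k.factorial))]
      refine Tendsto.sub_const (tendsto_finsetSum _ fun k _ => Tendsto.mul_const _ ?_) _
      exact (Complex.continuous_ofReal.tendsto _).comp (hmom k)
  have hsmall : (∫ x, ∑ j, |S j x| ^ (2 * r) ∂μ) / (2 * r).factorial + ‖(0 : ℂ)‖ +
      (∫ x, ∑ j, |S j x| ^ (2 * r) ∂μ) / (2 * r).factorial < ε := by
    simp only [Function.comp_apply] at hr
    rw [norm_zero, hSint]
    linarith
  filter_upwards [hbound.eventually (gt_mem_nhds hsmall)] with n hn
  refine lt_of_le_of_lt ?_ hn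
  rw [dist_eq_norm]
  refine (norm_sub_le_norm_sub_add_norm_sub _ (∑ k ∈ Finset.range (2 * r),
    ((∫ x, ∑ j, S j x ^ k ∂μ : ℝ) : ℂ) * (Complex.I ^ k / k.factorial)) _).trans ?_
  refine add_le_add ((norm_sub_le_norm_sub_add_norm_sub _ (∑ k ∈ Finset.range (2 * r),
    ((∫ y, ∑ j, R n j y ^ k ∂(P n) : ℝ) : ℂ) * (Complex.I ^ k / k.factorial)) _).trans
      (add_le_add_left (norm_integral_sum_exp_sub_le (hR n) (hRi n) _) _)) ?_
  rw [norm_sub_rev]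
  exact norm_integral_sum_exp_sub_le hS hSi' _

/-- The algebra of functions on triangular arrays generated by the power sums of the levels. -/
def levelAlg (m : ℕ) : Subalgebra ℝ (Tri m → ℝ) :=
  Algebra.adjoin ℝ (Set.range fun (p : Fin m × ℕ) (x : Tri m) => affPS 0 1 (x p.1) p.2)

/-- The set of products over the levels of homogeneous polynomials in the power sums. -/
def levelProds (m : ℕ) : Set (Tri m → ℝ) :=
  {F | ∃ (f : ℕ → (ℕ → ℝ) → ℝ) (d : ℕ → ℕ), (∀ k, f k ∈ polySpace (d k)) ∧ F = levelProd f 0 1}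

lemma one_mem_levelProds (m : ℕ) : 1 ∈ levelProds m :=
  ⟨fun _ => 1, fun _ => 0, fun _ => one_mem_polySpace, by
    funext x
    simp [levelProd]⟩

lemma mul_mem_levelProds {m : ℕ} {F G : Tri m → ℝ} (hF : F ∈ levelProds m)
    (hG : G ∈ levelProds m) : F * G ∈ levelProds m := by
  obtain ⟨f, d, hf, rfl⟩ := hF
  obtain ⟨g, e, hg, rfl⟩ := hG
  refine ⟨fun k => f k * g k, fun k => d k + e k, fun k => mul_mem_polySpace (hf k) (hg k), ?_⟩
  funext x
  simp [levelProd, Finset.prod_mul_distrib]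

lemma affPS_mem_levelProds {m : ℕ} (k : Fin m) (l : ℕ) :
    (fun x : Tri m => affPS 0 1 (x k) l) ∈ levelProds m := by
  obtain ⟨f, d, hf, h⟩ : ∃ (f : (ℕ → ℝ) → ℝ) (d : ℕ), f ∈ polySpace d ∧
      ∀ y : Fin (k.1 + 1) → ℝ, affPS 0 1 y l = f (affPS 0 1 y) := by
    rcases Nat.eq_zero_or_pos l with rfl | hl
    · refine ⟨((k.1 + 1 : ℕ) : ℝ) • 1, 0, Submodule.smul_mem _ _ one_mem_polySpace, fun y => ?_⟩
      simp [affPS]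
    · exact ⟨_, l, coord_mem_polySpace hl, fun y => rfl⟩
  refine ⟨fun j => if j = k.1 then f else 1, fun j => if j = k.1 then d else 0, fun j => ?_, ?_⟩
  · dsimp only
    split_ifs
    · exact hf
    · exact one_mem_polySpace
  · funext x
    rw [levelProd, Finset.prod_eq_single k]
    · simp [h]
    · intro j _ hj
      rw [if_neg (fun h => hj (Fin.ext h)), Pi.one_apply]
    · simp

lemma levelAlg_le_span (m : ℕ) {F : Tri m → ℝ} (hF : F ∈ levelAlg m) :
    F ∈ Submodule.span ℝ (levelProds m) := by
  have h : F ∈ Subalgebra.toSubmodule (levelAlg m) := hF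
  rw [levelAlg, Algebra.adjoin_eq_span] at h
  refine Submodule.span_mono (fun G hG => ?_) h
  induction hG using Submonoid.closure_induction with
  | mem G hG =>
    obtain ⟨p, rfl⟩ := hG
    exact affPS_mem_levelProds p.1 p.2
  | one => exact one_mem_levelProds m
  | mul F G _ _ hF hG => exact mul_mem_levelProds hF hG

/-- Sums of exponentials `∑ j, exp (i S_j)` over finite families of functions of linear growth, all
of whose power sums belong to `levelAlg m`. -/
def expFamilies (m : ℕ) : Set (Tri m → ℂ) :=
  {g | ∃ (n : ℕ) (S : Fin n → Tri m → ℝ) (q : ℝ), 0 ≤ q ∧ (∀ j, Continuous (S j)) ∧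
    (∀ j x, |S j x| ≤ q * ‖x‖) ∧ (∀ k : ℕ, (fun x => ∑ j, S j x ^ k) ∈ levelAlg m) ∧
    g = fun x => ∑ j, Complex.exp (S j x * Complex.I)}

lemma mem_expFamilies {m : ℕ} {ι : Type*} [Fintype ι] {S : ι → Tri m → ℝ} {q : ℝ} (hq : 0 ≤ q)
    (hc : ∀ j, Continuous (S j)) (hS : ∀ j x, |S j x| ≤ q * ‖x‖)
    (hk : ∀ k : ℕ, (fun x => ∑ j, S j x ^ k) ∈ levelAlg m) :
    (fun x => ∑ j, Complex.exp (S j x * Complex.I)) ∈ expFamilies m := by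
  let e := Fintype.equivFin ι
  refine ⟨_, fun j => S (e.symm j), q, hq, fun j => hc _, fun j => hS _, fun k => ?_, ?_⟩
  · convert hk k using 2 with x
    exact e.symm.sum_comp fun j => S j x ^ k
  · funext x
    exact (e.symm.sum_comp fun j => Complex.exp (S j x * Complex.I)).symm

lemma one_mem_expFamilies (m : ℕ) : 1 ∈ expFamilies m := by
  have : (1 : Tri m → ℂ) = fun x => ∑ _j : Unit, Complex.exp (((0 : ℝ) : ℂ) * Complex.I) := by
    funext x
    simp
  rw [this]
  refine mem_expFamilies (S := fun (_ : Unit) (_ : Tri m) => (0 : ℝ)) le_rfl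
    (fun j => continuous_const) (by simp) fun k => ?_
  simp only [Finset.univ_unique, Finset.sum_const, Finset.card_singleton, one_smul]
  exact (levelAlg m).algebraMap_mem ((0 : ℝ) ^ k)

lemma mul_mem_expFamilies {m : ℕ} {F G : Tri m → ℂ} (hF : F ∈ expFamilies m)
    (hG : G ∈ expFamilies m) : F * G ∈ expFamilies m := by
  obtain ⟨n, S, q, hq, hc, hS, hk, rfl⟩ := hF
  obtain ⟨n', S', q', hq', hc', hS', hk', rfl⟩ := hG
  have := mem_expFamilies (ι := Fin n × Fin n') (S := fun j x => S j.1 x + S' j.2 x)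
    (add_nonneg hq hq') (fun j => (hc _).add (hc' _))
    (fun j x => (abs_add_le _ _).trans (by linarith [hS j.1 x, hS' j.2 x])) fun k => ?_
  · convert this using 1
    funext x
    simp only [Pi.mul_apply, Finset.sum_mul_sum, Fintype.sum_prod_type, Complex.ofReal_add, add_mul,
      Complex.exp_add]
  · have : (fun x : Tri m => ∑ j : Fin n × Fin n', (S j.1 x + S' j.2 x) ^ k) =
        ∑ i ∈ Finset.range (k + 1), (k.choose i : ℝ) •
          ((fun x => ∑ j, S j x ^ i) * fun x => ∑ j, S' j x ^ (k - i)) := by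
      funext x
      simp only [Finset.sum_apply, Pi.smul_apply, Pi.mul_apply, smul_eq_mul, add_pow]
      rw [Finset.sum_comm]
      refine Finset.sum_congr rfl fun i _ => ?_
      rw [Finset.sum_mul_sum, Fintype.sum_prod_type, Finset.mul_sum]
      refine Finset.sum_congr rfl fun j _ => ?_
      rw [Finset.mul_sum]
      exact Finset.sum_congr rfl fun j' _ => by ring
    rw [this]
    exact sum_mem fun i _ => (levelAlg m).smul_mem ((levelAlg m).mul_mem (hk i) (hk' _)) _

lemma star_mem_expFamilies {m : ℕ} {F : Tri m → ℂ} (hF : F ∈ expFamilies m) :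
    star F ∈ expFamilies m := by
  obtain ⟨n, S, q, hq, hc, hS, hk, rfl⟩ := hF
  refine ⟨n, fun j x => -S j x, q, hq, fun j => (hc j).neg, fun j x => by
    rw [abs_neg]
    exact hS j x, fun k => ?_, ?_⟩
  · have : (fun x : Tri m => ∑ j, (-S j x) ^ k) = (-1 : ℝ) ^ k • fun x => ∑ j, S j x ^ k := by
      funext x
      rw [Pi.smul_apply, smul_eq_mul, Finset.mul_sum]
      exact Finset.sum_congr rfl fun j _ => neg_pow _ _
    rw [this]
    exact (levelAlg m).smul_mem (hk k) _
  · funext x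
    simp [← Complex.exp_conj]

lemma level_mem_expFamilies {m : ℕ} (k : Fin m) (t : ℝ) :
    (fun x : Tri m => ∑ i, Complex.exp ((t * x k i : ℝ) * Complex.I)) ∈ expFamilies m := by
  refine mem_expFamilies (S := fun i (x : Tri m) => t * x k i) (abs_nonneg t)
    (fun i => by fun_prop) (fun i x => ?_) fun l => ?_
  · rw [abs_mul]
    gcongr
    exact (norm_le_pi_norm (x k) i).trans (norm_le_pi_norm x k)
  · have : (fun x : Tri m => ∑ i, (t * x k i) ^ l) = t ^ l • fun x => affPS 0 1 (x k) l := by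
      funext x
      simp [affPS, mul_pow, Finset.mul_sum]
    rw [this]
    exact (levelAlg m).smul_mem (Algebra.subset_adjoin ⟨(k, l), rfl⟩) _

/-- The sums of exponentials `∑ i, exp (i t xᵢ)` determine a decreasing tuple. -/
lemma eq_of_forall_sum_exp_eq {n : ℕ} {x y : Fin n → ℝ} (hx : Antitone x) (hy : Antitone y)
    (h : ∀ t : ℝ, ∑ i, Complex.exp ((t * x i : ℝ) * Complex.I) =
      ∑ i, Complex.exp ((t * y i : ℝ) * Complex.I)) : x = y := by
  have key (z : Fin n → ℝ) (t : ℝ) : charFun (∑ i, Measure.dirac (z i)) t =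
      ∑ i, Complex.exp ((t * z i : ℝ) * Complex.I) := by
    rw [charFun_apply_real, integral_finsetSum_measure fun i _ => integrable_dirac (by simp)]
    simp
  have hmeas : ∑ i, Measure.dirac (x i) = ∑ i, Measure.dirac (y i) :=
    Measure.ext_of_charFun (funext fun t => by rw [key, key, h])
  have hcard (c : ℝ) : (Finset.univ.filter fun j => c ≤ x j).card =
      (Finset.univ.filter fun j => c ≤ y j).card := by
    have hc := congrArg (fun μ : Measure ℝ => μ (Set.Ici c)) hmeas
    simp only [Measure.finsetSum_apply, Measure.dirac_apply' _ measurableSet_Ici,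
      Set.indicator_apply, Set.mem_Ici, Pi.one_apply, Finset.sum_boole] at hc
    exact_mod_cast hc
  have hlt {u v : Fin n → ℝ} (hu : Antitone u) (hv : Antitone v) (i : Fin n) (hi : u i < v i) :
      (Finset.univ.filter fun j => v i ≤ u j).card <
        (Finset.univ.filter fun j => v i ≤ v j).card := by
    refine Finset.card_lt_card ((Finset.ssubset_iff_of_subset fun j hj => ?_).2 ⟨i, by simp, by
      simpa using hi⟩)
    rw [Finset.mem_filter_univ] at hj ⊢
    refine hv (le_of_not_gt fun hij => ?_)
    linarith [hu hij.le]
  funext i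
  rcases lt_trichotomy (x i) (y i) with hi | hi | hi
  · exact absurd (hcard (y i)) (hlt hx hy i hi).ne
  · exact hi
  · exact absurd (hcard (x i)).symm (hlt hy hx i hi).ne

lemma integrable_of_continuous_of_ae_norm_le {m : ℕ} {E : Type*} [NormedAddCommGroup E]
    [SecondCountableTopology E] {P : Measure (Tri m)} [IsFiniteMeasure P] {r : ℝ}
    (hr : ∀ᵐ x ∂P, ‖x‖ ≤ r) {F : Tri m → E} (hF : Continuous F) : Integrable F P := by
  obtain ⟨C, hC⟩ := (isCompact_closedBall (0 : Tri m) r).exists_bound_of_continuousOn hF.continuousOn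
  borelize E
  refine Integrable.of_bound hF.measurable.aestronglyMeasurable C ?_
  filter_upwards [hr] with x hx using hC x (by simpa using hx)

/-- A sequence of compactly supported probability measures on triangular arrays whose
`levelProds` moments converge to those of a law `P` with exponential moments. -/
structure MomentConv {m : ℕ} (Q : ℕ → Measure (Tri m)) (P : Measure (Tri m)) : Prop where
  prob : ∀ n, IsProbabilityMeasure (Q n)
  prob_lim : IsProbabilityMeasure P
  bounded : ∀ n, ∃ r : ℝ, ∀ᵐ x ∂Q n, ‖x‖ ≤ r
  exp_lim : ∀ q : ℝ, 0 ≤ q → Integrable (fun x => Real.exp (q * ‖x‖)) P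
  tendsto : ∀ F ∈ levelProds m, Tendsto (fun n => ∫ x, F x ∂Q n) atTop (𝓝 (∫ x, F x ∂P))

lemma MomentConv.integrable {m : ℕ} {Q : ℕ → Measure (Tri m)} {P : Measure (Tri m)}
    (h : MomentConv Q P) {E : Type*} [NormedAddCommGroup E] [SecondCountableTopology E]
    {F : Tri m → E} (hF : Continuous F) (n : ℕ) : Integrable F (Q n) :=
  have := h.prob n
  integrable_of_continuous_of_ae_norm_le (h.bounded n).choose_spec hF

lemma MomentConv.tendsto_levelAlg {m : ℕ} {Q : ℕ → Measure (Tri m)} {P : Measure (Tri m)}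
    (h : MomentConv Q P) {F : Tri m → ℝ} (hF : F ∈ levelAlg m) :
    Continuous F ∧ Integrable F P ∧ Tendsto (fun n => ∫ x, F x ∂Q n) atTop (𝓝 (∫ x, F x ∂P)) := by
  replace hF := levelAlg_le_span m hF
  induction hF using Submodule.span_induction with
  | mem F hF =>
    have ht := h.tendsto F hF
    obtain ⟨f, d, hf, rfl⟩ := hF
    have hc : Continuous (levelProd (M := m) f 0 1) := continuous_levelProd hf 0 1 m
    obtain ⟨C, q, -, hq, hb⟩ := exists_levelProd_bound hf m
    exact ⟨hc, ((h.exp_lim q hq).const_mul C).mono' hc.measurable.aestronglyMeasurable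
      (Eventually.of_forall hb), ht⟩
  | zero => exact ⟨continuous_zero, integrable_zero _ _ _, by simp⟩
  | add F G _ _ hF hG =>
    refine ⟨hF.1.add hG.1, hF.2.1.add hG.2.1, ?_⟩
    simp only [Pi.add_apply]
    rw [integral_add hF.2.1 hG.2.1]
    refine (hF.2.2.add hG.2.2).congr fun n => ?_
    rw [integral_add (h.integrable hF.1 n) (h.integrable hG.1 n)]
  | smul c F _ hF =>
    refine ⟨hF.1.const_smul c, hF.2.1.smul c, ?_⟩
    simp only [Pi.smul_apply, integral_smul]
    exact hF.2.2.const_smul c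

lemma MomentConv.tendsto_span_expFamilies {m : ℕ} {Q : ℕ → Measure (Tri m)} {P : Measure (Tri m)}
    (h : MomentConv Q P) {G : Tri m → ℂ} (hG : G ∈ Submodule.span ℂ (expFamilies m)) :
    Continuous G ∧ Integrable G P ∧ Tendsto (fun n => ∫ x, G x ∂Q n) atTop (𝓝 (∫ x, G x ∂P)) := by
  have := h.prob
  have := h.prob_lim
  induction hG using Submodule.span_induction with
  | mem G hG =>
    obtain ⟨n, S, q, hq, hc, hS, hk, rfl⟩ := hG
    have hcont : Continuous fun x => ∑ j, Complex.exp (S j x * Complex.I) := by fun_prop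
    refine ⟨hcont, ?_, ?_⟩
    · refine Integrable.of_bound hcont.measurable.aestronglyMeasurable n
        (Eventually.of_forall fun x => (norm_sum_le _ _).trans ?_)
      simp [Complex.norm_exp_ofReal_mul_I]
    · refine tendsto_integral_sum_exp_mul_I (fun j => (hc j).measurable)
        (fun _ j => (hc j).measurable) (fun n j k => h.integrable ((hc j).pow k) n) (fun j => ?_)
        fun k => (h.tendsto_levelAlg (hk k)).2.2
      refine (h.exp_lim q hq).mono'
        (Real.continuous_exp.comp (hc j).abs).measurable.aestronglyMeasurable
        (Eventually.of_forall fun x => ?_)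
      rw [Real.norm_of_nonneg (Real.exp_pos _).le]
      exact Real.exp_le_exp.2 (hS j x)
  | zero => exact ⟨continuous_zero, integrable_zero _ _ _, by simp⟩
  | add F G _ _ hF hG =>
    refine ⟨hF.1.add hG.1, hF.2.1.add hG.2.1, ?_⟩
    simp only [Pi.add_apply]
    rw [integral_add hF.2.1 hG.2.1]
    refine (hF.2.2.add hG.2.2).congr fun n => ?_
    rw [integral_add (h.integrable hF.1 n) (h.integrable hG.1 n)]
  | smul c F _ hF =>
    refine ⟨hF.1.const_smul c, hF.2.1.smul c, ?_⟩
    simp only [Pi.smul_apply, integral_smul]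
    exact hF.2.2.const_smul c

lemma mul_mem_span_expFamilies {m : ℕ} {F G : Tri m → ℂ}
    (hF : F ∈ Submodule.span ℂ (expFamilies m)) (hG : G ∈ Submodule.span ℂ (expFamilies m)) :
    F * G ∈ Submodule.span ℂ (expFamilies m) := by
  have := Submodule.mul_mem_mul hF hG
  rw [Submodule.span_mul_span] at this
  refine Submodule.span_mono ?_ this
  rintro _ ⟨F, hF, G, hG, rfl⟩
  exact mul_mem_expFamilies hF hG

lemma star_mem_span_expFamilies {m : ℕ} {F : Tri m → ℂ}
    (hF : F ∈ Submodule.span ℂ (expFamilies m)) : star F ∈ Submodule.span ℂ (expFamilies m) := by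
  induction hF using Submodule.span_induction with
  | mem F hF => exact Submodule.subset_span (star_mem_expFamilies hF)
  | zero => simp
  | add F G _ _ hF hG =>
    rw [star_add]
    exact add_mem hF hG
  | smul c F _ hF =>
    rw [star_smul]
    exact Submodule.smul_mem _ _ hF

/-- The space of triangular arrays with decreasing levels. -/
abbrev DecTri (m : ℕ) := {x : Tri m // ∀ k, Antitone (x k)}

lemma isClosed_antitone_levels (m : ℕ) : IsClosed {x : Tri m | ∀ k, Antitone (x k)} := by
  have : {x : Tri m | ∀ k, Antitone (x k)} =
      ⋂ (k : Fin m) (i : Fin (k.1 + 1)) (j : Fin (k.1 + 1)) (_ : i ≤ j), {x | x k j ≤ x k i} := by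
    ext x
    simp [Antitone]
  rw [this]
  exact isClosed_iInter fun k => isClosed_iInter fun i => isClosed_iInter fun j =>
    isClosed_iInter fun _ => isClosed_le (by fun_prop) (by fun_prop)

instance (m : ℕ) : PolishSpace (DecTri m) := (isClosed_antitone_levels m).polishSpace

/-- The bounded continuous function `∑ i, exp (i t xᵢ)` of level `k`. -/
def levelExp (m : ℕ) (k : Fin m) (t : ℝ) : BoundedContinuousFunction (DecTri m) ℂ :=
  BoundedContinuousFunction.ofNormedAddCommGroup
    (fun x => ∑ i, Complex.exp ((t * x.1 k i : ℝ) * Complex.I))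
    (by
      have (i : Fin (k.1 + 1)) : Continuous fun x : DecTri m => x.1 k i :=
        (continuous_apply i).comp ((continuous_apply k).comp continuous_subtype_val)
      exact continuous_finsetSum _ fun i _ => Complex.continuous_exp.comp
        ((Complex.continuous_ofReal.comp (continuous_const.mul (this i))).mul continuous_const))
    (k.1 + 1) fun x => by
      refine (norm_sum_le _ _).trans ?_
      simp only [Complex.norm_exp_ofReal_mul_I]
      simp

/-- The star algebra generated by the functions `levelExp`. -/
def levelExpAlg (m : ℕ) : StarSubalgebra ℂ (BoundedContinuousFunction (DecTri m) ℂ) :=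
  StarAlgebra.adjoin ℂ (Set.range fun p : Fin m × ℝ => levelExp m p.1 p.2)

lemma exists_mem_span_expFamilies {m : ℕ} {g : BoundedContinuousFunction (DecTri m) ℂ}
    (hg : g ∈ levelExpAlg m) :
    ∃ G ∈ Submodule.span ℂ (expFamilies m), ∀ x, g x = G x.1 := by
  induction hg using StarAlgebra.adjoin_induction with
  | mem g hg =>
    obtain ⟨p, rfl⟩ := hg
    exact ⟨_, Submodule.subset_span (level_mem_expFamilies p.1 p.2), fun x => rfl⟩
  | algebraMap r =>
    refine ⟨r • 1, Submodule.smul_mem _ _ (Submodule.subset_span (one_mem_expFamilies m)),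
      fun x => ?_⟩
    simp [Algebra.algebraMap_eq_smul_one]
  | add f g _ _ hf hg =>
    obtain ⟨F, hF, hfF⟩ := hf
    obtain ⟨G, hG, hgG⟩ := hg
    exact ⟨F + G, add_mem hF hG, fun x => by simp [hfF, hgG]⟩
  | mul f g _ _ hf hg =>
    obtain ⟨F, hF, hfF⟩ := hf
    obtain ⟨G, hG, hgG⟩ := hg
    exact ⟨F * G, mul_mem_span_expFamilies hF hG, fun x => by simp [hfF, hgG]⟩
  | star f _ hf =>
    obtain ⟨F, hF, hfF⟩ := hf
    exact ⟨star F, star_mem_span_expFamilies hF, fun x => by simp [hfF]⟩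

lemma separatesPoints_levelExpAlg (m : ℕ) :
    ((levelExpAlg m).map (BoundedContinuousFunction.toContinuousMapStarₐ ℂ)).SeparatesPoints := by
  intro x y hxy
  by_contra! h
  refine hxy (Subtype.ext (funext fun k => eq_of_forall_sum_exp_eq (x.2 k) (y.2 k) fun t => ?_))
  exact h _ ⟨BoundedContinuousFunction.toContinuousMapStarₐ ℂ (levelExp m k t),
    ⟨_, StarAlgebra.subset_adjoin ℂ _ ⟨(k, t), rfl⟩, rfl⟩, rfl⟩

/-- A measure on triangular arrays, viewed as a measure on arrays with decreasing levels. -/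
def decComap {m : ℕ} (Q : Measure (Tri m)) : Measure (DecTri m) :=
  Q.comap Subtype.val

lemma measurableEmbedding_decTri (m : ℕ) :
    MeasurableEmbedding (Subtype.val : DecTri m → Tri m) :=
  MeasurableEmbedding.subtype_coe (isClosed_antitone_levels m).measurableSet

lemma map_decComap {m : ℕ} {Q : Measure (Tri m)} (hQ : ∀ᵐ x ∂Q, ∀ k, Antitone (x k)) :
    (decComap Q).map Subtype.val = Q := by
  rw [decComap, (measurableEmbedding_decTri m).map_comap, Subtype.range_coe_subtype]
  exact Measure.restrict_eq_self_of_ae_mem hQ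

lemma isProbabilityMeasure_decComap {m : ℕ} {Q : Measure (Tri m)} [IsProbabilityMeasure Q]
    (hQ : ∀ᵐ x ∂Q, ∀ k, Antitone (x k)) : IsProbabilityMeasure (decComap Q) := by
  refine ⟨?_⟩
  have h := congrArg (fun μ : Measure (Tri m) => μ Set.univ) (map_decComap hQ)
  simpa [(measurableEmbedding_decTri m).map_apply] using h

lemma integral_decComap {m : ℕ} {E : Type*} [NormedAddCommGroup E] [NormedSpace ℝ E]
    {Q : Measure (Tri m)} (hQ : ∀ᵐ x ∂Q, ∀ k, Antitone (x k)) (F : Tri m → E) :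
    ∫ x, F x.1 ∂decComap Q = ∫ x, F x ∂Q := by
  conv_rhs => rw [← map_decComap hQ, (measurableEmbedding_decTri m).integral_map]

lemma MomentConv.exists_integral_le {m : ℕ} {Q : ℕ → Measure (Tri m)} {P : Measure (Tri m)}
    (h : MomentConv Q P) :
    ∃ C : ℝ, ∀ n, ∫ x, ‖x‖ ^ 2 ∂Q n ≤ C := by
  have hV : (∑ k : Fin m, fun x : Tri m => affPS 0 1 (x k) 2) ∈ levelAlg m :=
    sum_mem fun k _ => Algebra.subset_adjoin ⟨(k, 2), rfl⟩
  obtain ⟨hc, -, ht⟩ := h.tendsto_levelAlg hV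
  obtain ⟨C, hC⟩ := ht.bddAbove_range
  refine ⟨C, fun n => (integral_mono (h.integrable (by fun_prop) n) (h.integrable hc n)
    fun x => ?_).trans (hC ⟨n, rfl⟩)⟩
  have h0 : 0 ≤ (∑ k : Fin m, fun x : Tri m => affPS 0 1 (x k) 2) x := by
    rw [Finset.sum_apply]
    exact Finset.sum_nonneg fun k _ => Finset.sum_nonneg fun i _ => by positivity
  dsimp only
  rw [← Real.le_sqrt (norm_nonneg x) h0, pi_norm_le_iff_of_nonneg (Real.sqrt_nonneg _)]
  intro k
  rw [pi_norm_le_iff_of_nonneg (Real.sqrt_nonneg _)]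
  intro i
  rw [Real.le_sqrt (norm_nonneg _) h0, Finset.sum_apply, Real.norm_eq_abs, sq_abs]
  calc x k i ^ 2 ≤ affPS 0 1 (x k) 2 := by
        simpa [affPS] using Finset.single_le_sum (f := fun i => x k i ^ 2)
          (fun i _ => sq_nonneg _) (Finset.mem_univ i)
    _ ≤ _ := Finset.single_le_sum (f := fun k => affPS 0 1 (x k) 2)
        (fun k _ => Finset.sum_nonneg fun i _ => by positivity) (Finset.mem_univ k)

lemma MomentConv.isTight {m : ℕ} {Q : ℕ → Measure (Tri m)} {P : Measure (Tri m)}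
    (h : MomentConv Q P) (hQ : ∀ n, ∀ᵐ x ∂Q n, ∀ k, Antitone (x k)) :
    IsTightMeasureSet {decComap (Q n) | n} := by
  have := h.prob
  obtain ⟨C, hC⟩ := h.exists_integral_le
  have hC0 : 0 ≤ C := (integral_nonneg fun x => by positivity).trans (hC 0)
  rw [isTightMeasureSet_iff_exists_isCompact_measure_compl_le]
  intro ε hε
  obtain ⟨δ, hδ, hδε⟩ : ∃ δ : ℝ, 0 < δ ∧ ENNReal.ofReal δ ≤ ε := by
    obtain ⟨δ, hδ, hδε⟩ := ENNReal.lt_iff_exists_nnreal_btwn.1 hε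
    exact ⟨δ, by simpa using hδ, by simpa using hδε.le⟩
  let r := Real.sqrt ((C + 1) / δ)
  have hr : 0 ≤ r := Real.sqrt_nonneg _
  have hr2 : r ^ 2 = (C + 1) / δ := Real.sq_sqrt (by positivity)
  refine ⟨Subtype.val ⁻¹' Metric.closedBall (0 : Tri m) r,
    (isClosed_antitone_levels m).isClosedEmbedding_subtypeVal.isCompact_preimage
      (isCompact_closedBall 0 r), ?_⟩
  rintro _ ⟨n, rfl⟩
  rw [← Set.preimage_compl, ← (measurableEmbedding_decTri m).map_apply, map_decComap (hQ n)]
  refine le_trans ?_ hδε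
  have hM := mul_meas_ge_le_integral_of_nonneg (μ := Q n) (f := fun x => ‖x‖ ^ 2)
    (Eventually.of_forall fun x => by positivity) (h.integrable (by fun_prop) n) ((C + 1) / δ)
  rw [← ofReal_measureReal]
  refine ENNReal.ofReal_le_ofReal ((measureReal_mono (s₂ := {x | (C + 1) / δ ≤ ‖x‖ ^ 2})
    fun x hx => ?_).trans ?_)
  · rw [Set.mem_compl_iff, mem_closedBall_zero_iff, not_le] at hx
    rw [Set.mem_ofPred_eq, ← hr2]
    gcongr
  · have := hM.trans (hC n)
    rw [div_mul_eq_mul_div, div_le_iff₀ hδ] at this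
    nlinarith [measureReal_nonneg (μ := Q n) (s := {x : Tri m | (C + 1) / δ ≤ ‖x‖ ^ 2})]

/-- Convergence of the `levelProds` moments to those of a law with exponential moments implies
weak convergence, for laws on arrays with decreasing levels. -/
lemma MomentConv.tendsto_integral {m : ℕ} {Q : ℕ → Measure (Tri m)} {P : Measure (Tri m)}
    (h : MomentConv Q P) (hQ : ∀ n, ∀ᵐ x ∂Q n, ∀ k, Antitone (x k))
    (hP : ∀ᵐ x ∂P, ∀ k, Antitone (x k)) (f : BoundedContinuousFunction (Tri m) ℝ) :
    Tendsto (fun n => ∫ x, f x ∂Q n) atTop (𝓝 (∫ x, f x ∂P)) := by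
  have := h.prob
  have := h.prob_lim
  let Q' : ℕ → ProbabilityMeasure (DecTri m) :=
    fun n => ⟨decComap (Q n), isProbabilityMeasure_decComap (hQ n)⟩
  let P' : ProbabilityMeasure (DecTri m) := ⟨decComap P, isProbabilityMeasure_decComap hP⟩
  have htight : IsTightMeasureSet {(Q' n : Measure (DecTri m)) | n} := h.isTight hQ
  have hconv : Tendsto Q' atTop (𝓝 P') := by
    refine ProbabilityMeasure.tendsto_of_tight_of_separatesPoints ℂ htight
      (separatesPoints_levelExpAlg m) fun g hg => ?_
    obtain ⟨G, hG, hgG⟩ := exists_mem_span_expFamilies hg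
    simp only [hgG]
    change Tendsto (fun n => ∫ x, G x.1 ∂decComap (Q n)) atTop (𝓝 (∫ x, G x.1 ∂decComap P))
    simp only [integral_decComap hP, integral_decComap (hQ _)]
    exact (h.tendsto_span_expFamilies hG).2.2
  have hf := ProbabilityMeasure.tendsto_iff_forall_integral_tendsto.1 hconv
    (f.compContinuous ⟨Subtype.val, continuous_subtype_val⟩)
  change Tendsto (fun n => ∫ x, f x.1 ∂decComap (Q n)) atTop (𝓝 (∫ x, f x.1 ∂decComap P)) at hf
  simpa only [integral_decComap hP, integral_decComap (hQ _)] using hf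

lemma strictAnti_level_of_mem_cornersDom {M : ℕ} {b : Fin (M + 1) → ℝ} {x : Tri M}
    (hx : x ∈ cornersDom b) (k : Fin M) : StrictAnti (x k) :=
  (hx k).strictAnti_left

lemma strictAnti_level_of_mem_triDomain {m : ℕ} {x : Tri m} (hx : x ∈ triDomain m) (k : Fin m) :
    StrictAnti (x k) := by
  obtain ⟨k, hk⟩ := k
  cases k with
  | zero => exact Subsingleton.strictAnti (α := Fin 1) _
  | succ k => exact (hx ⟨k, by omega⟩ hk).strictAnti_right

/-- The array with entries `(x k i - c) / σ`. -/
def triRescale {m : ℕ} (c σ : ℝ) (x : Tri m) : Tri m := fun k i => (x k i - c) / σ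

lemma continuous_triRescale {m : ℕ} (c σ : ℝ) : Continuous (triRescale c σ : Tri m → Tri m) := by
  unfold triRescale
  fun_prop

lemma levelProd_triRescale {m : ℕ} (f : ℕ → (ℕ → ℝ) → ℝ) (c σ : ℝ) (x : Tri m) :
    levelProd f 0 1 (triRescale c σ x) = levelProd f c σ x := by
  have (k : Fin m) : affPS 0 1 (triRescale c σ x k) = affPS c σ (x k) := by
    funext l
    simp [affPS, triRescale]
  simp only [levelProd, this]

lemma momentConv_corners {θ : ℝ} (hθ : 0 < θ) {M : ℕ} (hm : 1 ≤ M + 1)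
    {b : ∀ n : ℕ, Fin (M + 1 + n + 1) → ℝ} (hb : ∀ n, StrictAnti (b n)) {c σ : ℕ → ℝ}
    (hσ : ∀ n, σ n ≠ 0)
    (h : ∀ l, 0 < l → Tendsto (fun n => affPS (c n) (σ n) (b n) l / ((M + 1 + n + 1 : ℕ) : ℝ) ^ l)
      atTop (𝓝 (limPS l))) :
    MomentConv (fun n => (corners θ (b n)).map fun x =>
      triRescale (c n) (σ n) (triRestrict (Nat.le_add_right (M + 1) n) x)) (gbc θ hm) where
  prob n :=
    have := isProbabilityMeasure_corners hθ (hb n)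
    Measure.isProbabilityMeasure_map
      ((continuous_triRescale _ _).comp (continuous_triRestrict _)).aemeasurable
  prob_lim := isProbabilityMeasure_gbc hθ hm
  bounded n := by
    have hc := (continuous_triRescale (c n) (σ n)).comp
      (continuous_triRestrict (Nat.le_add_right (M + 1) n))
    obtain ⟨r, hr⟩ := (isCompact_closedBall (0 : Tri (M + 1 + n)) ‖b n‖).exists_bound_of_continuousOn
      hc.continuousOn
    refine ⟨r, (ae_map_iff hc.aemeasurable (measurableSet_le (by fun_prop) (by fun_prop))).2 ?_⟩
    filter_upwards [ae_mem_normMeasure (w := cornersWt θ (b n)) (measurableSet_cornersDom (b n))]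
      with x hx using hr x (by simpa using norm_le_of_mem_cornersDom hx)
  exp_lim q hq := (integral_gbc_of_exp_bound hθ hm (by fun_prop) zero_le_one hq fun x => by
    rw [abs_of_pos (Real.exp_pos _), one_mul]).1
  tendsto := by
    rintro _ ⟨f, d, hf, rfl⟩
    refine (tendsto_integral_levelProd hθ hf hm hb hσ h).2.congr fun n => ?_
    refine Eq.trans ?_ (integral_map
      ((continuous_triRescale _ _).comp (continuous_triRestrict _)).aemeasurable
      (continuous_levelProd hf 0 1 _).aestronglyMeasurable).symm
    simp only [Function.comp_apply, levelProd_triRescale]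

/-- (Theorem 2.5) Multilevel universality: the rescaled bottom `m`
levels of the orbital beta process converge weakly to the Gaussian beta corners
process. -/
theorem orbital_beta_corners_to_GBC
    (θ : ℝ) (hθ : 0 < θ) (m : ℕ) (hm : 1 ≤ m)
    (a : (N : ℕ) → Fin N → ℝ) (μ : Measure ℝ)
    (hreg : RegularSeq a μ) (hvar : 0 < varM μ) :
    ∀ f : BoundedContinuousFunction (Tri m) ℝ,
      Tendsto (fun N : ℕ =>
          if h : m < N then
            ∫ v, f v ∂(Measure.map
              (fun x (k : Fin m) (i : Fin (k.1 + 1)) =>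
                (triProj m h x k i - N * meanM (empMeasure (a N))) /
                  Real.sqrt (N * varM μ))
              (obp θ (a N)))
          else 0)
        atTop (𝓝 (∫ v, f v ∂(gbc θ hm))) := by
  intro f
  obtain ⟨M, rfl⟩ : ∃ M, m = M + 1 := ⟨m - 1, by omega⟩
  have hshift : Tendsto (fun n : ℕ => M + 1 + n + 1) atTop atTop :=
    tendsto_atTop_mono (fun n => show n ≤ M + 1 + n + 1 by omega) tendsto_id
  have hσ (n : ℕ) : 0 < √(((M + 1 + n + 1 : ℕ) : ℝ) * varM μ) :=
    Real.sqrt_pos.2 (mul_pos (Nat.cast_pos.2 (Nat.succ_pos _)) hvar)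
  have hanti (n : ℕ) : StrictAnti (a (M + 1 + n + 1)) := hreg.1 _ (by omega)
  have key := (momentConv_corners hθ hm hanti (fun n => (hσ n).ne')
    (c := fun n => ((M + 1 + n + 1 : ℕ) : ℝ) * meanM (empMeasure (a (M + 1 + n + 1))))
    fun l hl => (hreg.tendsto_affPS hvar hl).comp hshift).tendsto_integral (fun n => ?_)
    ((ae_gbc θ hm).mono fun x hx k => (strictAnti_level_of_mem_triDomain hx k).antitone) f
  · have hN (n : ℕ) : n + (M + 2) = M + 1 + n + 1 := by omega
    have hu {u : ℕ → ℝ} {l : ℝ} (h : Tendsto (fun n => u (M + 1 + n + 1)) atTop (𝓝 l)) :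
        Tendsto u atTop (𝓝 l) :=
      (tendsto_add_atTop_iff_nat (M + 2)).1 (by simpa only [hN] using h)
    refine hu (key.congr fun n => ?_)
    rw [dif_pos (by omega)]
    rfl
  · refine (ae_map_iff ((continuous_triRescale _ _).comp (continuous_triRestrict _)).aemeasurable
      (isClosed_antitone_levels _).measurableSet).2 ?_
    filter_upwards [ae_mem_normMeasure (w := cornersWt θ (a (M + 1 + n + 1)))
      (measurableSet_cornersDom _)] with x hx k i j hij
    exact div_le_div_of_nonneg_right (sub_le_sub_right
      ((strictAnti_level_of_mem_cornersDom hx _).antitone hij) _) (hσ n).le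

end
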